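/- One has dim S_{26,2}(Γ₂,ε) = 1, dim S_{28,2}(Γ₂,ε) = 1, and dim S_{30,2}(Γ₂,ε) = 2. -/

import Mathlib

noncomputable section

open Matrix Complex Filter Topology

/-- The standard symplectic form matrix of size 4. -/
def J4 : Matrix (Fin 4) (Fin 4) ℤ := !![0,0,1,0; 0,0,0,1; -1,0,0,0; 0,-1,0,0]

/-- The Siegel modular group `Γ₂ = Sp(4,ℤ)`, as a set of 4×4 integer matrices. -/
def Sp4Z : Set (Matrix (Fin 4) (Fin 4) ℤ) := {γ | γᵀ * J4 * γ = J4}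

/-- The principal congruence subgroup `Γ₂[2]` of level 2. -/
def Sp4Z2 : Set (Matrix (Fin 4) (Fin 4) ℤ) :=
  {γ | γ ∈ Sp4Z ∧ ∀ i j, ((γ i j : ZMod 2) = if i = j then 1 else 0)}

/-- The Siegel upper half space of degree 2: symmetric 2×2 complex matrices with
positive definite imaginary part (encoded as functions `Fin 2 → Fin 2 → ℂ`). -/
def H2 : Set (Fin 2 → Fin 2 → ℂ) :=
  {τ | (Matrix.of τ).IsSymm ∧ (Matrix.of fun i j => (τ i j).im).PosDef}

/-- The four 2×2 blocks of a 4×4 integer matrix, as complex matrices. -/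
def blk (γ : Matrix (Fin 4) (Fin 4) ℤ) (r s : Fin 2) : Matrix (Fin 2) (Fin 2) ℂ :=
  Matrix.of fun i j =>
    ((γ ⟨2 * (r : ℕ) + (i : ℕ), by have h1 := r.isLt; have h2 := i.isLt; omega⟩
        ⟨2 * (s : ℕ) + (j : ℕ), by have h1 := s.isLt; have h2 := j.isLt; omega⟩ : ℤ) : ℂ)

/-- The factor `cτ + d`. -/
def den (γ : Matrix (Fin 4) (Fin 4) ℤ) (τ : Fin 2 → Fin 2 → ℂ) : Matrix (Fin 2) (Fin 2) ℂ :=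
  blk γ 1 0 * Matrix.of τ + blk γ 1 1

/-- The action `γ·τ = (aτ+b)(cτ+d)⁻¹` of `Sp(4)` on the Siegel upper half space. -/
def moeb (γ : Matrix (Fin 4) (Fin 4) ℤ) (τ : Fin 2 → Fin 2 → ℂ) : Fin 2 → Fin 2 → ℂ :=
  fun i j => ((blk γ 0 0 * Matrix.of τ + blk γ 0 1) * (den γ τ)⁻¹) i j

/-- Matrix coefficients of the `j`-th symmetric power of the standard representation of
`GL(2,ℂ)`, in the basis `x₁^(j-i) x₂^i`. -/
def symCoeff (j : ℕ) (m : Matrix (Fin 2) (Fin 2) ℂ) (l i : Fin (j + 1)) : ℂ :=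
  (((Polynomial.C (m 0 0) + Polynomial.C (m 1 0) * Polynomial.X) ^ (j - (l : ℕ)) *
    (Polynomial.C (m 0 1) + Polynomial.C (m 1 1) * Polynomial.X) ^ (l : ℕ)).coeff i)

/-- The `j`-th symmetric power `Sym^j(m)` acting on coordinate vectors. -/
def symAct (j : ℕ) (m : Matrix (Fin 2) (Fin 2) ℂ) (v : Fin (j + 1) → ℂ) : Fin (j + 1) → ℂ :=
  fun i => ∑ l, symCoeff j m l i * v l

lemma symAct_add (j : ℕ) (m : Matrix (Fin 2) (Fin 2) ℂ) (v w : Fin (j + 1) → ℂ) :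
    symAct j m (v + w) = symAct j m v + symAct j m w := by
  funext i
  simp [symAct, mul_add, Finset.sum_add_distrib]

lemma symAct_smul (j : ℕ) (m : Matrix (Fin 2) (Fin 2) ℂ) (a : ℂ) (v : Fin (j + 1) → ℂ) :
    symAct j m (a • v) = a • symAct j m v := by
  funext i
  simp only [symAct, Pi.smul_apply, smul_eq_mul, Finset.mul_sum]
  exact Finset.sum_congr rfl fun l _ => by ring

lemma symAct_zero (j : ℕ) (m : Matrix (Fin 2) (Fin 2) ℂ) : symAct j m 0 = 0 := by
  funext i; simp [symAct]

/-- The weight `(j,k)` automorphy action `Sym^j(m) ⊗ det(m)^k`. -/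
def wt (j : ℕ) (k : ℤ) (m : Matrix (Fin 2) (Fin 2) ℂ) (v : Fin (j + 1) → ℂ) :
    Fin (j + 1) → ℂ :=
  (m.det ^ k) • symAct j m v

lemma wt_add (j : ℕ) (k : ℤ) (m : Matrix (Fin 2) (Fin 2) ℂ) (v w : Fin (j + 1) → ℂ) :
    wt j k m (v + w) = wt j k m v + wt j k m w := by
  simp [wt, symAct_add, smul_add]

lemma wt_smul (j : ℕ) (k : ℤ) (m : Matrix (Fin 2) (Fin 2) ℂ) (a : ℂ) (v : Fin (j + 1) → ℂ) :
    wt j k m (a • v) = a • wt j k m v := by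
  rw [wt, wt, symAct_smul, smul_comm]

lemma wt_zero (j : ℕ) (k : ℤ) (m : Matrix (Fin 2) (Fin 2) ℂ) : wt j k m 0 = 0 := by
  simp [wt, symAct_zero]

/-- The slash operation `(F|γ)(τ) = Sym^j(cτ+d)⁻¹ det(cτ+d)⁻ᵏ F(γ·τ)`. -/
def slashS (j : ℕ) (k : ℤ) (γ : Matrix (Fin 4) (Fin 4) ℤ)
    (F : (Fin 2 → Fin 2 → ℂ) → (Fin (j + 1) → ℂ)) (τ : Fin 2 → Fin 2 → ℂ) :
    Fin (j + 1) → ℂ :=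
  ((den γ τ).det ^ (-k)) • symAct j ((den γ τ)⁻¹) (F (moeb γ τ))

lemma slashS_add (j : ℕ) (k : ℤ) (γ : Matrix (Fin 4) (Fin 4) ℤ)
    (F G : (Fin 2 → Fin 2 → ℂ) → (Fin (j + 1) → ℂ)) (τ : Fin 2 → Fin 2 → ℂ) :
    slashS j k γ (F + G) τ = slashS j k γ F τ + slashS j k γ G τ := by
  simp [slashS, symAct_add, smul_add]

lemma slashS_smul (j : ℕ) (k : ℤ) (γ : Matrix (Fin 4) (Fin 4) ℤ) (a : ℂ)
    (F : (Fin 2 → Fin 2 → ℂ) → (Fin (j + 1) → ℂ)) (τ : Fin 2 → Fin 2 → ℂ) :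
    slashS j k γ (a • F) τ = a • slashS j k γ F τ := by
  simp only [slashS, Pi.smul_apply, symAct_smul]
  rw [smul_comm]

lemma slashS_zero (j : ℕ) (k : ℤ) (γ : Matrix (Fin 4) (Fin 4) ℤ) (τ : Fin 2 → Fin 2 → ℂ) :
    slashS j k γ (0 : (Fin 2 → Fin 2 → ℂ) → (Fin (j + 1) → ℂ)) τ = 0 := by
  simp [slashS, symAct_zero]

/-- The diagonal point `diag(τ₁,τ₂)` of the Siegel upper half space. -/
def diagH (τ₁ τ₂ : ℂ) : Fin 2 → Fin 2 → ℂ :=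
  fun i j => if i = j then (if i = 0 then τ₁ else τ₂) else 0

/-- `F` is a Siegel cusp form of degree 2 and weight `(j,k)` on `Γ`, with character `χ`:
holomorphic on `ℍ₂`, transforming by `F(γ·τ) = χ(γ) Sym^j(cτ+d) det(cτ+d)^k F(τ)` for `γ ∈ Γ`,
with `(F|γ)(diag(τ₁,it)) → 0` as `t → ∞` for every `γ ∈ Γ₂`, and (normalization) vanishing
off `ℍ₂`. -/
def IsSiegelCuspForm (j : ℕ) (k : ℤ) (Γ : Set (Matrix (Fin 4) (Fin 4) ℤ))
    (χ : Matrix (Fin 4) (Fin 4) ℤ → ℂ)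
    (F : (Fin 2 → Fin 2 → ℂ) → (Fin (j + 1) → ℂ)) : Prop :=
  DifferentiableOn ℂ F H2 ∧
  (∀ γ ∈ Γ, ∀ τ ∈ H2, F (moeb γ τ) = χ γ • wt j k (den γ τ) (F τ)) ∧
  (∀ γ ∈ Sp4Z, ∀ τ₁ : ℂ, 0 < τ₁.im →
    Tendsto (fun t : ℝ => slashS j k γ F (diagH τ₁ (t * Complex.I))) atTop (𝓝 0)) ∧
  (∀ τ, τ ∉ H2 → F τ = 0)

/-- The space `S_{j,k}(Γ, χ)` of Siegel cusp forms of degree 2 and weight `(j,k)` on `Γ`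
with character `χ`, as a complex vector space. -/
def SiegelCusp (j : ℕ) (k : ℤ) (Γ : Set (Matrix (Fin 4) (Fin 4) ℤ))
    (χ : Matrix (Fin 4) (Fin 4) ℤ → ℂ) :
    Submodule ℂ ((Fin 2 → Fin 2 → ℂ) → (Fin (j + 1) → ℂ)) where
  carrier := {F | IsSiegelCuspForm j k Γ χ F}
  add_mem' := by
    rintro F G hF hG
    refine ⟨hF.1.add hG.1, ?_, ?_, ?_⟩
    · intro γ hγ τ hτ
      show F (moeb γ τ) + G (moeb γ τ) = χ γ • wt j k (den γ τ) (F τ + G τ)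
      rw [wt_add, smul_add, hF.2.1 γ hγ τ hτ, hG.2.1 γ hγ τ hτ]
    · intro γ hγ τ₁ hτ
      have h := (hF.2.2.1 γ hγ τ₁ hτ).add (hG.2.2.1 γ hγ τ₁ hτ)
      rw [add_zero] at h
      exact h.congr fun t => (slashS_add j k γ F G _).symm
    · intro τ hτ
      show F τ + G τ = 0
      rw [hF.2.2.2 τ hτ, hG.2.2.2 τ hτ, add_zero]
  zero_mem' := by
    refine ⟨?_, ?_, ?_, ?_⟩
    · exact differentiableOn_const 0
    · intro γ hγ τ hτ
      show (0 : Fin (j + 1) → ℂ) = χ γ • wt j k (den γ τ) 0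
      rw [wt_zero, smul_zero]
    · intro γ hγ τ₁ hτ
      have : (fun t : ℝ => slashS j k γ (0 : (Fin 2 → Fin 2 → ℂ) → (Fin (j + 1) → ℂ))
          (diagH τ₁ (t * Complex.I))) = fun _ => 0 := by
        funext t; exact slashS_zero j k γ _
      rw [this]
      exact tendsto_const_nhds
    · intro τ _; rfl
  smul_mem' := by
    rintro a F hF
    refine ⟨hF.1.const_smul a, ?_, ?_, ?_⟩
    · intro γ hγ τ hτ
      show a • F (moeb γ τ) = χ γ • wt j k (den γ τ) (a • F τ)
      rw [hF.2.1 γ hγ τ hτ, wt_smul, smul_comm]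
    · intro γ hγ τ₁ hτ
      have h := (hF.2.2.1 γ hγ τ₁ hτ).const_smul a
      rw [smul_zero] at h
      exact h.congr fun t => (slashS_smul j k γ a F _).symm
    · intro τ hτ
      show a • F τ = 0
      rw [hF.2.2.2 τ hτ, smul_zero]

/-- `ε` is (on `Γ₂`) the unique nontrivial homomorphism `Γ₂ → {±1}`. -/
def IsEps (ε : Matrix (Fin 4) (Fin 4) ℤ → ℂ) : Prop :=
  (∀ γ ∈ Sp4Z, ε γ = 1 ∨ ε γ = -1) ∧
  (∀ γ ∈ Sp4Z, ∀ δ ∈ Sp4Z, ε (γ * δ) = ε γ * ε δ) ∧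
  (∃ γ ∈ Sp4Z, ε γ ≠ 1)

open Finset (sum_add_distrib sum_congr sum_comm mem_filter mem_Icc sum_subset mem_range sum_eq_zero sum_range_succ' sum_range_succ sum_neg_distrib sum_insert sum_sub_distrib mem_product)
open Polynomial (eval_C)
open intervalIntegral (integral_congr norm_integral_le_of_norm_le_const integral_mul_const integral_neg integral_const_mul integral_smul integral_zero)
open Metric (mem_closedBall)
open Real (norm_eq_abs exp_pos pi_pos exp_le_exp pi_ne_zero abs_exp)
open Set (uIoc_subset_uIcc left_mem_uIcc ofPred_and)
open PowerSeries (coeff_mk coeff_mul coeff_C_mul)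
open Nat (choose_eq_zero_of_lt)
open ModularForm (eta_q)
open Prod (fst_add snd_add fst_swap snd_swap)
open Equiv (prodComm_apply coe_fn_mk)
notation "rexp" => Real.exp
notation:65 x:65 "⊹" => x + (1:ℝ) * I
notation "Vc" j:max => Fin (j + 1) → ℂ
notation "M4Z" => Matrix (Fin 4) (Fin 4) ℤ
notation "M2C" => Matrix (Fin 2) (Fin 2) ℂ

section
def gT : M4Z := !![1,0,1,0; 0,1,0,0; 0,0,1,0; 0,0,0,1]
def gS : M4Z := !![0,0,-1,0; 0,1,0,0; 1,0,0,0; 0,0,0,1]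
def gW : M4Z := !![0,1,0,0; 1,0,0,0; 0,0,0,1; 0,0,1,0]
def gU : M4Z := !![1,0,0,0; 1,1,0,0; 0,0,1,-1; 0,0,0,1]

inductive Gen : M4Z → Prop
  | one : Gen 1
  | step (g γ) : (g = gT ∨ g = gS ∨ g = gW ∨ g = gU) → Gen γ → Gen (g * γ)

lemma Gen.T {γ} (h : Gen γ) : Gen (gT * γ) := .step _ _ (by simp) h
lemma Gen.S {γ} (h : Gen γ) : Gen (gS * γ) := .step _ _ (by simp) h
lemma Gen.W {γ} (h : Gen γ) : Gen (gW * γ) := .step _ _ (by simp) h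
lemma Gen.U {γ} (h : Gen γ) : Gen (gU * γ) := .step _ _ (by simp) h

lemma genS_iff {γ} : Gen (gS * γ) ↔ Gen γ := by
  refine ⟨fun h => ?_, Gen.S⟩
  have := h.S.S.S
  simp only [← Matrix.mul_assoc] at this
  rwa [show gS * gS * gS * gS = 1 by decide, Matrix.one_mul] at this
lemma genT_iff {γ} : Gen (gT * γ) ↔ Gen γ := by
  refine ⟨fun h => ?_, Gen.T⟩
  have := h.S.T.S.T.S.S.S
  simp only [← Matrix.mul_assoc] at this
  rwa [show gS * gS * gS * gT * gS * gT * gS * gT = 1 by decide, Matrix.one_mul] at this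
lemma genW_iff {γ} : Gen (gW * γ) ↔ Gen γ := by
  refine ⟨fun h => ?_, Gen.W⟩
  have := h.W
  simp only [← Matrix.mul_assoc] at this
  rwa [show gW * gW = 1 by decide, Matrix.one_mul] at this
lemma genU_iff {γ} : Gen (gU * γ) ↔ Gen γ := by
  refine ⟨fun h => ?_, Gen.U⟩
  have := h.S.S.U.S.S
  simp only [← Matrix.mul_assoc] at this
  rwa [show gS * gS * gU * gS * gS * gU = 1 by decide, Matrix.one_mul] at this

lemma mem_T : gT ∈ Sp4Z := by show _ = _; decide
lemma mem_S : gS ∈ Sp4Z := by show _ = _; decide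
lemma mem_W : gW ∈ Sp4Z := by show _ = _; decide
lemma mem_U : gU ∈ Sp4Z := by show _ = _; decide
lemma spmul {γ δ} (h : γ ∈ Sp4Z) (h' : δ ∈ Sp4Z) : γ * δ ∈ Sp4Z := by
  show _ = _
  have h1 : γᵀ * J4 * γ = J4 := h
  have h2 : δᵀ * J4 * δ = J4 := h'
  rw [transpose_mul, show δᵀ * γᵀ * J4 * (γ * δ) = δᵀ * (γᵀ * J4 * γ) * δ by
    simp only [Matrix.mul_assoc], h1, h2]

lemma gT_mul (γ : M4Z) (k) :
    (gT * γ) 0 k = γ 0 k + γ 2 k ∧ (gT * γ) 1 k = γ 1 k ∧ (gT * γ) 2 k = γ 2 k ∧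
    (gT * γ) 3 k = γ 3 k := by
  simp [gT, Matrix.mul_apply, Fin.sum_univ_four]
lemma gS_mul (γ : M4Z) (k) :
    (gS * γ) 0 k = -γ 2 k ∧ (gS * γ) 1 k = γ 1 k ∧ (gS * γ) 2 k = γ 0 k ∧
    (gS * γ) 3 k = γ 3 k := by
  simp [gS, Matrix.mul_apply, Fin.sum_univ_four]
lemma gW_mul (γ : M4Z) (k) :
    (gW * γ) 0 k = γ 1 k ∧ (gW * γ) 1 k = γ 0 k ∧ (gW * γ) 2 k = γ 3 k ∧
    (gW * γ) 3 k = γ 2 k := by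
  simp [gW, Matrix.mul_apply, Fin.sum_univ_four]
lemma gU_mul (γ : M4Z) (k) :
    (gU * γ) 0 k = γ 0 k ∧ (gU * γ) 1 k = γ 0 k + γ 1 k ∧ (gU * γ) 2 k = γ 2 k - γ 3 k ∧
    (gU * γ) 3 k = γ 3 k := by
  simp [gU, Matrix.mul_apply, Fin.sum_univ_four, sub_eq_add_neg]

lemma sp_rel {γ : M4Z} (h : γ ∈ Sp4Z) (k l : Fin 4) :
    γ 0 k * γ 2 l + γ 1 k * γ 3 l - γ 2 k * γ 0 l - γ 3 k * γ 1 l = J4 k l := by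
  have h1 : γᵀ * J4 * γ = J4 := h
  rw [← h1]
  simp [J4, Matrix.mul_apply, Fin.sum_univ_four]
  ring

/-- reduce the pair (0,2) in column `k` to have zero in row 2, other rows unchanged -/
lemma red02 (k : Fin 4) : ∀ (n : ℕ) (γ : M4Z), γ ∈ Sp4Z →
    (γ 0 k).natAbs + (γ 2 k).natAbs = n →
    ∃ δ ∈ Sp4Z, (Gen δ → Gen γ) ∧ δ 2 k = 0 ∧ (∀ l, δ 1 l = γ 1 l ∧ δ 3 l = γ 3 l) ∧
      (∀ l, γ 0 l = 0 → γ 2 l = 0 → δ 0 l = 0 ∧ δ 2 l = 0) := by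
  intro n
  induction n using Nat.strong_induction_on with
  | _ n ih =>
    intro γ hγ hn
    by_cases h2 : γ 2 k = 0
    · exact ⟨γ, hγ, id, h2, by simp, by simp_all⟩
    by_cases h0 : γ 0 k = 0
    · refine ⟨gS * γ, spmul mem_S hγ, genS_iff.1, ?_, ?_, ?_⟩
      · rw [(gS_mul γ k).2.2.1, h0]
      · intro l; exact ⟨(gS_mul γ l).2.1, (gS_mul γ l).2.2.2⟩
      · intro l a b; simp [gS_mul, a, b]
    -- four possibilities for reduction
    have key : ∀ g, g ∈ Sp4Z → (Gen (g * γ) → Gen γ) →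
        ((g * γ) 0 k).natAbs + ((g * γ) 2 k).natAbs < n →
        (∀ l, (g * γ) 1 l = γ 1 l ∧ (g * γ) 3 l = γ 3 l) →
        (∀ l, γ 0 l = 0 → γ 2 l = 0 → (g * γ) 0 l = 0 ∧ (g * γ) 2 l = 0) →
        ∃ δ ∈ Sp4Z, (Gen δ → Gen γ) ∧ δ 2 k = 0 ∧ (∀ l, δ 1 l = γ 1 l ∧ δ 3 l = γ 3 l) ∧
      (∀ l, γ 0 l = 0 → γ 2 l = 0 → δ 0 l = 0 ∧ δ 2 l = 0) := by
      intro g hg hG hlt h13 h02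
      obtain ⟨δ, hδ, d1, d2, d3, d4⟩ := ih _ hlt (g * γ) (spmul hg hγ) rfl
      refine ⟨δ, hδ, fun h => hG (d1 h), d2, fun l => ?_, fun l a b => d4 l (h02 l a b).1 (h02 l a b).2⟩
      exact ⟨(d3 l).1.trans (h13 l).1, (d3 l).2.trans (h13 l).2⟩
    -- T: 0 += 2 ;  T⁻¹ = S T S T S⁻¹... : use gS*gS*gS*... forms
    have hTi : ∀ δ : M4Z, Gen (gS * gT * gS * gT * gS * δ) → Gen δ := by
      intro δ h
      simp only [Matrix.mul_assoc] at h
      exact genS_iff.1 (genT_iff.1 (genS_iff.1 (genT_iff.1 (genS_iff.1 h))))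
    have hSTS : ∀ δ : M4Z, Gen (gS * gT * gS * δ) → Gen δ := by
      intro δ h
      simp only [Matrix.mul_assoc] at h
      exact genS_iff.1 (genT_iff.1 (genS_iff.1 h))
    have mSTS : gS * gT * gS ∈ Sp4Z := spmul (spmul mem_S mem_T) mem_S
    have e1 : ∀ l, (gS * gT * gS * γ) 0 l = -γ 0 l ∧ (gS * gT * gS * γ) 1 l = γ 1 l ∧
        (gS * gT * gS * γ) 2 l = γ 0 l - γ 2 l ∧ (gS * gT * gS * γ) 3 l = γ 3 l := by
      intro l
      rw [show gS * gT * gS = !![-1,0,0,0; 0,1,0,0; 1,0,-1,0; 0,0,0,1] by decide]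
      simp [Matrix.mul_apply, Fin.sum_univ_four, sub_eq_add_neg]
    have e2 : ∀ l, (gS * gT * gS * gT * gS * γ) 0 l = - γ 0 l + γ 2 l ∧
        (gS * gT * gS * gT * gS * γ) 1 l = γ 1 l ∧
        (gS * gT * gS * gT * gS * γ) 2 l = - γ 2 l ∧
        (gS * gT * gS * gT * gS * γ) 3 l = γ 3 l := by
      intro l
      rw [show gS * gT * gS * gT * gS = !![-1,0,1,0; 0,1,0,0; 0,0,-1,0; 0,0,0,1] by decide]
      simp [Matrix.mul_apply, Fin.sum_univ_four]
    have m2 : gS * gT * gS * gT * gS ∈ Sp4Z := spmul (spmul mSTS mem_T) mem_S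
    have e4 : ∀ l, (gT * gS * gT * γ) 0 l = γ 0 l ∧ (gT * gS * gT * γ) 1 l = γ 1 l ∧
        (gT * gS * gT * γ) 2 l = γ 0 l + γ 2 l ∧ (gT * gS * gT * γ) 3 l = γ 3 l := by
      intro l
      rw [show gT * gS * gT = !![1,0,0,0; 0,1,0,0; 1,0,1,0; 0,0,0,1] by decide]
      simp [Matrix.mul_apply, Fin.sum_univ_four]
    by_cases hs : 0 < γ 0 k * γ 2 k
    · -- same sign
      have hsgn : (0 < γ 0 k ∧ 0 < γ 2 k) ∨ (γ 0 k < 0 ∧ γ 2 k < 0) := by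
        rcases lt_trichotomy (γ 0 k) 0 with h | h | h
        · right; exact ⟨h, by nlinarith⟩
        · exact absurd h h0
        · left; exact ⟨h, by nlinarith⟩
      by_cases hc : (γ 0 k).natAbs ≤ (γ 2 k).natAbs
      · refine key _ mSTS (hSTS γ) ?_ (fun l => ⟨(e1 l).2.1, (e1 l).2.2.2⟩) ?_
        · rw [(e1 k).1, (e1 k).2.2.1]; omega
        · intro l a b; rw [(e1 l).1, (e1 l).2.2.1, a, b]; simp
      · refine key _ m2 (hTi γ) ?_ (fun l => ⟨(e2 l).2.1, (e2 l).2.2.2⟩) ?_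
        · rw [(e2 k).1, (e2 k).2.2.1]; omega
        · intro l a b; rw [(e2 l).1, (e2 l).2.2.1, a, b]; simp
    · have hsgn : (0 < γ 0 k ∧ γ 2 k < 0) ∨ (γ 0 k < 0 ∧ 0 < γ 2 k) := by
        rcases lt_trichotomy (γ 0 k) 0 with h | h | h
        · right; exact ⟨h, lt_of_le_of_ne (by nlinarith) (Ne.symm h2)⟩
        · exact absurd h h0
        · left; exact ⟨h, lt_of_le_of_ne (by nlinarith) h2⟩
      by_cases hc : (γ 0 k).natAbs ≤ (γ 2 k).natAbs
      · refine key _ (spmul (spmul mem_T mem_S) mem_T) (fun h => ?_) ?_ (fun l => ⟨(e4 l).2.1, (e4 l).2.2.2⟩) ?_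
        · simp only [Matrix.mul_assoc] at h
          exact genT_iff.1 (genS_iff.1 (genT_iff.1 h))
        · rw [(e4 k).1, (e4 k).2.2.1]; omega
        · intro l a b; rw [(e4 l).1, (e4 l).2.2.1, a, b]; simp
      · refine key _ mem_T genT_iff.1 ?_ (fun l => ⟨(gT_mul γ l).2.1, (gT_mul γ l).2.2.2⟩) ?_
        · rw [(gT_mul γ k).1, (gT_mul γ k).2.2.1]; omega
        · intro l a b; simp [gT_mul, a, b]

lemma red13 (k : Fin 4) (γ : M4Z) (hγ : γ ∈ Sp4Z) :
    ∃ δ ∈ Sp4Z, (Gen δ → Gen γ) ∧ δ 3 k = 0 ∧ (∀ l, δ 0 l = γ 0 l ∧ δ 2 l = γ 2 l) ∧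
      (∀ l, γ 1 l = 0 → γ 3 l = 0 → δ 1 l = 0 ∧ δ 3 l = 0) := by
  obtain ⟨δ, h1, h2, h3, h4, h5⟩ := red02 k _ (gW * γ) (spmul mem_W hγ) rfl
  refine ⟨gW * δ, spmul mem_W h1, fun h => genW_iff.1 (h2 (genW_iff.1 h)), ?_, fun l => ?_, fun l a b => ?_⟩
  · simp [gW_mul, h3]
  · simp [gW_mul, h4]
  · have := h5 l; simp [gW_mul] at this ⊢; exact this a b

lemma redU : ∀ (n : ℕ) (γ : M4Z), γ ∈ Sp4Z → γ 2 0 = 0 → γ 3 0 = 0 →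
    (γ 0 0).natAbs + (γ 1 0).natAbs = n →
    ∃ δ ∈ Sp4Z, (Gen δ → Gen γ) ∧ δ 1 0 = 0 ∧ δ 2 0 = 0 ∧ δ 3 0 = 0 := by
  intro n
  induction n using Nat.strong_induction_on with
  | _ n ih =>
    intro γ hγ h2 h3 hn
    by_cases h1 : γ 1 0 = 0
    · exact ⟨γ, hγ, id, h1, h2, h3⟩
    by_cases h0 : γ 0 0 = 0
    · exact ⟨gW * γ, spmul mem_W hγ, genW_iff.1, by simp [gW_mul, h0], by simp [gW_mul, h3],
        by simp [gW_mul, h2]⟩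
    have key : ∀ g, g ∈ Sp4Z → (Gen (g * γ) → Gen γ) →
        ((g * γ) 0 0).natAbs + ((g * γ) 1 0).natAbs < n → (g * γ) 2 0 = 0 → (g * γ) 3 0 = 0 →
        ∃ δ ∈ Sp4Z, (Gen δ → Gen γ) ∧ δ 1 0 = 0 ∧ δ 2 0 = 0 ∧ δ 3 0 = 0 := by
      intro g hg hG hlt a b
      obtain ⟨δ, hδ, d1, d2⟩ := ih _ hlt (g * γ) (spmul hg hγ) a b rfl
      exact ⟨δ, hδ, fun h => hG (d1 h), d2⟩
    have hn' : ∀ δ, δ ∈ Sp4Z → (Gen δ → Gen γ) → δ 2 0 = 0 → δ 3 0 = 0 →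
        (δ 0 0).natAbs + (δ 1 0).natAbs = n → (δ 0 0).natAbs ≤ (δ 1 0).natAbs → δ 0 0 ≠ 0 →
        ∃ δ ∈ Sp4Z, (Gen δ → Gen γ) ∧ δ 1 0 = 0 ∧ δ 2 0 = 0 ∧ δ 3 0 = 0 := by
      intro δ hδ hG a b hs hle hne
      have aux : ∀ δ', δ' ∈ Sp4Z → (Gen δ' → Gen γ) → δ' 2 0 = 0 → δ' 3 0 = 0 →
        (δ' 0 0).natAbs + (δ' 1 0).natAbs < n →
        ∃ δ ∈ Sp4Z, (Gen δ → Gen γ) ∧ δ 1 0 = 0 ∧ δ 2 0 = 0 ∧ δ 3 0 = 0 := by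
        intro δ' hδ' hG' a' b' hlt
        obtain ⟨δ, hδ, d1, d2⟩ := ih _ hlt δ' hδ' a' b' rfl
        exact ⟨δ, hδ, fun h => hG' (d1 h), d2⟩
      by_cases hs' : (δ 0 0 + δ 1 0).natAbs < (δ 1 0).natAbs
      · refine aux (gU * δ) (spmul mem_U hδ) (fun h => hG (genU_iff.1 h)) ?_ ?_ ?_
        · simp [gU_mul, a, b]
        · simp [gU_mul, b]
        · rw [(gU_mul δ 0).1, (gU_mul δ 0).2.1]; omega
      · refine aux (gU * (gS * (gS * δ))) (spmul mem_U (spmul mem_S (spmul mem_S hδ)))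
          (fun h => hG (genS_iff.1 (genS_iff.1 (genU_iff.1 h)))) ?_ ?_ ?_
        · simp [gU_mul, gS_mul, a, b]
        · simp [gU_mul, gS_mul, b]
        · simp only [(gU_mul _ 0).1, (gU_mul _ 0).2.1, (gS_mul _ 0).1, (gS_mul _ 0).2.1, (gS_mul _ 0).2.2.1]
          omega
    by_cases hle : (γ 0 0).natAbs ≤ (γ 1 0).natAbs
    · exact hn' γ hγ id h2 h3 hn hle h0
    · refine hn' (gW * γ) (spmul mem_W hγ) genW_iff.1 (by simp [gW_mul, h3]) (by simp [gW_mul, h2]) ?_ ?_ ?_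
      · simp only [(gW_mul γ 0).1, (gW_mul γ 0).2.1]; omega
      · simp only [(gW_mul γ 0).1, (gW_mul γ 0).2.1]; omega
      · simp only [(gW_mul γ 0).1]; exact h1

def Nm (p s q y : ℤ) : M4Z :=
  !![1,p,s,q; 0,1,q-p*y,y; 0,0,1,0; 0,0,-p,1]

lemma genNm (p s q y : ℤ) : Gen (Nm p s q y) := by
  have i1 : ∀ p s q y, gT * Nm p s q y = Nm p (s+1) q y := by
    intro p s q y
    ext i j; fin_cases i <;> fin_cases j <;> simp [gT, Nm, Matrix.mul_apply, Fin.sum_univ_four]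
  have i2 : ∀ p s q y, gW * (gT * (gW * Nm p s q y)) = Nm p s q (y+1) := by
    intro p s q y
    rw [← Matrix.mul_assoc, ← Matrix.mul_assoc,
      show gW * gT * gW = !![1,0,0,0; 0,1,0,1; 0,0,1,0; 0,0,0,1] by decide]
    ext i j; fin_cases i <;> fin_cases j <;> simp [Nm, Matrix.mul_apply, Fin.sum_univ_four]
    ring
  have i3 : ∀ p s q y, gW * (gU * (gW * Nm p s q y)) = Nm (p+1) (s+(q-p*y)) (q+y) y := by
    intro p s q y
    rw [← Matrix.mul_assoc, ← Matrix.mul_assoc,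
      show gW * gU * gW = !![1,1,0,0; 0,1,0,0; 0,0,1,0; 0,0,-1,1] by decide]
    ext i j; fin_cases i <;> fin_cases j <;> simp [Nm, Matrix.mul_apply, Fin.sum_univ_four] <;> ring
  have i4 : ∀ p s q y, gU * (gT * (gS * (gS * (gU * (gS * (gS * Nm p s q y)))))) =
      Nm p (s+1-p) (q+1) (y+1) := by
    intro p s q y
    simp only [← Matrix.mul_assoc]
    rw [show gU * gT * gS * gS * gU * gS * gS = !![1,0,1,1; 0,1,1,1; 0,0,1,0; 0,0,0,1] by decide]
    ext i j; fin_cases i <;> fin_cases j <;> simp [Nm, Matrix.mul_apply, Fin.sum_univ_four] <;> ring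
  have j1 : ∀ p s q y, Gen (Nm p (s+1) q y) ↔ Gen (Nm p s q y) := by
    intro p s q y; rw [← i1]; exact genT_iff
  have j2 : ∀ p s q y, Gen (Nm p s q (y+1)) ↔ Gen (Nm p s q y) := by
    intro p s q y; rw [← i2, genW_iff, genT_iff, genW_iff]
  have j3 : ∀ p s q y, Gen (Nm (p+1) (s+(q-p*y)) (q+y) y) ↔ Gen (Nm p s q y) := by
    intro p s q y; rw [← i3, genW_iff, genU_iff, genW_iff]
  have j4 : ∀ p s q y, Gen (Nm p (s+1-p) (q+1) (y+1)) ↔ Gen (Nm p s q y) := by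
    intro p s q y; rw [← i4, genU_iff, genT_iff, genS_iff, genS_iff, genU_iff, genS_iff, genS_iff]
  have k1 : ∀ p s q y, Gen (Nm p s q y) ↔ Gen (Nm p 0 q y) := by
    intro p s q y
    induction s using Int.induction_on with
    | zero => rfl
    | succ i hi => rw [j1]; exact hi
    | pred i hi => rw [← hi, ← j1]; simp
  have k2 : ∀ p s q y, Gen (Nm p s q y) ↔ Gen (Nm p s q 0) := by
    intro p s q y
    induction y using Int.induction_on with
    | zero => rfl
    | succ i hi => rw [j2]; exact hi
    | pred i hi => rw [← hi, ← j2]; simp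
  have k4 : ∀ p q, Gen (Nm p 0 q 0) ↔ Gen (Nm p 0 0 0) := by
    intro p q
    induction q using Int.induction_on with
    | zero => rfl
    | succ i hi => rw [← hi, ← j4 p 0 i 0, k2, k1]; rw [k2 p _ _ (0+1), k1 p (0+1-p)]
    | pred i hi => rw [← hi, ← j4 p 0 (-i-1) 0, k2 p _ _ (0+1), k1 p (0+1-p)]; simp
  have k3 : ∀ p, Gen (Nm p 0 0 0) ↔ Gen (Nm 0 0 0 0) := by
    intro p
    induction p using Int.induction_on with
    | zero => rfl
    | succ i hi => rw [← hi, ← j3 i 0 0 0]; simp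
    | pred i hi => rw [← hi, ← j3 (-i-1) 0 0 0]; simp
  rw [k1, k2, k4, k3, show Nm 0 0 0 0 = 1 by decide]
  exact Gen.one

theorem gen_all (γ : M4Z) (hγ : γ ∈ Sp4Z) : Gen γ := by
  obtain ⟨γ1, m1, g1, a1, -, -⟩ := red02 0 _ γ hγ rfl
  obtain ⟨γ2, m2, g2, a2, b2, -⟩ := red13 0 γ1 m1
  obtain ⟨γ3, m3, g3, a3, b3, c3⟩ := redU _ γ2 m2 (by rw [(b2 0).2, a1]) a2 rfl
  refine g1 (g2 (g3 ?_))
  have h4 : ∃ δ ∈ Sp4Z, (Gen δ → Gen γ3) ∧ δ 0 0 = 1 ∧ δ 1 0 = 0 ∧ δ 2 0 = 0 ∧ δ 3 0 = 0 := by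
    have r := sp_rel m3 0 2
    simp [J4, a3, b3, c3] at r
    rcases Int.eq_one_or_neg_one_of_mul_eq_one r with h | h
    · exact ⟨γ3, m3, id, h, a3, b3, c3⟩
    · refine ⟨gS * (gS * γ3), spmul mem_S (spmul mem_S m3), fun h => genS_iff.1 (genS_iff.1 h), ?_⟩
      simp [gS_mul, a3, b3, c3, h]
  obtain ⟨γ4, m4, g4, a4, b4, c4, d4⟩ := h4
  refine g4 ?_
  obtain ⟨γ5, m5, g5, a5, b5, c5⟩ := red13 1 γ4 m4
  refine g5 ?_
  have h6 : ∃ δ ∈ Sp4Z, (Gen δ → Gen γ5) ∧ δ 0 0 = 1 ∧ δ 1 0 = 0 ∧ δ 2 0 = 0 ∧ δ 3 0 = 0 ∧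
      δ 1 1 = 1 ∧ δ 3 1 = 0 := by
    have r0 := sp_rel m5 0 1
    have r3 := sp_rel m5 0 3
    have r := sp_rel m5 1 3
    have e := c5 0 b4 d4
    have e2 : γ5 2 0 = 0 := by rw [(b5 0).2, c4]
    have e0 : γ5 0 0 = 1 := by rw [(b5 0).1, a4]
    simp [J4, e, e2, e0] at r0 r3
    simp [J4, r0, r3, a5] at r
    rcases Int.eq_one_or_neg_one_of_mul_eq_one r with h | h
    · exact ⟨γ5, m5, id, e0, e.1, e2, e.2, h, a5⟩
    · refine ⟨gW * (gS * (gS * (gW * γ5))), spmul mem_W (spmul mem_S (spmul mem_S (spmul mem_W m5))),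
        fun h => genW_iff.1 (genS_iff.1 (genS_iff.1 (genW_iff.1 h))), ?_⟩
      simp [gS_mul, gW_mul, e, e0, e2, h, a5]
  obtain ⟨γ6, m6, g6, a6, b6, c6, d6, e6, f6⟩ := h6
  refine g6 ?_
  have r01 := sp_rel m6 0 1
  have r02 := sp_rel m6 0 2
  have r03 := sp_rel m6 0 3
  have r13 := sp_rel m6 1 3
  have r12 := sp_rel m6 1 2
  have r23 := sp_rel m6 2 3
  simp [J4, a6, b6, c6, d6] at r01 r02 r03
  simp [J4, e6, f6, r01, r02, r03] at r13 r12
  simp [J4, r01, r02, r03, r13] at r23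
  have h32 : γ6 3 2 = -γ6 0 1 := by linarith
  rw [h32] at r23
  have : γ6 = Nm (γ6 0 1) (γ6 0 2) (γ6 0 3) (γ6 1 3) := by
    ext i j; fin_cases i <;> fin_cases j <;>
      simp [Nm, a6, b6, c6, d6, e6, f6, r01, r02, r03, r13] <;> linarith
  rw [this]; exact genNm _ _ _ _

lemma eps_vals (ε : M4Z → ℂ) (hε : IsEps ε) :
    ε 1 = 1 ∧ ε gT = -1 ∧ ε gS = -1 ∧ ε gW = -1 ∧ ε gU = -1 := by
  obtain ⟨h1, h2, γ0, hγ0, hne⟩ := hε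
  have m1 : (1 : M4Z) ∈ Sp4Z := by show _ = _; decide
  have e1 : ε 1 = 1 := by
    have := h2 1 m1 1 m1
    rw [Matrix.one_mul] at this
    rcases h1 1 m1 with h | h
    · exact h
    · rw [h] at this; norm_num at this
  have S := h1 _ mem_S
  have T := h1 _ mem_T
  have W := h1 _ mem_W
  have U := h1 _ mem_U
  have mm := @spmul
  have mST := mm mem_S mem_T
  -- (S T)^3 = S^2
  have q1 : ε gS * ε gT * ε gS * ε gT * ε gS * ε gT = ε gS * ε gS := by
    rw [← h2 _ mem_S _ mem_S, ← h2 _ mem_S _ mem_T, ← h2 _ mST _ mem_S, ← h2 _ (mm mST mem_S) _ mem_T,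
      ← h2 _ (mm (mm mST mem_S) mem_T) _ mem_S, ← h2 _ (mm (mm (mm mST mem_S) mem_T) mem_S) _ mem_T]
    congr 1; decide
  -- U T = (T (W T W) Z) U with Z = S2 conj of U
  have mWT := mm (mm mem_W mem_T) mem_W
  have mWS := mm (mm mem_W mem_S) mem_W
  have mWU := mm (mm mem_W mem_U) mem_W
  have eW : ∀ g, g ∈ Sp4Z → ε (gW * g * gW) = ε g := by
    intro g hg
    rw [h2 _ (mm mem_W hg) _ mem_W, h2 _ mem_W _ hg]
    rcases W with h | h <;> rw [h] <;> ring
  -- Z = translation by off-diagonal; relation  S * Z = V * S, V = W U W up to inverse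
  have hZ : ∃ Z ∈ Sp4Z, ε Z = ε gU ∧ gU * gT = gT * (gW * gT * gW) * Z * gU := by
    refine ⟨!![1,0,0,1; 0,1,1,0; 0,0,1,0; 0,0,0,1], by show _ = _; decide, ?_, by decide⟩
    have hz : (!![1,0,0,1; 0,1,1,0; 0,0,1,0; 0,0,0,1] : M4Z) ∈ Sp4Z := by
      show _ = _; decide
    have : ε (!![1,0,0,1; 0,1,1,0; 0,0,1,0; 0,0,0,1] * gS) = ε (gS * gU) := by congr 1; decide
    rw [h2 _ hz _ mem_S, h2 _ mem_S _ mem_U] at this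
    rcases S with h | h <;> rw [h] at this <;> simpa using this
  obtain ⟨Z, mZ, eZ, rZ⟩ := hZ
  have q2 : ε gU * ε gT = ε gT * ε gT * ε gU * ε gU := by
    rw [← h2 _ mem_U _ mem_T, rZ, h2 _ (mm (mm mem_T mWT) mZ) _ mem_U, h2 _ (mm mem_T mWT) _ mZ,
      h2 _ mem_T _ mWT, eW _ mem_T, eZ]
  -- W = product
  have q3 : ε gW = ε gU := by
    have mD := mm mem_S mem_S
    have r : gW * (gS * gS) = (gW * gU * gW) * (gS * gS) * gU * (gS * gS) * (gW * gU * gW) := by decide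
    have r' := congrArg ε r
    rw [h2 _ mem_W _ mD, h2 _ (mm (mm (mm mWU mD) mem_U) mD) _ mWU, h2 _ (mm (mm mWU mD) mem_U) _ mD,
      h2 _ (mm mWU mD) _ mem_U, h2 _ mWU _ mD, h2 _ mem_S _ mem_S, eW _ mem_U] at r'
    rcases S with h | h <;> rw [h] at r' <;> rcases U with h' | h' <;> rw [h'] at r' ⊢ <;> simpa using r'
  have key : ε gT = 1 → False := by
    intro hT
    have hS : ε gS = 1 := by rcases S with h | h <;> rw [h, hT] at q1 <;> norm_num at q1; exact h
    have hU : ε gU = 1 := by rcases U with h | h <;> rw [h, hT] at q2 <;> norm_num at q2; exact h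
    have hW : ε gW = 1 := q3.trans hU
    have : ∀ γ, Gen γ → γ ∈ Sp4Z ∧ ε γ = 1 := by
      intro γ h
      induction h with
      | one => exact ⟨m1, e1⟩
      | step g γ hg _ ih =>
        rcases hg with rfl | rfl | rfl | rfl
        · exact ⟨mm mem_T ih.1, by rw [h2 _ mem_T _ ih.1, hT, ih.2, one_mul]⟩
        · exact ⟨mm mem_S ih.1, by rw [h2 _ mem_S _ ih.1, hS, ih.2, one_mul]⟩
        · exact ⟨mm mem_W ih.1, by rw [h2 _ mem_W _ ih.1, hW, ih.2, one_mul]⟩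
        · exact ⟨mm mem_U ih.1, by rw [h2 _ mem_U _ ih.1, hU, ih.2, one_mul]⟩
    exact hne (this _ (gen_all _ hγ0)).2
  have hT : ε gT = -1 := T.resolve_left key
  have hS : ε gS = -1 := by rcases S with h | h <;> rw [h, hT] at q1 <;> norm_num at q1; exact h
  have hU : ε gU = -1 := by rcases U with h | h <;> rw [h, hT] at q2 <;> norm_num at q2; exact h
  exact ⟨e1, hT, hS, q3.trans hU, hU⟩
end

section
/-- evaluation of a coordinate vector as a binary form -/
def ev (j : ℕ) (v : Vc j) (x y : ℂ) : ℂ :=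
  ∑ l : Fin (j + 1), v l * (x ^ (j - (l : ℕ)) * y ^ (l : ℕ))

lemma ev_add (j) (v w) (x y) : ev j (v + w) x y = ev j v x y + ev j w x y := by
  simp [ev, add_mul, sum_add_distrib]
lemma ev_smul (j) (a : ℂ) (v) (x y) : ev j (a • v) x y = a * ev j v x y := by
  simp [ev, Finset.mul_sum, mul_assoc]
lemma ev_neg (j) (v) (x y) : ev j (-v) x y = - ev j v x y := by
  simp [ev]
lemma ev_zero (j) (x y) : ev j 0 x y = 0 := by
  simp [ev]

lemma ev_ext {j} {v w : Vc j} (h : ∀ y, ev j v 1 y = ev j w 1 y) : v = w := by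
  classical
  let P : (Vc j) → Polynomial ℂ := fun v => ∑ l : Fin (j + 1), Polynomial.monomial (l : ℕ) (v l)
  have hP : ∀ v y, (P v).eval y = ev j v 1 y := by
    intro v y
    simp [P, ev, Polynomial.eval_finsetSum, Polynomial.eval_monomial]
  have hc : ∀ v (i : Fin (j + 1)), (P v).coeff i = v i := by
    intro v i
    simp [P, Polynomial.finsetSum_coeff, Polynomial.coeff_monomial, Fin.val_inj]
  have : P v = P w := Polynomial.funext fun y => by rw [hP, hP, h]
  funext i
  rw [← hc v, ← hc w, this]

lemma ev_symAct (j) (m : M2C) (v) (x y : ℂ) :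
    ev j (symAct j m v) x y = ev j v (m 0 0 * x + m 1 0 * y) (m 0 1 * x + m 1 1 * y) := by
  have key : ∀ l : Fin (j + 1), ∑ i : Fin (j + 1), symCoeff j m l i * (x ^ (j - (i : ℕ)) * y ^ (i : ℕ))
      = (m 0 0 * x + m 1 0 * y) ^ (j - (l : ℕ)) * (m 0 1 * x + m 1 1 * y) ^ (l : ℕ) := by
    intro l
    have hcont : ∀ x : ℂ, x ≠ 0 → ∑ i : Fin (j + 1), symCoeff j m l i * (x ^ (j - (i : ℕ)) * y ^ (i : ℕ))
      = (m 0 0 * x + m 1 0 * y) ^ (j - (l : ℕ)) * (m 0 1 * x + m 1 1 * y) ^ (l : ℕ) := by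
      intro x hx
      set p := ((Polynomial.C (m 0 0) + Polynomial.C (m 1 0) * Polynomial.X) ^ (j - (l : ℕ)) *
    (Polynomial.C (m 0 1) + Polynomial.C (m 1 1) * Polynomial.X) ^ (l : ℕ)) with hp
      have hlin : ∀ a b : ℂ, (Polynomial.C a + Polynomial.C b * Polynomial.X).natDegree ≤ 1 := by
        intro a b
        compute_degree
      have hd : p.natDegree < j + 1 := by
        have h1 := Polynomial.natDegree_pow_le_of_le (j - (l : ℕ)) (hlin (m 0 0) (m 1 0))
        have h2 := Polynomial.natDegree_pow_le_of_le (l : ℕ) (hlin (m 0 1) (m 1 1))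
        have h3 := Polynomial.natDegree_mul_le_of_le h1 h2
        have := l.isLt
        rw [hp]; omega
      have h := Polynomial.eval_eq_sum_range' hd (y / x)
      have h' : x ^ j * p.eval (y / x) = (m 0 0 * x + m 1 0 * y) ^ (j - (l : ℕ)) * (m 0 1 * x + m 1 1 * y) ^ (l : ℕ) := by
        have : x ^ j = x ^ (j - (l : ℕ)) * x ^ (l : ℕ) := by
          rw [← pow_add]; congr 1; have := l.isLt; omega
        rw [hp, this]
        simp only [Polynomial.eval_mul, Polynomial.eval_pow, Polynomial.eval_add, eval_C,
          Polynomial.eval_X]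
        rw [mul_mul_mul_comm, ← mul_pow, ← mul_pow]
        congr 2 <;> field_simp
      rw [← h', h, Finset.mul_sum, ← Fin.sum_univ_eq_sum_range (fun i => x ^ j * (p.coeff i * (y / x) ^ i))]
      refine sum_congr rfl fun i _ => ?_
      have : x ^ j = x ^ (j - (i : ℕ)) * x ^ (i : ℕ) := by
        rw [← pow_add]; congr 1; have := i.isLt; omega
      rw [this, symCoeff, ← hp, div_pow]
      field_simp
    by_cases hx : x = 0
    · have := Continuous.ext_on (f := fun x : ℂ => ∑ i : Fin (j + 1), symCoeff j m l i * (x ^ (j - (i : ℕ)) * y ^ (i : ℕ)))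
        (g := fun x : ℂ => (m 0 0 * x + m 1 0 * y) ^ (j - (l : ℕ)) * (m 0 1 * x + m 1 1 * y) ^ (l : ℕ))
        (dense_compl_singleton (0 : ℂ)) (by fun_prop) (by fun_prop) (fun x hx => hcont x hx)
      exact congrFun this x
    · exact hcont x hx
  simp only [ev, symAct, Finset.sum_mul]
  rw [sum_comm]
  refine sum_congr rfl fun l _ => ?_
  rw [← key l, Finset.mul_sum]
  exact sum_congr rfl fun i _ => by ring

lemma symAct_mul (j) (m n : M2C) (v) :
    symAct j (m * n) v = symAct j m (symAct j n v) := by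
  refine ev_ext fun y => ?_
  simp only [ev_symAct, Matrix.mul_apply, Fin.sum_univ_two]
  congr 1 <;> ring

lemma symAct_one (j) (v) : symAct j 1 v = v := by
  refine ev_ext fun y => ?_
  simp [ev_symAct]

def mkH (t z s : ℂ) : Fin 2 → Fin 2 → ℂ := ![![t, z], ![z, s]]

lemma posDef_two (a b c : ℝ) : (Matrix.of ![![a, b], ![b, c]]).PosDef ↔ 0 < a ∧ b ^ 2 < a * c := by
  constructor
  · intro h
    have h1 := h.det_pos
    have h2 := h.diag_pos (i := 0)
    simp [det_fin_two] at h1 h2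
    exact ⟨h2, by nlinarith⟩
  · rintro ⟨ha, hb⟩
    refine Matrix.PosDef.of_dotProduct_mulVec_pos ?_ ?_
    · ext i j; fin_cases i <;> fin_cases j <;> simp
    · intro x hx
      simp [dotProduct, Matrix.mulVec, Fin.sum_univ_two]
      have hpos : 0 < a * (x 0 * (a * x 0 + b * x 1) + x 1 * (b * x 0 + c * x 1)) := by
        have e : a * (x 0 * (a * x 0 + b * x 1) + x 1 * (b * x 0 + c * x 1)) =
          (a * x 0 + b * x 1) ^ 2 + (a * c - b ^ 2) * x 1 ^ 2 := by ring
        rw [e]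
        by_cases h1 : x 1 = 0
        · have h0 : x 0 ≠ 0 := by
            intro h0; apply hx; funext i; fin_cases i <;> simp [h0, h1]
          rw [h1]; simp; positivity
        · have : 0 < a * c - b ^ 2 := by linarith
          positivity
      exact (pos_iff_pos_of_mul_pos hpos).1 ha

def DD (t z s : ℂ) : Prop := 0 < t.im ∧ z.im ^ 2 < t.im * s.im

lemma mkH_mem (t z s : ℂ) : mkH t z s ∈ H2 ↔ DD t z s := by
  have e : (Matrix.of fun i j => (mkH t z s i j).im) = Matrix.of ![![t.im, z.im], ![z.im, s.im]] := by
    ext i j; fin_cases i <;> fin_cases j <;> simp [mkH]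
  have e2 : (Matrix.of (mkH t z s)).IsSymm := by
    ext i j; fin_cases i <;> fin_cases j <;> simp [mkH]
  simp only [H2, Set.mem_ofPred_eq, e, posDef_two, e2, true_and, DD]

lemma eq_mk {τ} (h : τ ∈ H2) : τ = mkH (τ 0 0) (τ 0 1) (τ 1 1) := by
  have := h.1.apply 0 1
  simp at this
  ext i j; fin_cases i <;> fin_cases j <;> simp [mkH, this]

lemma DD.pos {t z s} (h : DD t z s) : 0 < t.im ∧ 0 < s.im := by
  refine ⟨h.1, ?_⟩
  have := h.2
  by_contra h'
  nlinarith [sq_nonneg z.im, h.1]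

lemma den_T (τ) : den gT τ = 1 := by
  ext i j; fin_cases i <;> fin_cases j <;> simp [den, blk, gT, Matrix.mul_apply, Fin.sum_univ_two]
lemma den_W (τ) : den gW τ = !![0,1;1,0] := by
  ext i j; fin_cases i <;> fin_cases j <;> simp [den, blk, gW, Matrix.mul_apply, Fin.sum_univ_two]
lemma den_U (τ) : den gU τ = !![1,-1;0,1] := by
  ext i j; fin_cases i <;> fin_cases j <;> simp [den, blk, gU, Matrix.mul_apply, Fin.sum_univ_two]
lemma den_S (t z s) : den gS (mkH t z s) = !![t,z;0,1] := by
  ext i j; fin_cases i <;> fin_cases j <;> simp [den, blk, gS, mkH, Matrix.mul_apply, Fin.sum_univ_two]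

lemma moeb_T (t z s) : moeb gT (mkH t z s) = mkH (t + 1) z s := by
  ext i j; fin_cases i <;> fin_cases j <;>
    (simp only [moeb, den_T]; simp [blk, gT, mkH, Matrix.mul_apply, Fin.sum_univ_two])
lemma moeb_W (t z s) : moeb gW (mkH t z s) = mkH s z t := by
  ext i j; fin_cases i <;> fin_cases j <;>
    (simp only [moeb, den_W]; simp [blk, gW, mkH, Matrix.mul_apply, Fin.sum_univ_two, Matrix.inv_def, det_fin_two,
      adjugate_fin_two])
lemma moeb_U (t z s) : moeb gU (mkH t z s) = mkH t (z + t) (s + 2 * z + t) := by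
  ext i j; fin_cases i <;> fin_cases j <;>
    (simp only [moeb, den_U]; simp [blk, gU, mkH, Matrix.mul_apply, Fin.sum_univ_two, Matrix.inv_def, det_fin_two,
      adjugate_fin_two]) <;> ring
lemma moeb_S (t z s) (ht : t ≠ 0) : moeb gS (mkH t z s) = mkH (-1 / t) (z / t) (s - z ^ 2 / t) := by
  ext i j; fin_cases i <;> fin_cases j <;>
    (simp only [moeb, den_S]; simp [blk, gS, mkH, Matrix.mul_apply, Fin.sum_univ_two, Matrix.inv_def, det_fin_two,
      adjugate_fin_two]) <;> field_simp <;> ring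

lemma DD.ne {t z s} (h : DD t z s) : t ≠ 0 := by
  rintro rfl; simpa using h.1
lemma DD.T {t z s} (h : DD t z s) : DD (t + 1) z s := by simpa [DD] using h
lemma DD.W {t z s} (h : DD t z s) : DD s z t := ⟨h.pos.2, by have := h.2; linarith⟩
lemma DD.U {t z s} (h : DD t z s) : DD t (z + t) (s + 2 * z + t) := by
  refine ⟨h.1, ?_⟩
  have := h.2
  simp; nlinarith
lemma DD.S {t z s} (h : DD t z s) : DD (-1 / t) (z / t) (s - z ^ 2 / t) := by
  have hn : 0 < t.re ^ 2 + t.im ^ 2 := by have := h.1; positivity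
  have h1 : (-1 / t).im = t.im / (t.re ^ 2 + t.im ^ 2) := by
    simp [Complex.div_im, normSq_apply]; ring
  refine ⟨by rw [h1]; have := h.1; positivity, ?_⟩
  have h2 : (z / t).im = (z.im * t.re - z.re * t.im) / (t.re ^ 2 + t.im ^ 2) := by
    simp [Complex.div_im, normSq_apply]; ring
  have h3 : (s - z ^ 2 / t).im = s.im - (2 * z.re * z.im * t.re - (z.re ^ 2 - z.im ^ 2) * t.im) / (t.re ^ 2 + t.im ^ 2) := by
    simp [Complex.div_im, normSq_apply, pow_two]; ring
  rw [h1, h2, h3, ← sub_pos]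
  have : t.im / (t.re ^ 2 + t.im ^ 2) * (s.im - (2 * z.re * z.im * t.re - (z.re ^ 2 - z.im ^ 2) * t.im) / (t.re ^ 2 + t.im ^ 2))
    - ((z.im * t.re - z.re * t.im) / (t.re ^ 2 + t.im ^ 2)) ^ 2 = (t.im * s.im - z.im ^ 2) / (t.re ^ 2 + t.im ^ 2) := by
    field_simp; ring
  rw [this]
  have := h.2
  exact div_pos (by linarith) hn

/-- the four generating laws -/
structure Laws (j : ℕ) (f : ℂ → ℂ → ℂ → Vc j) : Prop where
  T : ∀ t z s, DD t z s → f (t + 1) z s = - f t z s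
  W : ∀ t z s, DD t z s → ∀ x y, ev j (f s z t) x y = - ev j (f t z s) y x
  U : ∀ t z s, DD t z s → ∀ x y, ev j (f t (z + t) (s + 2 * z + t)) x y = - ev j (f t z s) x (y - x)
  S : ∀ t z s, DD t z s → ∀ x y, ev j (f (-1 / t) (z / t) (s - z ^ 2 / t)) x y =
    - t ^ 2 * ev j (f t z s) (t * x) (y + z * x)

lemma laws_of_form {j : ℕ} {ε} (hε : IsEps ε) {F} (hF : IsSiegelCuspForm j 2 Sp4Z ε F) :
    Laws j (fun t z s => F (mkH t z s)) := by
  obtain ⟨-, eT, eS, eW, eU⟩ := eps_vals ε hε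
  have L := hF.2.1
  refine ⟨fun t z s h => ?_, fun t z s h x y => ?_, fun t z s h x y => ?_, fun t z s h x y => ?_⟩
  · have := L gT mem_T _ ((mkH_mem _ _ _).2 h)
    rw [moeb_T, eT, wt, den_T, symAct_one] at this
    simpa using this
  · have := L gW mem_W _ ((mkH_mem _ _ _).2 h)
    rw [moeb_W, eW, wt, den_W] at this
    simp [det_fin_two] at this
    rw [this, ev_neg, ev_symAct]; simp
  · have := L gU mem_U _ ((mkH_mem _ _ _).2 h)
    rw [moeb_U, eU, wt, den_U] at this
    simp [det_fin_two] at this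
    rw [this, ev_neg, ev_symAct]; simp; congr 1; ring
  · have := L gS mem_S _ ((mkH_mem _ _ _).2 h)
    rw [moeb_S _ _ _ h.ne, eS, wt, den_S] at this
    simp [det_fin_two] at this
    rw [this, ev_neg, ev_smul, ev_symAct]; simp
    rw [add_comm (z * x)]; left; norm_cast

lemma den_mul (g γ : M4Z) (τ) (h : IsUnit (den γ τ).det) :
    den (g * γ) τ = den g (moeb γ τ) * den γ τ ∧
    moeb (g * γ) τ = fun i k => ((blk g 0 0 * Matrix.of (moeb γ τ) + blk g 0 1) * den γ τ * (den (g * γ) τ)⁻¹) i k := by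
  have hb : ∀ r s, blk (g * γ) r s = blk g r 0 * blk γ 0 s + blk g r 1 * blk γ 1 s := by
    intro r s
    ext i k
    simp [blk, Matrix.mul_apply, Fin.sum_univ_four, Fin.sum_univ_two]
    ring
  have hm : Matrix.of (moeb γ τ) * den γ τ = blk γ 0 0 * Matrix.of τ + blk γ 0 1 := by
    have : Matrix.of (moeb γ τ) = (blk γ 0 0 * Matrix.of τ + blk γ 0 1) * (den γ τ)⁻¹ := rfl
    rw [this, Matrix.mul_assoc, nonsing_inv_mul _ h, Matrix.mul_one]
  have key : ∀ r, (blk g r 0 * Matrix.of (moeb γ τ) + blk g r 1) * den γ τ =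
      blk (g * γ) r 0 * Matrix.of τ + blk (g * γ) r 1 := by
    intro r
    rw [Matrix.add_mul, Matrix.mul_assoc, hm, hb, hb, den]
    simp only [Matrix.mul_add, Matrix.add_mul, Matrix.mul_assoc]
    abel
  refine ⟨(key 1).symm, ?_⟩
  funext i k
  rw [key 0]; rfl

/-- The generating laws imply the full law. -/
lemma full_of_laws {j : ℕ} {ε} (hε : IsEps ε) {F : (Fin 2 → Fin 2 → ℂ) → (Vc j)}
    (L : Laws j (fun t z s => F (mkH t z s))) :
    ∀ γ ∈ Sp4Z, ∀ τ ∈ H2, IsUnit (den γ τ).det ∧ moeb γ τ ∈ H2 ∧ F (moeb γ τ) = ε γ • wt j 2 (den γ τ) (F τ) := by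
  obtain ⟨e1, eT, eS, eW, eU⟩ := eps_vals ε hε
  have base : ∀ g, (g = gT ∨ g = gS ∨ g = gW ∨ g = gU) → ∀ τ ∈ H2, g ∈ Sp4Z ∧ IsUnit (den g τ).det ∧ moeb g τ ∈ H2 ∧
      F (moeb g τ) = ε g • wt j 2 (den g τ) (F τ) := by
    intro g hg τ hτ
    obtain ⟨t, z, s, rfl⟩ : ∃ t z s, τ = mkH t z s := ⟨_, _, _, eq_mk hτ⟩
    have h := (mkH_mem _ _ _).1 hτ
    rcases hg with rfl | rfl | rfl | rfl
    · refine ⟨mem_T, by simp [den_T], by rw [moeb_T, mkH_mem]; exact h.T, ?_⟩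
      rw [moeb_T, L.T _ _ _ h, eT, wt, den_T, symAct_one]; simp
    · refine ⟨mem_S, by simp [den_S, det_fin_two, h.ne], by rw [moeb_S _ _ _ h.ne, mkH_mem]; exact h.S, ?_⟩
      rw [moeb_S _ _ _ h.ne]
      refine ev_ext fun y => ?_
      rw [L.S _ _ _ h, eS, wt, den_S]
      simp [ev_neg, ev_smul, ev_symAct, det_fin_two]
      rw [add_comm y]; left; norm_cast
    · refine ⟨mem_W, by simp [den_W, det_fin_two], by rw [moeb_W, mkH_mem]; exact h.W, ?_⟩
      rw [moeb_W]
      refine ev_ext fun y => ?_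
      rw [L.W _ _ _ h, eW, wt, den_W]
      simp [ev_neg, ev_symAct, det_fin_two]
    · refine ⟨mem_U, by simp [den_U, det_fin_two], by rw [moeb_U, mkH_mem]; exact h.U, ?_⟩
      rw [moeb_U]
      refine ev_ext fun y => ?_
      rw [L.U _ _ _ h, eU, wt, den_U]
      simp [ev_neg, ev_symAct, det_fin_two]
      congr 1; ring
  have m1 : (1 : M4Z) ∈ Sp4Z := by show _ = _; decide
  have all : ∀ γ, Gen γ → γ ∈ Sp4Z ∧ ∀ τ ∈ H2, IsUnit (den γ τ).det ∧ moeb γ τ ∈ H2 ∧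
      F (moeb γ τ) = ε γ • wt j 2 (den γ τ) (F τ) := by
    intro γ hγ
    induction hγ with
    | one =>
      refine ⟨m1, fun τ hτ => ?_⟩
      have d1 : den 1 τ = 1 := by
        ext i k; fin_cases i <;> fin_cases k <;> simp [den, blk, Matrix.mul_apply, Fin.sum_univ_two, Matrix.one_apply]
      have mo : moeb 1 τ = τ := by
        funext i k; fin_cases i <;> fin_cases k <;>
          simp [moeb, d1, blk, Matrix.mul_apply, Fin.sum_univ_two, Matrix.one_apply]
      rw [d1, mo, e1, wt, symAct_one]; simp [hτ]
    | step g γ hg _ ih =>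
      refine ⟨spmul (base g hg _ ((mkH_mem Complex.I 0 Complex.I).2 (by simp [DD]))).1 ih.1, fun τ hτ => ?_⟩
      obtain ⟨u1, u2, u3⟩ := ih.2 τ hτ
      obtain ⟨b0, b1, b2, b3⟩ := base g hg _ u2
      obtain ⟨k1, k2⟩ := den_mul g γ τ u1
      have hmo : moeb (g * γ) τ = moeb g (moeb γ τ) := by
        rw [k2, k1]
        funext i k
        rw [Matrix.mul_inv_rev, Matrix.mul_assoc, ← Matrix.mul_assoc (den γ τ), mul_nonsing_inv _ u1, Matrix.one_mul]
        rfl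
      refine ⟨by rw [k1, det_mul]; exact b1.mul u1, by rw [hmo]; exact b2, ?_⟩
      rw [hmo, b3, u3, k1, hε.2.1 _ b0 _ ih.1, wt, wt, wt, symAct_mul, symAct_smul, symAct_smul, det_mul, mul_zpow]
      simp only [smul_smul]
      congr 1; ring
  intro γ hγ τ hτ
  exact (all γ (gen_all γ hγ)).2 τ hτ
end

section
section ana
variable {E : Type*} [NormedAddCommGroup E] [NormedSpace ℂ E] [CompleteSpace E]

/-- period integral is independent of the base point -/
lemma per_int {g : ℂ → E} {A : ℝ} (hd : ∀ w : ℂ, A < w.im → DifferentiableAt ℂ g w)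
    (hp : ∀ w : ℂ, A < w.im → g (w + 1) = g w) (c : ℂ) (hc : A < c.im) (Y : ℝ) (hY : A < Y) :
    ∫ x in (0:ℝ)..1, g (c + x) = ∫ x in (0:ℝ)..1, g (x + Y * I) := by
  have h1 := integral_boundary_rect_eq_zero_of_differentiableOn g (0 + c.im * I) (1 + Y * I) (by
    intro w hw
    refine (hd w ?_).differentiableWithinAt
    have : w.im ∈ Set.uIcc c.im Y := by simpa using hw.2
    rcases Set.mem_uIcc.1 this with h | h <;> linarith [h.1])
  have h2 : ∀ y ∈ Set.uIcc c.im Y, g ((1:ℝ) + y * I) = g ((0:ℝ) + y * I) := by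
    intro y hy
    rw [← hp ((0:ℝ) + y * I)]
    · congr 1; push_cast; ring
    · simp only [add_im, ofReal_im, mul_im, ofReal_re, I_im, I_re]
      rcases Set.mem_uIcc.1 hy with h | h <;> linarith [h.1]
  have e1 : ((0:ℂ) + c.im * I).re = 0 := by simp
  have e2 : ((1:ℂ) + Y * I).re = 1 := by simp
  have e3 : ((0:ℂ) + c.im * I).im = c.im := by simp
  have e4 : ((1:ℂ) + Y * I).im = Y := by simp
  rw [e1, e2, e3, e4, integral_congr h2] at h1
  have h3 : ∫ x in (0:ℝ)..1, g (x + c.im * I) = ∫ x in (0:ℝ)..1, g (x + Y * I) := by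
    rw [add_sub_cancel_right] at h1
    exact sub_eq_zero.1 h1
  rw [← h3]
  have hper : Function.Periodic (fun x : ℝ => g (x + c.im * I)) 1 := by
    intro x
    show g (((x + 1 : ℝ) : ℂ) + c.im * I) = g (x + c.im * I)
    rw [← hp (x + c.im * I) (by simpa using hc)]
    congr 1; push_cast; ring
  have h4 := hper.intervalIntegral_add_eq 0 c.re
  rw [zero_add] at h4
  rw [h4]
  have h5 := intervalIntegral.integral_comp_add_right (a := 0) (b := 1) (fun x : ℝ => g (x + c.im * I)) c.re
  rw [zero_add, add_comm 1 c.re] at h5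
  rw [← h5]
  refine integral_congr fun x _ => ?_
  show g (c + x) = g (((x + c.re : ℝ) : ℂ) + c.im * I)
  congr 1
  conv_lhs => rw [← re_add_im c]
  push_cast; ring

/-- parametric integral: holomorphy -/
lemma par_diff {f : ℂ → ℝ → E} {U : Set ℂ} (hU : IsOpen U)
    (hc : ContinuousOn (Function.uncurry f) (U ×ˢ Set.univ))
    (hd : ∀ x, ∀ p ∈ U, DifferentiableAt ℂ (fun p => f p x) p) (a b : ℝ) :
    ∀ p ∈ U, DifferentiableAt ℂ (fun p => ∫ x in a..b, f p x) p := by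
  intro p hp
  obtain ⟨r, hr, hrU⟩ := Metric.nhds_basis_closedBall.mem_iff.1 (hU.mem_nhds hp)
  have hcx : ∀ p ∈ U, Continuous (f p) := by
    intro p hp
    have := hc.comp_continuous (f := fun x : ℝ => (p, x)) (by fun_prop) (fun x => ⟨hp, trivial⟩)
    exact this
  obtain ⟨M, hM⟩ := ((isCompact_closedBall p r).prod (isCompact_uIcc (a := a) (b := b))).exists_bound_of_continuousOn
    (hc.mono (Set.prod_mono hrU (Set.subset_univ _)))
  have hr2 : 0 < r / 2 := by linarith
  have key := intervalIntegral.hasDerivAt_integral_of_dominated_loc_of_deriv_le (μ := MeasureTheory.volume)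
    (F := f) (F' := fun p x => deriv (fun p => f p x) p) (x₀ := p) (s := Metric.ball p (r/2)) (a := a) (b := b)
    (bound := fun _ => M / (r / 2)) (Metric.ball_mem_nhds p hr2)
    (by
      filter_upwards [hU.mem_nhds hp] with x hx
      exact (hcx x hx).aestronglyMeasurable)
    ((hcx p hp).intervalIntegrable _ _)
    (by
      refine aestronglyMeasurable_of_tendsto_ae (u := atTop) (f := fun (n : ℕ) x => ((r / ((n:ℝ) + 1) : ℝ) : ℂ)⁻¹ • (f (p + ((r / ((n:ℝ) + 1) : ℝ) : ℂ)) x - f p x)) ?_ ?_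
      · intro n
        have h1 : p + ((r / ((n:ℝ) + 1) : ℝ) : ℂ) ∈ U := by
          apply hrU
          rw [mem_closedBall, dist_eq_norm, add_sub_cancel_left, norm_real, norm_eq_abs,
            abs_of_nonneg (by positivity)]
          exact div_le_self hr.le (by linarith [n.cast_nonneg (α := ℝ)])
        exact (((hcx _ h1).sub (hcx _ hp)).const_smul _).aestronglyMeasurable
      · refine Eventually.of_forall fun x => ?_
        refine (hd x p hp).hasDerivAt.tendsto_slope_zero.comp (f := fun n : ℕ => ((r / ((n:ℝ) + 1) : ℝ) : ℂ)) ?_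
        refine tendsto_nhdsWithin_iff.2 ⟨?_, Eventually.of_forall fun n => ?_⟩
        · have : Tendsto (fun n : ℕ => r / ((n:ℝ) + 1)) atTop (𝓝 0) := tendsto_const_div_atTop_nhds_zero_nat r |>.comp (tendsto_add_atTop_nat 1) |>.congr (by intro n; simp)
          have h2 := (continuous_ofReal.tendsto 0).comp this
          rw [ofReal_zero] at h2
          exact h2
        · have : r / ((n:ℝ) + 1) ≠ 0 := by positivity
          exact ofReal_ne_zero.2 this)
    (by
      refine Eventually.of_forall fun x hx q hq => ?_
      have hq' : dist q p < r / 2 := hq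
      refine norm_deriv_le_of_forall_mem_sphere_norm_le hr2 ?_ ?_
      · refine DifferentiableOn.diffContOnCl fun w hw => (hd x w (hrU ?_)).differentiableWithinAt
        have : dist w q ≤ r / 2 := Metric.closure_ball_subset_closedBall hw
        have := dist_triangle w q p
        rw [mem_closedBall]; linarith
      · intro w hw
        refine hM (w, x) ⟨?_, uIoc_subset_uIcc hx⟩
        have : dist w q = r / 2 := hw
        have := dist_triangle w q p
        rw [mem_closedBall]; linarith)
    (by simp)
    (by
      refine Eventually.of_forall fun x hx q hq => ?_
      refine (hd x q (hrU ?_)).hasDerivAt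
      exact Metric.ball_subset_closedBall (Metric.ball_subset_ball (by linarith) hq))
  exact key.2.differentiableAt

lemma par_cont {X : Type*} [TopologicalSpace X] [FirstCountableTopology X] {f : X → ℝ → E} {U : Set X} (hU : IsOpen U)
    (hc : ContinuousOn (Function.uncurry f) (U ×ˢ Set.univ)) (a b : ℝ) :
    ContinuousOn (fun p => ∫ x in a..b, f p x) U := by
  rw [continuousOn_iff_continuous_domRestrict]
  have h : Continuous (Function.uncurry fun (p : U) x => f p x) :=
    hc.comp_continuous (f := fun q : U × ℝ => ((q.1 : X), q.2)) (by fun_prop) (fun q => ⟨q.1.2, trivial⟩)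
  exact intervalIntegral.continuous_parametric_intervalIntegral_of_continuous' h a b

lemma fub {f : ℝ → ℝ → E} (hc : Continuous (Function.uncurry f)) :
    ∫ x in (0:ℝ)..1, ∫ y in (0:ℝ)..1, f x y = ∫ y in (0:ℝ)..1, ∫ x in (0:ℝ)..1, f x y := by
  refine MeasureTheory.intervalIntegral_intervalIntegral_swap ?_
  refine (hc.continuousOn.integrableOn_compact ((isCompact_uIcc (a := (0:ℝ)) (b := 1)).prod (isCompact_uIcc (a := (0:ℝ)) (b := 1)))).mono_set ?_
  exact Set.prod_mono uIoc_subset_uIcc uIoc_subset_uIcc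
end ana
end

section
def qq (N : ℤ) (w : ℂ) : ℂ := cexp (Real.pi * I * N * w)
lemma qq_idx (N M : ℤ) (w) : qq (N + M) w = qq N w * qq M w := by
  simp only [qq, ← exp_add]; congr 1; push_cast; ring
lemma qq_add (N : ℤ) (w v) : qq N (w + v) = qq N w * qq N v := by
  simp only [qq, ← exp_add]; congr 1; ring
lemma qq_zero (w) : qq 0 w = 1 := by simp [qq]
lemma qq_at (N) : qq N 0 = 1 := by simp [qq]
lemma qq_ne (N w) : qq N w ≠ 0 := exp_ne_zero _
lemma qq_neg (N w) : qq (-N) w * qq N w = 1 := by rw [← qq_idx]; simp [qq_zero]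
lemma qq_neg' (N w) : qq N w * qq (-N) w = 1 := by rw [← qq_idx]; simp [qq_zero]
lemma norm_qq (N : ℤ) (w) : ‖qq N w‖ = rexp (-(Real.pi * N * w.im)) := by
  rw [qq, norm_exp]; congr 1; simp [mul_assoc]
lemma qq_even (n : ℤ) : qq (2 * n) 1 = 1 := by
  rw [qq, exp_eq_one_iff]; exact ⟨n, by push_cast; ring⟩
lemma qq_one : qq 1 1 = -1 := by simp [qq, exp_pi_mul_I]
lemma qq_odd {N : ℤ} (h : Odd N) : qq N 1 = -1 := by
  obtain ⟨n, rfl⟩ := h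
  rw [qq_idx, qq_even, qq_one]; ring
lemma qq_diff (N) : Differentiable ℂ (qq N) := by unfold qq; fun_prop
@[fun_prop] lemma qq_cont (N) : Continuous (qq N) := (qq_diff N).continuous

/-- Fourier coefficient bound -/
lemma co_bound {g : ℂ → ℂ} {Y : ℝ} (hc : ContinuousOn g {w | w.im = Y}) :
    ∃ C : ℝ, 0 ≤ C ∧ ∀ N : ℤ, ‖∫ x in (0:ℝ)..1, g (x + Y * I) * qq (-N) (x + Y * I)‖ ≤ C * rexp (Real.pi * N * Y) := by
  have h1 : Continuous (fun x : ℝ => g (x + Y * I)) := hc.comp_continuous (by fun_prop) (by intro x; simp)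
  obtain ⟨C, hC⟩ := (isCompact_uIcc (a := (0:ℝ)) (b := 1)).exists_bound_of_continuousOn h1.continuousOn
  refine ⟨C, (norm_nonneg _).trans (hC 0 left_mem_uIcc), fun N => ?_⟩
  refine (norm_integral_le_of_norm_le_const (C := C * rexp (Real.pi * N * Y)) fun x hx => ?_).trans (by simp)
  rw [norm_mul, norm_qq]
  have e : -(Real.pi * ((-N : ℤ) : ℝ) * (x + Y * I : ℂ).im) = Real.pi * N * Y := by simp
  rw [e]
  exact mul_le_mul_of_nonneg_right (hC x (uIoc_subset_uIcc hx)) (exp_pos _).le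

lemma four_sum {g : ℂ → ℂ} {A : ℝ} (hd : ∀ w : ℂ, A < w.im → DifferentiableAt ℂ g w)
    (hp : ∀ w : ℂ, A < w.im → g (w + 1) = g w) (Y : ℝ) (hY : A < Y) (w : ℂ) (hw : A < w.im) :
    Summable (fun n : ℤ => ‖(∫ x in (0:ℝ)..1, g (x + Y * I) * qq (-(2 * n)) (x + Y * I)) * qq (2 * n) w‖) ∧
    HasSum (fun n : ℤ => (∫ x in (0:ℝ)..1, g (x + Y * I) * qq (-(2 * n)) (x + Y * I)) * qq (2 * n) w) (g w) := by
  set c : ℤ → ℂ := fun n => ∫ x in (0:ℝ)..1, g (x + Y * I) * qq (-(2 * n)) (x + Y * I) with hcdef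
  have hcY : ∀ Y', A < Y' → ∀ n, c n = ∫ x in (0:ℝ)..1, g (x + Y' * I) * qq (-(2 * n)) (x + Y' * I) := by
    intro Y' hY' n
    have := per_int (g := fun w => g w * qq (-(2 * n)) w) (A := A) (fun w hw => (hd w hw).mul (qq_diff _ w))
      (fun w hw => by
        show g (w + 1) * qq _ (w + 1) = _
        rw [hp w hw, qq_add, ← mul_neg, qq_even, mul_one]) (Y' * I) (by simpa using hY') Y hY
    rw [hcdef]
    simp only at this ⊢
    rw [← this]
    refine integral_congr fun x _ => ?_
    simp only [add_comm]
  have hcon : ∀ Y', A < Y' → ContinuousOn g {w | w.im = Y'} := fun Y' hY' w hw =>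
    (hd w (by rw [hw]; exact hY')).continuousAt.continuousWithinAt
  set y := w.im with hy
  set δ := (y - A) / 2 with hδ
  have hδ0 : 0 < δ := by rw [hδ]; linarith
  obtain ⟨C1, hC1, hb1⟩ := co_bound (hcon (y - δ) (by linarith))
  obtain ⟨C2, hC2, hb2⟩ := co_bound (hcon (y + δ) (by linarith))
  have hs : Summable (fun n : ℤ => ‖c n * qq (2 * n) w‖) := by
    have hgeo : Summable (fun n : ℕ => (max C1 C2) * rexp (-(2 * Real.pi * δ)) ^ n) := by
      refine (summable_geometric_of_lt_one (exp_pos _).le ?_).mul_left _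
      rw [Real.exp_lt_one_iff]; have := pi_pos; nlinarith [mul_pos this hδ0]
    refine Summable.of_nat_of_neg ?_ ?_
    · refine hgeo.of_nonneg_of_le (fun n => norm_nonneg _) fun n => ?_
      have := hb1 (2 * n)
      rw [norm_mul, norm_qq, hcY (y - δ) (by linarith)]
      calc _ ≤ (C1 * rexp (Real.pi * ((2 * n : ℤ) : ℝ) * (y - δ))) * rexp (-(Real.pi * ((2 * n : ℤ):ℝ) * w.im)) :=
            mul_le_mul_of_nonneg_right this (exp_pos _).le
        _ = C1 * rexp (-(2 * Real.pi * δ)) ^ n := by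
            rw [mul_assoc, ← Real.exp_add, ← Real.exp_nat_mul]; congr 2; push_cast; rw [← hy]; ring
        _ ≤ _ := by gcongr; exact le_max_left _ _
    · refine hgeo.of_nonneg_of_le (fun n => norm_nonneg _) fun n => ?_
      have := hb2 (2 * -n)
      rw [norm_mul, norm_qq, hcY (y + δ) (by linarith)]
      calc _ ≤ (C2 * rexp (Real.pi * ((2 * -n : ℤ) : ℝ) * (y + δ))) * rexp (-(Real.pi * ((2 * -n : ℤ):ℝ) * w.im)) :=
            mul_le_mul_of_nonneg_right this (exp_pos _).le
        _ = C2 * rexp (-(2 * Real.pi * δ)) ^ n := by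
            rw [mul_assoc, ← Real.exp_add, ← Real.exp_nat_mul]; congr 2; push_cast; rw [← hy]; ring
        _ ≤ _ := by gcongr; exact le_max_right _ _
  refine ⟨hs, ?_⟩
  have hT : Fact (0 < (1:ℝ)) := ⟨one_pos⟩
  let h : ℝ → ℂ := fun x => g (x + y * I)
  have hcont : Continuous h := (hcon y hw).comp_continuous (by fun_prop) (by intro x; simp)
  let G : C(AddCircle (1:ℝ), ℂ) := ⟨AddCircle.liftIco 1 0 h, AddCircle.liftIco_zero_continuous (by
    show g ((0:ℝ) + y * I) = g ((1:ℝ) + y * I)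
    rw [← hp ((0:ℝ) + y * I) (by simpa using hw)]; congr 1; push_cast; ring) hcont.continuousOn⟩
  have hco : ∀ n, fourierCoeff G n = c n * qq (2 * n) (y * I) := by
    intro n
    rw [fourierCoeff_eq_intervalIntegral _ n 0, hcY y hw, ← integral_mul_const]
    simp only [zero_add, div_one, one_smul]
    refine intervalIntegral.integral_congr_ae ?_
    have : ∀ᵐ x : ℝ, x ≠ 1 := by simp [MeasureTheory.ae_iff]
    filter_upwards [this] with x hx1 hx
    rw [Set.uIoc_of_le zero_le_one] at hx
    have e : G (x : AddCircle (1:ℝ)) = h x := AddCircle.liftIco_coe_apply (p := (1:ℝ)) (a := 0) (f := h) (by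
      rw [zero_add]; exact ⟨hx.1.le, lt_of_le_of_ne hx.2 hx1⟩)
    rw [e, fourier_coe_apply, smul_eq_mul]
    show cexp _ * g (x + y * I) = _
    rw [mul_comm, mul_assoc (g _)]
    refine congrArg _ ?_
    simp only [qq]
    rw [← exp_add]
    congr 1
    push_cast; ring
  have hsum : Summable (fourierCoeff G) := by
    refine Summable.of_norm ?_
    refine hs.congr fun n => ?_
    rw [hco, norm_mul, norm_mul, norm_qq, norm_qq]; simp [hy]
  have := has_pointwise_sum_fourier_series_of_summable hsum ((w.re : ℝ) : AddCircle (1:ℝ))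
  have e : G ((w.re : ℝ) : AddCircle (1:ℝ)) = g w := by
    have hper : Function.Periodic h 1 := fun x => by
      show g ((x + 1 : ℝ) + y * I) = g (x + y * I)
      rw [← hp (x + y * I) (by simpa using hw)]; congr 1; push_cast; ring
    have e1 : ∀ u : ℝ, G ((u : ℝ) : AddCircle (1:ℝ)) = h u := by
      intro u
      obtain ⟨k, hk⟩ : ∃ k : ℤ, u - k * 1 ∈ Set.Ico (0:ℝ) (0 + 1) := ⟨⌊u⌋, by
        simp only [mul_one, zero_add]; exact ⟨Int.fract_nonneg u, Int.fract_lt_one u⟩⟩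
      have e2 : ((u : ℝ) : AddCircle (1:ℝ)) = ((u - k * 1 : ℝ) : AddCircle (1:ℝ)) := by
        rw [AddCircle.coe_sub, ← zsmul_eq_mul, AddCircle.coe_zsmul, AddCircle.coe_period, smul_zero, sub_zero]
      rw [e2]
      have : G ((u - k * 1 : ℝ) : AddCircle (1:ℝ)) = h (u - k * 1) := AddCircle.liftIco_coe_apply (p := (1:ℝ)) (a := 0) (f := h) hk
      rw [this, hper.sub_int_mul_eq]
    rw [e1]
    show g (w.re + w.im * I) = g w
    rw [re_add_im]
  rw [e] at this
  convert! this using 2 with n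
  rw [hco, fourier_coe_apply, smul_eq_mul, mul_assoc]
  congr 1
  rw [qq, qq, ← exp_add]
  congr 1
  conv_lhs => rw [← re_add_im w]
  push_cast; rw [hy]; ring

/-- half-integral Fourier coefficient -/
def co (Y : ℝ) (g : ℂ → ℂ) (N : ℤ) : ℂ := ∫ x in (0:ℝ)..1, g (x + Y * I) * qq (-N) (x + Y * I)

structure AP (A : ℝ) (g : ℂ → ℂ) : Prop where
  d : ∀ w : ℂ, A < w.im → DifferentiableAt ℂ g w
  p : ∀ w : ℂ, A < w.im → g (w + 1) = - g w

lemma AP.sum {A g} (h : AP A g) (Y : ℝ) (hY : A < Y) (w : ℂ) (hw : A < w.im) :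
    Summable (fun n : ℤ => ‖co Y g (2 * n + 1) * qq (2 * n + 1) w‖) ∧
    HasSum (fun n : ℤ => co Y g (2 * n + 1) * qq (2 * n + 1) w) (g w) := by
  have hh := four_sum (g := fun w => g w * qq (-1) w) (A := A)
    (fun w hw => (h.d w hw).mul (qq_diff _ w)) (fun w hw => by
      show g (w + 1) * qq _ (w + 1) = _
      rw [h.p w hw, qq_add, qq_odd (by decide)]; ring) Y hY w hw
  have e : ∀ n : ℤ, co Y g (2 * n + 1) = ∫ x in (0:ℝ)..1, (g (x + Y * I) * qq (-1) (x + Y * I)) * qq (-(2 * n)) (x + Y * I) := by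
    intro n
    refine integral_congr fun x _ => ?_
    show _ = _
    rw [mul_assoc, ← qq_idx]; congr 2; ring
  have e2 : ∀ n : ℤ, co Y g (2 * n + 1) * qq (2 * n + 1) w = (∫ x in (0:ℝ)..1, (g (x + Y * I) * qq (-1) (x + Y * I)) * qq (-(2 * n)) (x + Y * I)) * qq (2 * n) w * qq 1 w := by
    intro n
    rw [e, qq_idx]; ring
  simp only [e2]
  refine ⟨?_, ?_⟩
  · simp only [norm_mul _ (qq 1 w)]
    exact hh.1.mul_right _
  · have := hh.2.mul_right (qq 1 w)
    rwa [mul_assoc, qq_neg, mul_one] at this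

lemma AP.zero {A g} (h : AP A g) (Y : ℝ) (hY : A < Y) (hc : ∀ N, Odd N → co Y g N = 0) (w : ℂ) (hw : A < w.im) : g w = 0 := by
  have := (h.sum Y hY w hw).2
  simp only [hc _ ⟨_, rfl⟩, zero_mul] at this
  exact this.unique hasSum_zero

lemma AP.fin {A g} (h : AP A g) (Y : ℝ) (hY : A < Y) (s : Finset ℤ) (hc : ∀ N, Odd N → N ∉ s → co Y g N = 0)
    (hs : ∀ N ∈ s, Odd N) (w : ℂ) (hw : A < w.im) : g w = ∑ N ∈ s, co Y g N * qq N w := by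
  classical
  have := (h.sum Y hY w hw).2
  have inj : Function.Injective (fun n : ℤ => 2 * n + 1) := fun a b h => by simpa using h
  have h2 : HasSum (fun N : ℤ => if N ∈ s then co Y g N * qq N w else 0) (g w) := by
    rw [← inj.hasSum_iff]
    · convert! this using 2 with n
      by_cases hn : 2 * n + 1 ∈ s
      · simp [hn]
      · simp [hn, hc _ ⟨n, rfl⟩ hn]
    · intro x hx
      rw [if_neg]
      intro hxs
      obtain ⟨n, hn⟩ := hs x hxs
      exact hx ⟨n, hn.symm⟩
  refine h2.unique ?_
  have hf : HasSum _ _ := hasSum_sum_of_ne_finset_zero (f := fun N : ℤ => if N ∈ s then co Y g N * qq N w else 0) (s := s) (by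
    intro b hb; simp [hb])
  rwa [sum_congr rfl fun N hN => if_pos hN] at hf

lemma AP.bdd {A g} (h : AP A g) (Y : ℝ) (hY : A < Y) (N0 : ℤ) (hc : ∀ N, Odd N → N < N0 → co Y g N = 0) (B : ℝ) (hB : A < B) :
    ∃ C : ℝ, ∀ w : ℂ, B ≤ w.im → ‖g w * qq (-N0) w‖ ≤ C := by
  have hs := (h.sum Y hY (B * I) (by simpa using hB)).1
  have hs' := hs.mul_right ‖qq (-N0) (B * I)‖
  simp only [← norm_mul] at hs'
  refine ⟨∑' n : ℤ, ‖co Y g (2 * n + 1) * qq (2 * n + 1) (B * I) * qq (-N0) (B * I)‖, fun w hw => ?_⟩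
  have h1 := (h.sum Y hY w (by linarith)).2.mul_right (qq (-N0) w)
  rw [← h1.tsum_eq]
  refine tsum_of_norm_bounded hs'.hasSum fun n => ?_
  by_cases hn : 2 * n + 1 < N0
  · simp [hc _ ⟨n, rfl⟩ hn]
  · rw [mul_assoc, mul_assoc, norm_mul, norm_mul (co Y g (2 * n + 1)), ← qq_idx, ← qq_idx, norm_qq, norm_qq]
    refine mul_le_mul_of_nonneg_left (Real.exp_le_exp.2 ?_) (norm_nonneg _)
    have h3 : (0:ℝ) ≤ ((2 * n + 1 + -N0 : ℤ) : ℝ) := by exact_mod_cast (by omega)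
    have h4 := mul_nonneg Real.pi_pos.le h3
    have : (B * I : ℂ).im = B := by simp
    rw [this]
    nlinarith

lemma AP.co_eq {A g} (h : AP A g) (c : ℂ) (hc : A < c.im) (Y : ℝ) (hY : A < Y) {N : ℤ} (hN : Odd N) :
    ∫ x in (0:ℝ)..1, g (c + x) * qq (-N) (c + x) = co Y g N :=
  per_int (g := fun w => g w * qq (-N) w) (A := A) (fun w hw => (h.d w hw).mul (qq_diff _ w))
      (fun w hw => by
        show g (w + 1) * qq _ (w + 1) = _
        rw [h.p w hw, qq_add, qq_odd hN.neg]; ring) c hc Y hY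
end

section
def evL (j : ℕ) (x y : ℂ) : (Vc j) →L[ℂ] ℂ :=
  ∑ l : Fin (j + 1), (x ^ (j - (l : ℕ)) * y ^ (l : ℕ)) • ContinuousLinearMap.proj (R := ℂ) l
lemma evL_apply (j x y v) : evL j x y v = ev j v x y := by
  simp [evL, ev, mul_comm]

lemma ev_homog (j v) (c x y : ℂ) : ev j v (c * x) (c * y) = c ^ j * ev j v x y := by
  simp only [ev, Finset.mul_sum]
  refine sum_congr rfl fun l _ => ?_
  have : c ^ j = c ^ (j - (l : ℕ)) * c ^ (l : ℕ) := by
    rw [← pow_add]; congr 1; have := l.isLt; omega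
  rw [mul_pow, mul_pow, this]; ring

lemma ev_inj {j} {v w : Vc j} (h : ∀ x y, ev j v x y = ev j w x y) : v = w := ev_ext fun y => h 1 y

structure Form (j : ℕ) (f : ℂ → ℂ → ℂ → Vc j) : Prop where
  ej : Even j
  d : ∀ t z s, DD t z s → DifferentiableAt ℂ (fun p : ℂ × ℂ × ℂ => f p.1 p.2.1 p.2.2) (t, z, s)
  L : Laws j f

variable {j : ℕ} {f : ℂ → ℂ → ℂ → Vc j}

lemma Form.Ts (h : Form j f) {t z s} (hD : DD t z s) : f t z (s + 1) = - f t z s := by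
  have h1 : DD t z (s + 1) := by
    refine ⟨hD.1, ?_⟩; simpa using hD.2
  refine ev_inj fun x y => ?_
  rw [h.L.W _ _ _ h1.W, h.L.T _ _ _ hD.W, ev_neg, h.L.W _ _ _ hD, ev_neg]; ring

lemma Form.Z (h : Form j f) {t z s} (hD : DD t z s) : f t (z + 1) s = - f t z s := by
  have hV : DD t (z - t) (s - 2 * z + t) := by
    refine ⟨hD.1, ?_⟩
    have := hD.2; simp; nlinarith
  have h1 : DD t (z + 1) s := by
    refine ⟨hD.1, ?_⟩; simpa using hD.2
  refine ev_inj fun x y => ?_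
  have hu := h.L.U _ _ _ hV x y
  have hu1 := h.L.U _ _ _ hV.T x y
  rw [h.L.T _ _ _ hV, ev_neg] at hu1
  have e1 : z - t + t = z := by ring
  have e2 : s - 2 * z + t + 2 * (z - t) + t = s := by ring
  have e3 : z - t + (t + 1) = z + 1 := by ring
  have e4 : s - 2 * z + t + 2 * (z - t) + (t + 1) = s + 1 := by ring
  rw [e1, e2] at hu
  rw [e3, e4, h.Ts (t := t + 1) h1.T, h.L.T _ _ _ h1, ev_neg, ev_neg] at hu1
  rw [ev_neg, hu]
  linear_combination hu1

lemma Form.N (h : Form j f) {t z s} (hD : DD t z s) (x y) : ev j (f t (-z) s) x y = ev j (f t z s) x (-y) := by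
  have ht := hD.ne
  have h1 := h.L.S _ _ _ hD.S x y
  rw [h.L.S _ _ _ hD] at h1
  have e1 : -1 / (-1 / t) = t := by field_simp
  have e2 : z / t / (-1 / t) = -z := by field_simp
  have e3 : s - z ^ 2 / t - (z / t) ^ 2 / (-1 / t) = s := by field_simp; ring
  have e4 : t * (-1 / t * x) = (-1) * x := by field_simp
  have e5 : y + z / t * x + z * (-1 / t * x) = (-1) * (-y) := by field_simp; ring
  rw [e1, e2, e3, e4, e5, ev_homog, h.ej.neg_one_pow] at h1
  rw [h1]; field_simp

/-- Fourier-Jacobi coefficient -/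
def hgt (t z : ℂ) : ℝ := z.im ^ 2 / t.im + 1
def phi (f : ℂ → ℂ → ℂ → Vc j) (M : ℤ) (t z : ℂ) : Vc j :=
  ∫ x in (0:ℝ)..1, qq (-M) (x + hgt t z * I) • f t z (x + hgt t z * I)

lemma DD_iff {t z s : ℂ} (ht : 0 < t.im) : DD t z s ↔ z.im ^ 2 / t.im < s.im := by
  rw [DD, div_lt_iff₀ ht]; simp [ht, mul_comm]

lemma phi_eq (h : Form j f) {M : ℤ} (hM : Odd M) {t z : ℂ} (ht : 0 < t.im) (c : ℂ) (hc : DD t z c) :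
    ∫ x in (0:ℝ)..1, qq (-M) (c + x) • f t z (c + x) = phi f M t z := by
  refine per_int (g := fun s => qq (-M) s • f t z s) (A := z.im ^ 2 / t.im) ?_ ?_ c ((DD_iff ht).1 hc) _ (by simp [hgt])
  · intro w hw
    refine (qq_diff _ w).smul ?_
    exact (h.d t z w ((DD_iff ht).2 hw)).comp w (f := fun s => (t, z, s)) (by fun_prop)
  · intro w hw
    show qq (-M) (w + 1) • f t z (w + 1) = _
    rw [h.Ts ((DD_iff ht).2 hw), qq_add, qq_odd hM.neg]; simp

lemma ev_int {g : ℝ → Vc j} (hg : Continuous g) (x y) (a b : ℝ) :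
    ev j (∫ u in a..b, g u) x y = ∫ u in a..b, ev j (g u) x y := by
  simp only [← evL_apply]
  exact ((evL j x y).intervalIntegral_comp_comm (hg.intervalIntegrable _ _)).symm

lemma Form.ca (h : Form j f) {t z s} (hD : DD t z s) : ContinuousAt (fun p : ℂ × ℂ × ℂ => f p.1 p.2.1 p.2.2) (t, z, s) :=
  (h.d t z s hD).continuousAt

lemma DD_shift {t z s : ℂ} (hD : DD t z s) (x : ℝ) : DD t z (s + x) := by
  refine ⟨hD.1, ?_⟩; simpa using hD.2

lemma phi_ev (h : Form j f) {M : ℤ} (hM : Odd M) {t z : ℂ} (ht : 0 < t.im) (c : ℂ) (hc : DD t z c) (x y) :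
    ∫ u in (0:ℝ)..1, qq (-M) (c + u) * ev j (f t z (c + u)) x y = ev j (phi f M t z) x y := by
  rw [← phi_eq h hM ht c hc, ev_int]
  · simp only [ev_smul]
  · refine Continuous.smul (f := fun u : ℝ => qq (-M) (c + u)) (by fun_prop) ?_
    rw [continuous_iff_continuousAt]
    intro u
    exact (h.ca (DD_shift hc u)).comp (f := fun u : ℝ => ((t, z, c + u) : ℂ × ℂ × ℂ)) (by fun_prop)

structure Jac (j : ℕ) (M : ℤ) (φ : ℂ → ℂ → Vc j) : Prop where
  ej : Even j
  oM : Odd M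
  c : ContinuousOn (Function.uncurry φ) ({t | 0 < t.im} ×ˢ Set.univ)
  dt : ∀ t z, 0 < t.im → DifferentiableAt ℂ (fun t => φ t z) t
  dz : ∀ t z, 0 < t.im → DifferentiableAt ℂ (fun z => φ t z) z
  T : ∀ t z, 0 < t.im → φ (t + 1) z = - φ t z
  Z : ∀ t z, 0 < t.im → φ t (z + 1) = - φ t z
  N : ∀ t z, 0 < t.im → ∀ x y, ev j (φ t (-z)) x y = ev j (φ t z) x (-y)
  U : ∀ t z, 0 < t.im → ∀ x y, ev j (φ t (z + t)) x y = - qq (-M) (2 * z + t) * ev j (φ t z) x (y - x)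
  S : ∀ t z, 0 < t.im → ∀ x y, ev j (φ (-1 / t) (z / t)) x y =
    - t ^ 2 * qq M (z ^ 2 / t) * ev j (φ t z) (t * x) (y + z * x)

lemma Form.jac (h : Form j f) {M : ℤ} (hM : Odd M) : Jac j M (phi f M) := by
  have base : ∀ t z : ℂ, 0 < t.im → DD t z (hgt t z * I) := by
    intro t z ht; rw [DD_iff ht, im_ofReal_mul, I_im, hgt]; linarith
  -- local constancy of height
  have loc : ∀ t z : ℂ, 0 < t.im → ∃ Y : ℝ, DD t z (Y * I) := fun t z ht => ⟨_, base t z ht⟩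
  have hopen : ∀ c : ℂ, IsOpen {p : ℂ × ℂ | DD p.1 p.2 c} := by
    intro c
    simp only [DD, ofPred_and]
    refine IsOpen.inter (isOpen_lt (by fun_prop) (by fun_prop)) (isOpen_lt (by fun_prop) (by fun_prop))
  have hcont : ∀ c : ℂ, ContinuousOn (Function.uncurry fun (p : ℂ × ℂ) (u : ℝ) => qq (-M) (c + u) • f p.1 p.2 (c + u))
      ({p : ℂ × ℂ | DD p.1 p.2 c} ×ˢ Set.univ) := by
    rintro c ⟨⟨t, z⟩, u⟩ ⟨hD, -⟩
    refine ContinuousAt.continuousWithinAt ?_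
    refine ContinuousAt.smul (f := fun p : (ℂ × ℂ) × ℝ => qq (-M) (c + p.2)) (by fun_prop) ?_
    exact (h.ca (DD_shift hD u)).comp (f := fun p : (ℂ × ℂ) × ℝ => ((p.1.1, p.1.2, c + p.2) : ℂ × ℂ × ℂ)) (x := ((t, z), u)) (by fun_prop)
  have hco : ∀ t z : ℂ, 0 < t.im → ContinuousAt (Function.uncurry (phi f M)) (t, z) := by
    intro t z ht
    have hn : {p : ℂ × ℂ | DD p.1 p.2 (hgt t z * I)} ∈ 𝓝 (t, z) := (hopen (hgt t z * I)).mem_nhds (base t z ht)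
    have h1 := (par_cont (hopen (hgt t z * I)) (hcont _) 0 1).continuousAt hn
    refine h1.congr ?_
    filter_upwards [hn] with p hp
    exact phi_eq h hM hp.1 _ hp
  refine ⟨h.ej, hM, ?_, ?_, ?_, ?_, ?_, ?_, ?_, ?_⟩
  · rintro ⟨t, z⟩ ⟨ht, -⟩
    exact (hco t z ht).continuousWithinAt
  · intro t z ht
    have ho : IsOpen {t' : ℂ | DD t' z (hgt t z * I)} := (hopen (hgt t z * I)).preimage (f := fun t' => (t', z)) (by fun_prop)
    have h1 := par_diff (f := fun t' u => qq (-M) (hgt t z * I + u) • f t' z (hgt t z * I + u)) ho (by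
        exact (hcont (hgt t z * I)).comp (f := fun p : ℂ × ℝ => ((p.1, z), p.2)) (by fun_prop) (fun p hp => ⟨hp.1, trivial⟩)) (by
        intro u p hp
        exact DifferentiableAt.fun_const_smul ((h.d p z _ (DD_shift hp u)).comp p (f := fun t' => (t', z, hgt t z * I + u)) (by fun_prop)) _) 0 1 t (base t z ht)
    refine h1.congr_of_eventuallyEq ?_
    filter_upwards [ho.mem_nhds (base t z ht)] with p hp
    exact (phi_eq h hM hp.1 _ hp).symm
  · intro t z ht
    have ho : IsOpen {z' : ℂ | DD t z' (hgt t z * I)} := (hopen (hgt t z * I)).preimage (f := fun z' => (t, z')) (by fun_prop)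
    have h1 := par_diff (f := fun z' u => qq (-M) (hgt t z * I + u) • f t z' (hgt t z * I + u)) ho (by
        exact (hcont (hgt t z * I)).comp (f := fun p : ℂ × ℝ => ((t, p.1), p.2)) (by fun_prop) (fun p hp => ⟨hp.1, trivial⟩)) (by
        intro u p hp
        exact DifferentiableAt.fun_const_smul ((h.d t p _ (DD_shift hp u)).comp p (f := fun z' => (t, z', hgt t z * I + u)) (by fun_prop)) _) 0 1 z (base t z ht)
    refine h1.congr_of_eventuallyEq ?_
    filter_upwards [ho.mem_nhds (base t z ht)] with p hp
    exact (phi_eq h hM hp.1 _ hp).symm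
  · intro t z ht
    rw [← phi_eq h hM (by simpa using ht) _ (base t z ht).T, ← phi_eq h hM ht _ (base t z ht), ← integral_neg]
    refine integral_congr fun u _ => ?_
    simp only [h.L.T _ _ _ (DD_shift (base t z ht) u), smul_neg]
  · intro t z ht
    have hD1 : DD t (z + 1) (hgt t z * I) := by
      refine ⟨ht, ?_⟩; simpa using (base t z ht).2
    rw [← phi_eq h hM ht _ hD1, ← phi_eq h hM ht _ (base t z ht), ← integral_neg]
    refine integral_congr fun u _ => ?_
    simp only [h.Z (DD_shift (base t z ht) u), smul_neg]
  · intro t z ht x y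
    have hD1 : DD t (-z) (hgt t z * I) := by
      refine ⟨ht, ?_⟩; simpa using (base t z ht).2
    rw [← phi_ev h hM ht _ hD1, ← phi_ev h hM ht _ (base t z ht)]
    refine integral_congr fun u _ => ?_
    simp only [h.N (DD_shift (base t z ht) u)]
  · intro t z ht x y
    rw [← phi_ev h hM ht _ (base t z ht).U, ← phi_ev h hM ht _ (base t z ht), ← integral_const_mul]
    refine integral_congr fun u _ => ?_
    have := h.L.U _ _ _ (DD_shift (base t z ht) u) x y
    have e : (hgt t z * I : ℂ) + 2 * z + t + u = hgt t z * I + u + 2 * z + t := by ring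
    have e' : (hgt t z * I : ℂ) + u + 2 * z + t = (2 * z + t) + (hgt t z * I + u) := by ring
    simp only [e]
    rw [this]
    simp only [e', qq_add _ (2 * z + t)]; ring
  · intro t z ht x y
    rw [← phi_ev h hM (base t z ht).S.1 _ (base t z ht).S, ← phi_ev h hM ht _ (base t z ht), ← integral_const_mul]
    refine integral_congr fun u _ => ?_
    have := h.L.S _ _ _ (DD_shift (base t z ht) u) x y
    have e : (hgt t z * I : ℂ) - z ^ 2 / t + u = hgt t z * I + u - z ^ 2 / t := by ring
    have e' : (hgt t z * I : ℂ) + u - z ^ 2 / t = (hgt t z * I + u) + -(z ^ 2 / t) := by ring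
    have e'' : qq (-M) (-(z ^ 2 / t)) = qq M (z ^ 2 / t) := by simp [qq]
    simp only [e]
    rw [this]
    simp only [e', qq_add, e'']; ring
end

section
variable {j : ℕ} {M : ℤ} {φ : ℂ → ℂ → Vc j}

def pp (φ : ℂ → ℂ → Vc j) (N : ℤ) (z : ℂ) : Vc j :=
  ∫ x in (0:ℝ)..1, qq (-N) (x ⊹) • φ (x ⊹) z
def aa (φ : ℂ → ℂ → Vc j) (N R : ℤ) : Vc j :=
  ∫ u in (0:ℝ)..1, qq (-R) (u + (0:ℝ) * I) • pp φ N (u + (0:ℝ) * I)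

lemma Jac.ca (h : Jac j M φ) {t : ℂ} (ht : 0 < t.im) (z : ℂ) : ContinuousAt (Function.uncurry φ) (t, z) := by
  refine h.c.continuousAt ?_
  refine IsOpen.mem_nhds (IsOpen.prod (isOpen_lt (by fun_prop) (by fun_prop)) isOpen_univ) ⟨ht, trivial⟩

lemma Jac.cc (h : Jac j M φ) {X : Type*} [TopologicalSpace X] {a b : X → ℂ} (ha : Continuous a) (hb : Continuous b)
    (hp : ∀ x, 0 < (a x).im) : Continuous (fun x => φ (a x) (b x)) := by
  rw [continuous_iff_continuousAt]
  intro x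
  exact (h.ca (hp x) (b x)).comp (f := fun x => (a x, b x)) (by fun_prop)

lemma Jac.pp_eq (h : Jac j M φ) {N : ℤ} (hN : Odd N) (z : ℂ) (c : ℂ) (hc : 0 < c.im) :
    ∫ x in (0:ℝ)..1, qq (-N) (c + x) • φ (c + x) z = pp φ N z := by
  refine per_int (g := fun t => qq (-N) t • φ t z) (A := 0) ?_ ?_ c hc 1 one_pos
  · intro w hw
    exact (qq_diff _ w).smul (h.dt w z hw)
  · intro w hw
    show qq (-N) (w + 1) • φ (w + 1) z = _
    rw [h.T _ _ hw, qq_add, qq_odd hN.neg]; simp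

lemma Jac.pp_diff (h : Jac j M φ) (N : ℤ) (z : ℂ) : DifferentiableAt ℂ (pp φ N) z := by
  refine par_diff (f := fun z x => qq (-N) (x ⊹) • φ (x ⊹) z) isOpen_univ ?_ ?_ 0 1 z trivial
  · refine Continuous.continuousOn ?_
    refine Continuous.smul (f := fun p : ℂ × ℝ => qq (-N) (p.2 ⊹)) (by fun_prop) ?_
    exact h.cc (X := ℂ × ℝ) (a := fun p => p.2 ⊹) (b := fun p => p.1) (by fun_prop) (by fun_prop) (by intro p; simp)
  · intro x p _
    exact (h.dz _ p (by simp)).fun_const_smul _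
lemma Jac.pp_cont (h : Jac j M φ) (N : ℤ) : Continuous (pp φ N) :=
  continuous_iff_continuousAt.2 fun z => (h.pp_diff N z).continuousAt

lemma Jac.pp_Z (h : Jac j M φ) (N : ℤ) (z : ℂ) : pp φ N (z + 1) = - pp φ N z := by
  rw [pp, pp, ← integral_neg]
  refine integral_congr fun u _ => ?_
  simp only [h.Z _ _ (show 0 < ((u:ℂ) ⊹).im by simp), smul_neg]

lemma Jac.pp_N (h : Jac j M φ) (N : ℤ) (z : ℂ) (x y) : ev j (pp φ N (-z)) x y = ev j (pp φ N z) x (-y) := by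
  have hc : ∀ z, Continuous fun u : ℝ => qq (-N) (u ⊹) • φ (u ⊹) z := fun z =>
    Continuous.smul (f := fun u : ℝ => qq (-N) (u ⊹)) (by fun_prop) (h.cc (by fun_prop) (by fun_prop) (by intro p; simp))
  rw [pp, pp, ev_int (hc _), ev_int (hc _)]
  refine integral_congr fun u _ => ?_
  simp only [ev_smul, h.N _ _ (show 0 < ((u:ℂ) ⊹).im by simp)]

lemma Jac.aa_eq (h : Jac j M φ) (N : ℤ) {R : ℤ} (hR : Odd R) (c : ℂ) :
    ∫ x in (0:ℝ)..1, qq (-R) (c + x) • pp φ N (c + x) = aa φ N R := by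
  refine per_int (g := fun t => qq (-R) t • pp φ N t) (A := min 0 c.im - 1) ?_ ?_ c (by linarith [min_le_right 0 c.im]) 0 (by linarith [min_le_left 0 c.im])
  · intro w hw
    exact (qq_diff _ w).smul (h.pp_diff N w)
  · intro w hw
    show qq (-R) (w + 1) • pp φ N (w + 1) = _
    rw [h.pp_Z, qq_add, qq_odd hR.neg]; simp

/-- double integral formula with moving base point -/
lemma Jac.aa_dbl (h : Jac j M φ) (N : ℤ) {R : ℤ} (hR : Odd R) (c : ℝ → ℂ) :
    aa φ N R = ∫ x in (0:ℝ)..1, qq (-N) (x ⊹) • ∫ u in (0:ℝ)..1, qq (-R) (c x + u) • φ (x ⊹) (c x + u) := by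
  have h1 : aa φ N R = ∫ u in (0:ℝ)..1, ∫ x in (0:ℝ)..1, qq (-R) (u + (0:ℝ) * I) • qq (-N) (x ⊹) • φ (x ⊹) (u + (0:ℝ) * I) := by
    simp only [integral_smul]; rfl
  rw [h1, fub]
  · refine integral_congr fun x _ => ?_
    show _ = _
    have := per_int (g := fun z => qq (-R) z • φ (x ⊹) z) (A := min 0 (c x).im - 1) (by
      intro w hw
      exact (qq_diff _ w).smul (h.dz _ w (by simp))) (by
      intro w hw
      show qq (-R) (w + 1) • φ _ (w + 1) = _
      rw [h.Z _ _ (by simp), qq_add, qq_odd hR.neg]; simp) (c x) (by linarith [min_le_right 0 (c x).im]) 0 (by linarith [min_le_left 0 (c x).im])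
    rw [this, ← integral_smul]
    refine integral_congr fun u _ => ?_
    show _ = _
    rw [smul_comm]
  · refine Continuous.smul (f := fun p : ℝ × ℝ => qq (-R) (p.1 + (0:ℝ) * I)) (by fun_prop) ?_
    refine Continuous.smul (f := fun p : ℝ × ℝ => qq (-N) (p.2 ⊹)) (by fun_prop) ?_
    exact h.cc (by fun_prop) (by fun_prop) (by intro p; simp)

lemma Jac.aa_ev (h : Jac j M φ) (N : ℤ) {R : ℤ} (hR : Odd R) (c : ℝ → ℂ) (hc : Continuous c) (x y : ℂ) :
    ev j (aa φ N R) x y = ∫ v in (0:ℝ)..1, qq (-N) (v ⊹) * ∫ u in (0:ℝ)..1, qq (-R) (c v + u) * ev j (φ (v ⊹) (c v + u)) x y := by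
  have hk : Continuous (Function.uncurry fun v u : ℝ => qq (-R) (c v + u) • φ (v ⊹) (c v + u)) := by
    refine Continuous.smul (f := fun p : ℝ × ℝ => qq (-R) (c p.1 + p.2)) (by fun_prop) ?_
    exact h.cc (by fun_prop) (by fun_prop) (by intro p; simp)
  rw [h.aa_dbl N hR c, ev_int]
  · refine integral_congr fun v _ => ?_
    show _ = _
    rw [ev_smul, ev_int]
    · simp only [ev_smul]
    · exact hk.comp (f := fun u : ℝ => (v, u)) (by fun_prop)
  · refine Continuous.smul (f := fun v : ℝ => qq (-N) (v ⊹)) (by fun_prop) ?_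
    exact intervalIntegral.continuous_parametric_intervalIntegral_of_continuous' hk 0 1

lemma Jac.shift (h : Jac j M φ) (N : ℤ) {R : ℤ} (hR : Odd R) (x y : ℂ) :
    ev j (aa φ (N + R + M) (R + 2 * M)) x y = - ev j (aa φ N R) x (y + x) := by
  rw [h.aa_ev N hR (fun v => v ⊹) (by fun_prop), h.aa_ev _ (hR.add_even ⟨M, by ring⟩) (fun _ => 0) (by fun_prop), ← integral_neg]
  refine integral_congr fun v _ => ?_
  show _ = _
  rw [← mul_neg, ← integral_neg, ← integral_const_mul, ← integral_const_mul]
  refine integral_congr fun u _ => ?_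
  show _ = _
  have := h.U (v ⊹) u (by simp) x (y + x)
  rw [add_comm (u:ℂ)] at this
  rw [this, add_sub_cancel_right, zero_add, two_mul (u:ℂ), qq_add _ ((u:ℂ) + u), qq_add _ (u:ℂ)]
  have e1 : -(N + R + M) = -N + -R + -M := by ring
  have e2 : -(R + 2 * M) = -R + -M + -M := by ring
  rw [e1, e2, qq_idx, qq_idx, qq_idx _ _ (u:ℂ), qq_idx _ _ (u:ℂ), qq_add (-R) ((v:ℂ) ⊹) u]
  ring

lemma Jac.sgn (h : Jac j M φ) (N : ℤ) {R : ℤ} (hR : Odd R) (x y : ℂ) :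
    ev j (aa φ N (-R)) x y = ev j (aa φ N R) x (-y) := by
  have hc : ∀ R, ∀ c : ℂ, Continuous fun u : ℝ => qq (-R) (c + u) • pp φ N (c + u) := fun R c =>
    Continuous.smul (f := fun u : ℝ => qq (-R) (c + u)) (by fun_prop) ((h.pp_cont N).comp (by fun_prop))
  rw [← h.aa_eq N hR (-1), ← h.aa_eq N hR.neg 0, ev_int (hc _ _), ev_int (hc _ _)]
  have hh := intervalIntegral.integral_comp_sub_left (a := 0) (b := 1) (fun u : ℝ => ev j (qq (-(-R)) (0 + u) • pp φ N (0 + u)) x y) 1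
  rw [sub_self, sub_zero] at hh
  rw [← hh]
  refine integral_congr fun u _ => ?_
  simp only [ev_smul]
  rw [← h.pp_N]
  have e : (0:ℂ) + ((1 - u : ℝ) : ℂ) = -(-1 + u) := by push_cast; ring
  rw [e]
  congr 1
  simp only [qq]
  congr 1
  push_cast; ring

lemma norm_ev_le (v : Vc j) (x y : ℂ) : ‖ev j v x y‖ ≤ (j + 1) * ‖v‖ * (1 + ‖x‖ + ‖y‖) ^ j := by
  refine (norm_sum_le _ _).trans ?_
  have : ∀ l ∈ (Finset.univ : Finset (Fin (j + 1))), ‖v l * (x ^ (j - (l : ℕ)) * y ^ (l : ℕ))‖ ≤ ‖v‖ * (1 + ‖x‖ + ‖y‖) ^ j := by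
    intro l _
    rw [norm_mul, norm_mul, norm_pow, norm_pow]
    have : (1 + ‖x‖ + ‖y‖) ^ j = (1 + ‖x‖ + ‖y‖) ^ (j - (l : ℕ)) * (1 + ‖x‖ + ‖y‖) ^ (l : ℕ) := by
      rw [← pow_add]; congr 1; have := l.isLt; omega
    rw [this]
    gcongr
    · exact norm_le_pi_norm v l
    · linarith [norm_nonneg y]
    · linarith [norm_nonneg x]
  refine (Finset.sum_le_sum this).trans ?_
  simp [mul_assoc]

lemma Jac.bd (h : Jac j M φ) : ∃ C : ℝ, 0 ≤ C ∧ ∀ N R : ℤ, ‖aa φ N R‖ ≤ C * rexp (Real.pi * N) := by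
  have h1 : Continuous (fun p : ℝ × ℝ => φ (p.1 ⊹) (p.2 + (0:ℝ) * I)) :=
    h.cc (by fun_prop) (by fun_prop) (by intro p; simp)
  obtain ⟨C, hC⟩ := ((isCompact_uIcc (a := (0:ℝ)) (b := 1)).prod (isCompact_uIcc (a := (0:ℝ)) (b := 1))).exists_bound_of_continuousOn h1.continuousOn
  refine ⟨C, (norm_nonneg _).trans (hC (0, 0) ⟨left_mem_uIcc, left_mem_uIcc⟩), fun N R => ?_⟩
  refine (norm_integral_le_of_norm_le_const (C := C * rexp (Real.pi * N)) fun u hu => ?_).trans (by simp)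
  rw [norm_smul, norm_qq]
  have e : -(Real.pi * ((-R : ℤ) : ℝ) * (u + (0:ℝ) * I : ℂ).im) = 0 := by simp
  rw [e, Real.exp_zero, one_mul]
  refine (norm_integral_le_of_norm_le_const (C := C * rexp (Real.pi * N)) fun x hx => ?_).trans (by simp)
  rw [norm_smul, norm_qq]
  have e : -(Real.pi * ((-N : ℤ) : ℝ) * (x ⊹ : ℂ).im) = Real.pi * N := by simp
  rw [e, mul_comm]
  exact mul_le_mul_of_nonneg_right (hC (x, u) ⟨uIoc_subset_uIcc hx, uIoc_subset_uIcc hu⟩) (exp_pos _).le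

lemma Jac.shiftn (h : Jac j M φ) (l : ℕ) (N : ℤ) {R : ℤ} (hR : Odd R) (x y : ℂ) :
    ev j (aa φ (N + l * R + l ^ 2 * M) (R + 2 * l * M)) x y = (-1) ^ l * ev j (aa φ N R) x (y + l * x) := by
  induction l generalizing y with
  | zero => simp
  | succ l ih =>
    have := h.shift (N + l * R + l ^ 2 * M) (R := R + 2 * l * M) (hR.add_even ⟨l * M, by ring⟩) x y
    rw [ih] at this
    convert this using 1
    · congr 2 <;> push_cast <;> ring
    · push_cast
      rw [pow_succ]
      have : y + ((l:ℂ) + 1) * x = y + x + l * x := by ring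
      rw [this]; ring

/-- Koecher, negative index -/
lemma Jac.neg (h : Jac j M φ) (hM : M < 0) (N : ℤ) {R : ℤ} (hR : Odd R) : aa φ N R = 0 := by
  obtain ⟨C, hC0, hC⟩ := h.bd
  refine ev_inj fun x y => ?_
  rw [ev_zero]
  set K : ℝ := (j + 1) * C * rexp (Real.pi * N) * (1 + ‖x‖ + ‖y‖) ^ j with hK
  have hK0 : 0 ≤ K := by positivity
  have key : ∀ l : ℕ, R < l → ‖ev j (aa φ N R) x y‖ ≤ K * ((1 + l) ^ j * rexp (-l)) := by
    intro l hl
    have h1 := h.shiftn l N hR x (y - l * x)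
    rw [sub_add_cancel] at h1
    have h2 : ‖ev j (aa φ N R) x y‖ = ‖ev j (aa φ (N + l * R + l ^ 2 * M) (R + 2 * l * M)) x (y - l * x)‖ := by
      rw [h1, norm_mul, norm_pow, norm_neg, norm_one, one_pow, one_mul]
    rw [h2]
    refine (norm_ev_le _ _ _).trans ?_
    have h3 : 1 + ‖x‖ + ‖y - l * x‖ ≤ (1 + ‖x‖ + ‖y‖) * (1 + l) := by
      have := norm_sub_le y (l * x)
      rw [norm_mul, norm_natCast] at this
      have hl0 : (0:ℝ) ≤ l := l.cast_nonneg
      nlinarith [norm_nonneg x, norm_nonneg y, mul_nonneg hl0 (norm_nonneg y)]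
    have h4 : rexp (Real.pi * ((N + l * R + l ^ 2 * M : ℤ) : ℝ)) ≤ rexp (Real.pi * N) * rexp (-l) := by
      rw [← Real.exp_add, exp_le_exp]
      have i1 : (l:ℤ) * R + l ^ 2 * M ≤ - l := by
        have : (l:ℤ) * (R + l * M + 1) ≤ 0 := by
          refine mul_nonpos_of_nonneg_of_nonpos (by positivity) ?_
          nlinarith
        nlinarith
      have i2 : (l:ℝ) * R + l ^ 2 * M ≤ -l := by exact_mod_cast i1
      have i3 := Real.pi_gt_three
      have hl0 : (0:ℝ) ≤ l := l.cast_nonneg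
      push_cast
      nlinarith
    calc _ ≤ (j + 1) * (C * (rexp (Real.pi * N) * rexp (-l))) * ((1 + ‖x‖ + ‖y‖) * (1 + l)) ^ j := by
          gcongr
          exact (hC _ _).trans (by gcongr)
      _ = _ := by rw [mul_pow, hK]; ring
  have hlim : Tendsto (fun l : ℕ => K * ((1 + l : ℝ) ^ j * rexp (-l))) atTop (𝓝 0) := by
    have h1 := (Real.tendsto_pow_mul_exp_neg_atTop_nhds_zero j).comp (tendsto_atTop_add_const_left atTop (1:ℝ) tendsto_natCast_atTop_atTop)
    have h2 := h1.const_mul (K * rexp 1)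
    rw [mul_zero] at h2
    refine h2.congr fun l => ?_
    simp only [Function.comp]
    have : rexp (-(1 + l : ℝ)) = rexp (-l) * (rexp 1)⁻¹ := by
      rw [← Real.exp_neg, ← Real.exp_add]; congr 1; ring
    rw [this]
    have := (exp_pos 1).ne'
    field_simp
  have := ge_of_tendsto hlim (by
    filter_upwards [eventually_gt_atTop R.natAbs] with l hl
    exact key l (by omega))
  exact norm_le_zero_iff.1 this
end

section
lemma Jac.shiftz {j : ℕ} {M : ℤ} {φ : ℂ → ℂ → Vc j} (h : Jac j M φ) (l : ℤ) (N : ℤ) {R : ℤ} (hR : Odd R) :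
    ∃ e : ℂ, e * e = 1 ∧ ∀ x y : ℂ, ev j (aa φ (N + l * R + l ^ 2 * M) (R + 2 * l * M)) x y = e * ev j (aa φ N R) x (y + l * x) := by
  refine ⟨(-1) ^ l.natAbs, by rw [← pow_add]; exact Even.neg_one_pow ⟨_, rfl⟩, fun x y => ?_⟩
  rcases l.natAbs_eq with hl | hl <;> generalize l.natAbs = n at hl ⊢ <;> subst hl
  · simpa using h.shiftn n N hR x y
  · have hR' : Odd (R + 2 * (-(n:ℤ)) * M) := hR.add_even ⟨-n * M, by ring⟩
    have := h.shiftn n (N + -(n:ℤ) * R + (-(n:ℤ)) ^ 2 * M) hR' x (y + (-(n:ℤ) : ℤ) * x)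
    have e1 : N + -(n:ℤ) * R + (-(n:ℤ)) ^ 2 * M + n * (R + 2 * (-(n:ℤ)) * M) + n ^ 2 * M = N := by ring
    have e2 : R + 2 * (-(n:ℤ)) * M + 2 * n * M = R := by ring
    have e3 : y + (-(n:ℤ) : ℤ) * x + n * x = y := by push_cast; ring
    rw [e1, e2, e3] at this
    rw [this, ← mul_assoc, ← pow_add, Even.neg_one_pow ⟨n, rfl⟩, one_mul]

section
variable {j : ℕ} {f : ℂ → ℂ → ℂ → Vc j}

def AC (f : ℂ → ℂ → ℂ → Vc j) (N R M : ℤ) : Vc j := aa (phi f M) N R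

lemma Form.ac (h : Form j f) {N R M : ℤ} (hM : Odd M) (x y : ℂ) :
    ev j (AC f N R M) x y = ∫ u in (0:ℝ)..1, qq (-R) u * ∫ v in (0:ℝ)..1, ∫ w in (0:ℝ)..1, qq (-N) (v + I) * (qq (-M) (w + I) * ev j (f (v + I) u (w + I)) x y) := by
  have hJ := h.jac hM
  rw [AC, aa, ev_int]
  · refine integral_congr fun u _ => ?_
    show _ = _
    rw [ev_smul, pp, ev_int]
    · simp only [ofReal_zero, ofReal_one, zero_mul, one_mul, add_zero]
      congr 1
      refine integral_congr fun v _ => ?_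
      show _ = _
      rw [integral_const_mul, ev_smul, ← phi_ev h hM (by simp) I (by simp [DD])]
      simp only [add_comm I]
    · refine Continuous.smul (f := fun v : ℝ => qq (-N) (v ⊹)) (by fun_prop) ?_
      exact hJ.cc (by fun_prop) (by fun_prop) (by intro p; simp)
  · refine Continuous.smul (f := fun v : ℝ => qq (-R) (v + (0:ℝ) * I)) (by fun_prop) ?_
    exact (hJ.pp_cont N).comp (by fun_prop)

lemma Form.swap (h : Form j f) {N R M : ℤ} (hN : Odd N) (hM : Odd M) (x y : ℂ) :
    ev j (AC f N R M) x y = - ev j (AC f M R N) y x := by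
  rw [h.ac hM, h.ac hN, ← integral_neg]
  refine integral_congr fun u _ => ?_
  show _ = _
  rw [← mul_neg, fub]
  · congr 1
    rw [← integral_neg]
    refine integral_congr fun v _ => ?_
    show _ = _
    rw [← integral_neg]
    refine integral_congr fun w _ => ?_
    show _ = _
    rw [h.L.W _ _ _ (show DD ((v:ℂ) + I) u (w + I) by simp [DD])]
    ring
  · refine Continuous.mul (f := fun p : ℝ × ℝ => qq (-N) (p.1 + I)) (by fun_prop) ?_
    refine Continuous.mul (f := fun p : ℝ × ℝ => qq (-M) (p.2 + I)) (by fun_prop) ?_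
    simp only [← evL_apply]
    refine (evL j x y).continuous.comp ?_
    rw [continuous_iff_continuousAt]
    intro p
    exact (h.ca (show DD ((p.1:ℂ) + I) u (p.2 + I) by simp [DD])).comp (f := fun p : ℝ × ℝ => (((p.1:ℂ) + I, (u:ℂ), (p.2:ℂ) + I) : ℂ × ℂ × ℂ)) (by fun_prop)

lemma Form.swap0 (h : Form j f) {N R M : ℤ} (hN : Odd N) (hM : Odd M) (h0 : AC f M R N = 0) : AC f N R M = 0 := by
  refine ev_inj fun x y => ?_
  rw [h.swap hN hM, h0]; simp [ev_zero]

lemma Jac.shift0 {M : ℤ} {φ : ℂ → ℂ → Vc j} (h : Jac j M φ) (l : ℤ) {N R : ℤ} (hR : Odd R)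
    (h0 : aa φ (N + l * R + l ^ 2 * M) (R + 2 * l * M) = 0) : aa φ N R = 0 := by
  obtain ⟨e, he, hh⟩ := h.shiftz l N hR
  refine ev_inj fun x y => ?_
  have := hh x (y - l * x)
  rw [h0, sub_add_cancel, ev_zero] at this
  rw [ev_zero]
  have : e * (e * ev j (aa φ N R) x y) = 0 := by rw [← this, mul_zero]
  rwa [← mul_assoc, he, one_mul] at this

lemma Form.koe (h : Form j f) {N R M : ℤ} (hN : Odd N) (hR : Odd R) (hM : Odd M) (hh : M < 0 ∨ N < 0 ∨ 4 * N * M ≤ R ^ 2) : AC f N R M = 0 := by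
  by_cases hM0 : M < 0
  · exact (h.jac hM).neg hM0 N hR
  by_cases hN0 : N < 0
  · exact h.swap0 hN hM ((h.jac hN).neg hN0 M hR)
  replace hh : 4 * N * M ≤ R ^ 2 := by tauto
  induction hk : M.natAbs using Nat.strong_induction_on generalizing N R M with
  | _ k ih =>
  have hMp : 0 < M := by obtain ⟨m, rfl⟩ := hM; omega
  set l : ℤ := -((R + M) / (2 * M)) with hl
  have hR' : Odd (R + 2 * l * M) := hR.add_even ⟨l * M, by ring⟩
  have hN' : Odd (N + l * R + l ^ 2 * M) := by
    rw [show N + l * R + l ^ 2 * M = N + (l * R + l ^ 2 * M) by ring]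
    refine hN.add_even ?_
    rcases Int.even_or_odd l with he | ho
    · exact (he.mul_right _).add ((he.pow_of_ne_zero (by norm_num)).mul_right _)
    · exact (ho.mul hR).add_odd ((ho.pow).mul hM)
  refine (h.jac hM).shift0 l hR ?_
  set N' := N + l * R + l ^ 2 * M with hNd
  have hb1 : -M ≤ R + 2 * l * M ∧ R + 2 * l * M < M := by
    have a1 := Int.emod_nonneg (R + M) (show 2 * M ≠ 0 by omega)
    have a2 := Int.emod_lt_of_pos (R + M) (show 0 < 2 * M by omega)
    have a3 := Int.emod_add_mul_ediv (R + M) (2 * M)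
    have : R + 2 * l * M = (R + M) % (2 * M) - M := by rw [hl]; linarith
    rw [this]; omega
  have hd : 4 * N' * M ≤ (R + 2 * l * M) ^ 2 := by
    have : (R + 2 * l * M) ^ 2 - 4 * N' * M = R ^ 2 - 4 * N * M := by rw [hNd]; ring
    linarith
  have hlt : N' < M := by nlinarith
  by_cases hn : N' < 0
  · exact h.swap0 hN' hM ((h.jac hN').neg hn M hR')
  refine h.swap0 hN' hM (ih N'.natAbs (by omega) hM hR' hN' hn hM0 (by linarith) rfl)

/-- finite expansion -/
def oddR (B : ℕ) : Finset ℤ := (Finset.Icc (-(B:ℤ)) B).filter (fun R => Odd R)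

lemma Form.pp_sum (h : Form j f) {N M : ℤ} (hN : Odd N) (hM : Odd M) (B : ℕ) (hB : 4 * N * M ≤ (B + 1) ^ 2) (z : ℂ) (i) :
    pp (phi f M) N z i = ∑ R ∈ oddR B, AC f N R M i * qq R z := by
  have hJ := h.jac hM
  have hd : ∀ z, DifferentiableAt ℂ (fun z => pp (phi f M) N z i) z := fun z => differentiableAt_pi.1 (hJ.pp_diff N z) i
  have hAP : AP (min 0 z.im - 1) (fun z => pp (phi f M) N z i) := ⟨fun w _ => hd w, fun w _ => by
    show pp _ _ _ _ = _
    rw [hJ.pp_Z]; rfl⟩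
  have hco : ∀ R, co 0 (fun z => pp (phi f M) N z i) R = AC f N R M i := by
    intro R
    have := ((ContinuousLinearMap.proj (R := ℂ) (φ := fun _ : Fin (j+1) => ℂ) i).intervalIntegral_comp_comm (a := 0) (b := 1) (μ := MeasureTheory.volume) (f := fun u : ℝ => qq (-R) (u + (0:ℝ) * I) • pp (phi f M) N (u + (0:ℝ) * I)) (by
      refine Continuous.intervalIntegrable ?_ _ _
      refine Continuous.smul (f := fun v : ℝ => qq (-R) (v + (0:ℝ) * I)) (by fun_prop) ?_
      exact (hJ.pp_cont N).comp (by fun_prop)))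
    rw [co, AC, aa]
    refine Eq.trans ?_ this
    refine integral_congr fun u _ => ?_
    simp [mul_comm]
  rw [hAP.fin 0 (by linarith [min_le_left 0 z.im]) (oddR B) ?_ (fun N hN => (Finset.mem_filter.1 hN).2) z (by linarith [min_le_right 0 z.im])]
  · simp only [hco]
  · intro R hR hn
    rw [hco, h.koe hN hR hM]; · rfl
    right; right
    simp only [oddR, mem_filter, mem_Icc, hR, and_true, not_and_or, not_le] at hn
    have : (B + 1 : ℤ) ^ 2 ≤ R ^ 2 := by rcases hn with hn | hn <;> nlinarith
    linarith
end
end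

section
/-- Taylor series at zero -/
def TT (g : ℂ → ℂ) : PowerSeries ℂ := PowerSeries.mk fun n => (n.factorial : ℂ)⁻¹ * iteratedDeriv n g 0

lemma ent_an {g : ℂ → ℂ} (hg : Differentiable ℂ g) {n : WithTop ℕ∞} (z : ℂ) : ContDiffAt ℂ n g z :=
  (hg.analyticAt z).contDiffAt

lemma TT_mul {f g : ℂ → ℂ} (hf : Differentiable ℂ f) (hg : Differentiable ℂ g) : TT (fun z => f z * g z) = TT f * TT g := by
  ext n
  have : (fun z => f z * g z) = f * g := rfl
  simp only [TT, coeff_mk, this, iteratedDeriv_mul (ent_an hf 0) (ent_an hg 0), Finset.mul_sum, coeff_mul,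
    Finset.Nat.sum_antidiagonal_eq_sum_range_succ_mk, Nat.succ_eq_add_one]
  refine sum_congr rfl fun i hi => ?_
  rw [Nat.cast_choose _ (by grind)]
  field_simp [Nat.factorial_ne_zero]

lemma TT_scale {g : ℂ → ℂ} (hg : Differentiable ℂ g) (t : ℂ) (n) : PowerSeries.coeff n (TT (fun z => g (t * z))) = t ^ n * PowerSeries.coeff n (TT g) := by
  simp only [TT, coeff_mk]
  rw [iteratedDeriv_comp_const_mul (contDiff_iff_contDiffAt.2 fun z => ent_an hg z)]
  simp; ring

lemma TT_pow (s : ℕ) : TT (fun z => z ^ s) = PowerSeries.X ^ s := by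
  ext n
  simp only [TT, coeff_mk, PowerSeries.coeff_X_pow, iteratedDeriv_fun_pow_zero]
  by_cases h : n = s
  · subst h; simp [Nat.factorial_ne_zero]
  · simp [h]

lemma TT_cmul (c : ℂ) (g : ℂ → ℂ) : TT (fun z => c * g z) = PowerSeries.C c * TT g := by
  ext n
  simp only [TT, coeff_mk, coeff_C_mul]
  rw [iteratedDeriv_const_mul_field]; ring

lemma TT_sum {ι} (s : Finset ι) {g : ι → ℂ → ℂ} (hg : ∀ i, Differentiable ℂ (g i)) : TT (fun z => ∑ i ∈ s, g i z) = ∑ i ∈ s, TT (g i) := by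
  ext n
  simp only [TT, map_sum, coeff_mk]
  rw [iteratedDeriv_fun_sum (fun i _ => ent_an (hg i) 0), Finset.mul_sum]

lemma TT_qq (R : ℤ) (n) : PowerSeries.coeff n (TT (qq R)) = (Real.pi * I * R) ^ n * (n.factorial : ℂ)⁻¹ := by
  simp only [TT, coeff_mk]
  have : qq R = fun z => cexp ((Real.pi * I * R) * z) := by ext z; simp [qq]
  rw [this, iteratedDeriv_cexp_const_mul]; simp [mul_comm]

lemma TT_circ {g : ℂ → ℂ} (hg : Differentiable ℂ g) (n : ℕ) : PowerSeries.coeff n (TT g) = ∫ θ in (0:ℝ)..1, g (qq 2 θ) * qq (-(2 * n)) θ := by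
  have h := DiffContOnCl.circleIntegral_one_div_sub_center_pow_smul (c := 0) one_pos n hg.diffContOnCl
  rw [circleIntegral] at h
  have h2 := intervalIntegral.integral_comp_mul_left (a := 0) (b := 1) (fun θ => deriv (circleMap 0 1) θ • (fun z : ℂ => (1 / (z - 0) ^ (n + 1)) • g z) (circleMap 0 1 θ)) (c := 2 * Real.pi) (by positivity)
  rw [mul_zero, mul_one, h] at h2
  have h3 : PowerSeries.coeff n (TT g) = (I)⁻¹ * ((2 * Real.pi)⁻¹ • (2 * Real.pi * I / n.factorial) • iteratedDeriv n g 0) := by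
    simp only [TT, coeff_mk, smul_eq_mul, real_smul]
    have := Real.pi_pos.ne'
    push_cast
    field_simp
  rw [h3, ← h2, ← integral_const_mul]
  refine integral_congr fun θ _ => ?_
  have e : circleMap 0 1 (2 * Real.pi * θ) = qq 2 θ := by
    simp only [circleMap, qq]; push_cast; rw [zero_add, one_mul]; congr 1; ring
  have e2 : qq (-(2 * n)) θ = (qq 2 θ ^ n)⁻¹ := by
    rw [qq, qq, ← Complex.exp_nat_mul, ← Complex.exp_neg]; congr 1; push_cast; ring
  simp only [deriv_circleMap, e, smul_eq_mul, sub_zero, e2]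
  have := qq_ne 2 θ
  field_simp
  ring

def cmpo {j : ℕ} (v : Vc j) (i : ℕ) : ℂ := if h : i < j + 1 then v ⟨i, h⟩ else 0
lemma cmp_fin {j : ℕ} (v : Vc j) (i : Fin (j + 1)) : cmpo v i = v i := by simp [cmpo, i.isLt]
lemma cmp_big {j : ℕ} (v : Vc j) {i : ℕ} (h : j < i) : cmpo v i = 0 := by simp [cmpo]; omega
lemma ev_cmp {j : ℕ} (v : Vc j) (x y) : ev j v x y = ∑ l ∈ Finset.range (j + 1), cmpo v l * (x ^ (j - l) * y ^ l) := by
  rw [Finset.sum_range]; simp only [cmp_fin]; rfl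

lemma ev_tr {j : ℕ} (v : Vc j) (t w y : ℂ) :
    ev j v t (y + w) = ev j (fun i => ∑ l ∈ Finset.range (j + 1), cmpo v l * t ^ (j - l) * (w ^ (l - (i:ℕ)) * (l.choose i))) 1 y := by
  rw [ev_cmp, ev_cmp]
  have : ∀ i ∈ Finset.range (j + 1), cmpo (fun i : Fin (j + 1) => ∑ l ∈ Finset.range (j + 1), cmpo v l * t ^ (j - l) * (w ^ (l - (i:ℕ)) * (l.choose i))) i * (1 ^ (j - i) * y ^ i)
      = ∑ l ∈ Finset.range (j + 1), cmpo v l * t ^ (j - l) * (y ^ i * w ^ (l - i) * (l.choose i)) := by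
    intro i hi
    rw [cmpo, dif_pos (Finset.mem_range.1 hi), one_pow, one_mul, Finset.sum_mul]
    refine sum_congr rfl fun l _ => ?_
    simp only; ring
  rw [sum_congr rfl this, sum_comm]
  refine sum_congr rfl fun l hl => ?_
  rw [← Finset.mul_sum, ← mul_assoc, add_pow]
  congr 1
  refine sum_subset (Finset.range_mono (Finset.mem_range.1 hl)) fun i _ hi => ?_
  rw [mem_range, not_lt] at hi
  rw [choose_eq_zero_of_lt (by omega)]; simp

section
variable {j : ℕ} {M : ℤ} {φ : ℂ → ℂ → Vc j}

lemma Jac.cS (h : Jac j M φ) {t : ℂ} (ht : 0 < t.im) (z : ℂ) {i : ℕ} (hi : i ≤ j) :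
    cmpo (φ (-1 / t) z) i = - t ^ (2 + j - i) * (qq M (t * z ^ 2) * ∑ s ∈ Finset.range (j + 3), (i + s).choose i * (z ^ s * cmpo (φ t (t * z)) (i + s))) := by
  have h0 : t ≠ 0 := by rintro rfl; simp at ht
  have e : φ (-1 / t) z = fun i : Fin (j + 1) => - t ^ 2 * qq M (t * z ^ 2) * (∑ l ∈ Finset.range (j + 1), cmpo (φ t (t * z)) l * t ^ (j - l) * ((t * z) ^ (l - (i:ℕ)) * (l.choose i))) := by
    refine ev_ext fun y => ?_
    have := h.S t (t * z) ht 1 y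
    rw [mul_div_cancel_left₀ _ h0, mul_one, mul_one, ev_tr] at this
    rw [this]
    have e2 : (t * z) ^ 2 / t = t * z ^ 2 := by field_simp
    rw [e2, ← ev_smul]; rfl
  rw [cmpo, dif_pos (by omega), e]
  simp only
  have e3 : t ^ (2 + j - i) = t ^ 2 * t ^ (j - i) := by rw [← pow_add]; congr 1; omega
  rw [e3]
  have : ∑ l ∈ Finset.range (j + 1), cmpo (φ t (t * z)) l * t ^ (j - l) * ((t * z) ^ (l - i) * (l.choose i)) =
      t ^ (j - i) * ∑ s ∈ Finset.range (j + 3), (i + s).choose i * (z ^ s * cmpo (φ t (t * z)) (i + s)) := by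
    have hr : Finset.range (j + 1) = Finset.range i ∪ Finset.Ico i (j + 1) := by ext a; simp; omega
    rw [hr, Finset.sum_union (by rw [Finset.disjoint_left]; intro a; simp; omega), sum_eq_zero, zero_add, Finset.sum_Ico_eq_sum_range, Finset.mul_sum]
    · have hs : Finset.range (j + 1 - i) ⊆ Finset.range (j + 3) := Finset.range_mono (by omega)
      rw [← sum_subset hs]
      · refine sum_congr rfl fun s hs => ?_
        rw [mem_range] at hs
        rw [Nat.add_sub_cancel_left, mul_pow]
        have : t ^ (j - i) = t ^ (j - (i + s)) * t ^ s := by rw [← pow_add]; congr 1; omega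
        rw [this]; ring
      · intro s _ hs
        rw [mem_range, not_lt] at hs
        rw [cmp_big _ (by omega)]; simp
    · intro l hl
      rw [choose_eq_zero_of_lt (Finset.mem_range.1 hl)]; simp
  rw [this]; ring

def ch (φ : ℂ → ℂ → Vc j) (ν i : ℕ) (t : ℂ) : ℂ := PowerSeries.coeff ν (TT (fun z => cmpo (φ t z) i))

lemma Jac.cd (h : Jac j M φ) {t : ℂ} (ht : 0 < t.im) (i : ℕ) : Differentiable ℂ (fun z => cmpo (φ t z) i) := by
  unfold cmpo
  split_ifs with hi
  · exact fun z => differentiableAt_pi.1 (h.dz t z ht) _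
  · fun_prop

lemma ch_big (ν : ℕ) {i : ℕ} (hi : j < i) (t : ℂ) : ch φ ν i t = 0 := by
  simp only [ch, cmp_big _ hi, TT, coeff_mk, iteratedDeriv_const]; simp

def G0 (M : ℤ) (φ : ℂ → ℂ → Vc j) (ν i : ℕ) (t : ℂ) : ℂ :=
  (i + 1) * (if 1 ≤ ν then ch φ (ν - 1) (i + 1) t else 0) + Real.pi * I * M * (if 2 ≤ ν then ch φ (ν - 2) i t else 0)

def EE (M : ℤ) (t : ℂ) : ℂ → ℂ := fun z => qq M (t * z ^ 2)
lemma EE_diff (M t) : Differentiable ℂ (EE M t) := (qq_diff M).comp (by fun_prop)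
lemma EE0 (M t) : PowerSeries.coeff 0 (TT (EE M t)) = 1 := by simp [TT, EE, qq]
lemma EE_deriv (M t) : deriv (EE M t) = fun z => (2 * (Real.pi * I * M * t)) * (z * EE M t z) := by
  ext z
  have : HasDerivAt (fun z : ℂ => cexp (Real.pi * I * M * (t * z ^ 2))) (cexp (Real.pi * I * M * (t * z ^ 2)) * (Real.pi * I * M * (t * (2 * z)))) z := by
    refine HasDerivAt.cexp ?_
    have := ((hasDerivAt_pow 2 z).const_mul t).const_mul (Real.pi * I * M)
    simpa using this
  show deriv (fun z : ℂ => cexp (Real.pi * I * M * (t * z ^ 2))) z = _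
  rw [this.deriv, EE, qq]; ring
lemma EE1 (M t) : PowerSeries.coeff 1 (TT (EE M t)) = 0 := by simp [TT, iteratedDeriv_one, EE_deriv]
lemma EE2 (M t) : PowerSeries.coeff 2 (TT (EE M t)) = Real.pi * I * M * t := by
  have : iteratedDeriv 2 (EE M t) 0 = 2 * (Real.pi * I * M * t) := by
    rw [iteratedDeriv_succ, iteratedDeriv_one, EE_deriv, deriv_const_mul_field, deriv_fun_mul (by fun_prop) (EE_diff M t 0)]
    simp [EE, qq]
  simp [TT, this]

lemma Jac.chS (h : Jac j M φ) {t : ℂ} (ht : 0 < t.im) {ν i : ℕ} (hi : i ≤ j)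
    (H : ∀ μ l : ℕ, (μ:ℤ) - l < ν - i - 2 → ch φ μ l t = 0) :
    ch φ ν i (-1 / t) = - t ^ (2 + j - i + ν) * (ch φ ν i t + t⁻¹ * G0 M φ ν i t) := by
  have h0 : t ≠ 0 := by rintro rfl; simp at ht
  have hd : ∀ s, Differentiable ℂ (fun z => cmpo (φ t (t * z)) s) := fun s => (h.cd ht s).comp (f := fun z => t * z) (by fun_prop)
  have e : ch φ ν i (-1 / t) = - t ^ (2 + j - i) * ∑ s ∈ Finset.range (j + 3), (i + s).choose i *
      PowerSeries.coeff ν ((PowerSeries.X : PowerSeries ℂ) ^ s * (TT (EE M t) * TT (fun z => cmpo (φ t (t * z)) (i + s)))) := by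
    rw [ch]
    have : (fun z => cmpo (φ (-1 / t) z) i) = fun z => - t ^ (2 + j - i) * (EE M t z * ∑ s ∈ Finset.range (j + 3), (i + s).choose i * (z ^ s * cmpo (φ t (t * z)) (i + s))) := by
      ext z; exact h.cS ht z hi
    have hd2 : ∀ s, Differentiable ℂ (fun z => z ^ s * cmpo (φ t (t * z)) (i + s)) := fun s => (differentiable_id.pow s).mul (hd _)
    have hd3 : ∀ s, Differentiable ℂ (fun z => ((i + s).choose i : ℂ) * (z ^ s * cmpo (φ t (t * z)) (i + s))) := fun s => (hd2 s).const_mul _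
    rw [this, TT_cmul, coeff_C_mul, TT_mul (EE_diff M t) (Differentiable.fun_sum fun s _ => hd3 s), TT_sum _ hd3, Finset.mul_sum, map_sum]
    congr 1
    refine sum_congr rfl fun s _ => ?_
    rw [TT_cmul, TT_mul (by fun_prop) (hd _), TT_pow, mul_left_comm, coeff_C_mul, mul_left_comm]
  have ec : ∀ b s, PowerSeries.coeff b (TT (fun z => cmpo (φ t (t * z)) s)) = t ^ b * ch φ b s t := fun b s => TT_scale (h.cd ht s) t b
  have hz : ∀ s, 2 ≤ s → PowerSeries.coeff ν (PowerSeries.X ^ s * (TT (EE M t) * TT (fun z => cmpo (φ t (t * z)) (i + s)))) = 0 := by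
    intro s hs
    rw [PowerSeries.coeff_X_pow_mul']
    split_ifs with hh
    · rw [coeff_mul]
      refine sum_eq_zero fun p hp => ?_
      rw [Finset.HasAntidiagonal.mem_antidiagonal] at hp
      rw [ec, H _ _ (by push_cast; omega)]; simp
    · rfl
  rw [e, show j + 3 = (j + 1) + 1 + 1 by ring, sum_range_succ', sum_range_succ', sum_eq_zero (fun s _ => by rw [hz _ (by omega), mul_zero])]
  have t1 : PowerSeries.coeff ν (PowerSeries.X ^ (0 + 1) * (TT (EE M t) * TT (fun z => cmpo (φ t (t * z)) (i + (0 + 1))))) =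
      t ^ ν * t⁻¹ * (if 1 ≤ ν then ch φ (ν - 1) (i + 1) t else 0) := by
    rw [PowerSeries.coeff_X_pow_mul', zero_add]
    split_ifs with hh
    · obtain ⟨n, rfl⟩ : ∃ n, ν = n + 1 := ⟨ν - 1, by omega⟩
      rw [Nat.add_sub_cancel, coeff_mul, Finset.Nat.sum_antidiagonal_eq_sum_range_succ_mk, sum_range_succ', sum_eq_zero]
      · simp only [EE0, ec, Nat.sub_zero]; field_simp; ring
      · intro a ha
        rw [mem_range] at ha
        simp only [ec]
        rw [H _ _ (by push_cast; omega)]; simp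
    · simp
  have t0 : PowerSeries.coeff ν (PowerSeries.X ^ 0 * (TT (EE M t) * TT (fun z => cmpo (φ t (t * z)) (i + 0)))) =
      t ^ ν * (ch φ ν i t + t⁻¹ * (Real.pi * I * M * (if 2 ≤ ν then ch φ (ν - 2) i t else 0))) := by
    rw [pow_zero, one_mul, coeff_mul, Finset.Nat.sum_antidiagonal_eq_sum_range_succ_mk]
    rcases ν with _ | _ | n
    · simp [EE0, ec]
    · simp [sum_range_succ, EE0, EE1, ec]
    · rw [sum_range_succ', sum_range_succ', sum_range_succ', sum_eq_zero]
      · simp only [EE0, EE1, EE2, ec, zero_add, Nat.reduceAdd]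
        simp
        field_simp
        ring
      · intro a ha
        simp only [ec]
        rw [mem_range] at ha
        rw [H _ _ (by omega)]; simp
  rw [t1, t0, G0]
  simp only [zero_add, add_zero, Nat.choose_self, Nat.choose_succ_self_right]
  rw [pow_add]; push_cast; ring
end
end

section
section
variable {j : ℕ} {M : ℤ} {φ : ℂ → ℂ → Vc j}

lemma Jac.ccm (h : Jac j M φ) {X : Type*} [TopologicalSpace X] {a b : X → ℂ} (ha : Continuous a) (hb : Continuous b)
    (hp : ∀ x, 0 < (a x).im) (i : ℕ) : Continuous (fun x => cmpo (φ (a x) (b x)) i) := by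
  unfold cmpo
  split_ifs with hi
  · exact (continuous_apply _).comp (h.cc ha hb hp)
  · fun_prop

lemma Jac.chAP (h : Jac j M φ) (ν i : ℕ) : AP 0 (ch φ ν i) where
  d := by
    have hU : IsOpen {t : ℂ | 0 < t.im} := isOpen_lt (by fun_prop) (by fun_prop)
    intro w hw
    have := par_diff (f := fun t θ => cmpo (φ t (qq 2 θ)) i * qq (-(2 * ν)) θ) hU ?_ ?_ 0 1 w hw
    · refine this.congr_of_eventuallyEq ?_
      filter_upwards [hU.mem_nhds hw] with t ht
      exact TT_circ (h.cd ht i) ν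
    · rw [continuousOn_iff_continuous_domRestrict]
      have := h.ccm (X := ({t : ℂ | 0 < t.im} ×ˢ (Set.univ : Set ℝ) : Set (ℂ × ℝ))) (a := fun p => p.1.1) (b := fun p => qq 2 p.1.2) (by fun_prop) (by fun_prop) (fun p => p.2.1) i
      exact this.mul (by fun_prop : Continuous fun p : ({t : ℂ | 0 < t.im} ×ˢ (Set.univ : Set ℝ) : Set (ℂ × ℝ)) => qq (-(2 * ν)) p.1.2)
    · intro x p hp
      refine DifferentiableAt.mul_const ?_ _
      unfold cmpo
      split_ifs with hi
      · exact differentiableAt_pi.1 (h.dt p _ hp) _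
      · fun_prop
  p := by
    intro w hw
    have : (fun z => cmpo (φ (w + 1) z) i) = fun z => (-1) * cmpo (φ w z) i := by
      ext z; rw [h.T w z hw]; unfold cmpo; split_ifs <;> simp
    rw [ch, this, TT_cmul, coeff_C_mul, ch]; ring

lemma Jac.ch_co (h : Jac j M φ) (ν : ℕ) {i : ℕ} (hi : i < j + 1) (N : ℤ) :
    co 1 (ch φ ν i) N = PowerSeries.coeff ν (TT (fun z => pp φ N z ⟨i, hi⟩)) := by
  have hd : Differentiable ℂ (fun z => pp φ N z ⟨i, hi⟩) := fun z => differentiableAt_pi.1 (h.pp_diff N z) _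
  rw [TT_circ hd, co]
  have e1 : ∀ x : ℝ, ch φ ν i (x ⊹) * qq (-N) (x ⊹) = ∫ θ in (0:ℝ)..1, cmpo (φ (x ⊹) (qq 2 θ)) i * qq (-(2 * ν)) θ * qq (-N) (x ⊹) := by
    intro x
    rw [integral_mul_const, ch, TT_circ (h.cd (by simp) i)]
  have hcc := h.ccm (X := ℝ × ℝ) (a := fun p => p.1 ⊹) (b := fun p => qq 2 p.2) (by fun_prop) (by fun_prop) (fun p => by simp) i
  simp only [e1]
  rw [fub]
  · refine integral_congr fun θ _ => ?_
    have hc2 := h.cc (X := ℝ) (a := fun p => p ⊹) (b := fun p => qq 2 θ) (by fun_prop) (by fun_prop) (fun p => by simp)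
    have e2 : pp φ N (qq 2 θ) ⟨i, hi⟩ = ∫ x in (0:ℝ)..1, qq (-N) (x ⊹) * φ (x ⊹) (qq 2 θ) ⟨i, hi⟩ := by
      rw [pp]
      have hc3 : Continuous fun x : ℝ => qq (-N) (x ⊹) • φ (x ⊹) (qq 2 θ) := Continuous.smul (f := fun x : ℝ => qq (-N) (x ⊹)) (by fun_prop) hc2
      exact ((ContinuousLinearMap.proj (R := ℂ) (φ := fun _ : Fin (j+1) => ℂ) (⟨i, hi⟩ : Fin (j+1))).intervalIntegral_comp_comm (hc3.intervalIntegrable 0 1)).symm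
    rw [e2, ← integral_mul_const]
    refine integral_congr fun x _ => ?_
    simp only [cmpo, dif_pos hi]; ring
  · exact (hcc.mul (by fun_prop : Continuous fun p : ℝ × ℝ => qq (-(2 * ν)) p.2)).mul (by fun_prop : Continuous fun p : ℝ × ℝ => qq (-N) (p.1 ⊹))
end

section
variable {j : ℕ} {f : ℂ → ℂ → ℂ → Vc j}
lemma Form.ch_co (h : Form j f) {N M : ℤ} (hN : Odd N) (hM : Odd M) (B : ℕ) (hB : 4 * N * M ≤ (B + 1) ^ 2) (ν i : ℕ) :
    co 1 (ch (phi f M) ν i) N = (Real.pi * I) ^ ν * (ν.factorial : ℂ)⁻¹ * ∑ R ∈ oddR B, (R : ℂ) ^ ν * cmpo (AC f N R M) i := by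
  by_cases hi : i < j + 1
  · rw [(h.jac hM).ch_co ν hi]
    have : (fun z => pp (phi f M) N z ⟨i, hi⟩) = fun z => ∑ R ∈ oddR B, AC f N R M ⟨i, hi⟩ * qq R z := by
      ext z; exact h.pp_sum hN hM B hB z _
    rw [this, TT_sum _ (fun R => (qq_diff R).const_mul _), map_sum, Finset.mul_sum]
    refine sum_congr rfl fun R _ => ?_
    rw [TT_cmul, coeff_C_mul, TT_qq, cmpo, dif_pos hi]; ring
  · have : ch (phi f M) ν i = fun _ => 0 := by ext t; exact ch_big ν (by omega) t
    rw [this, sum_eq_zero]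
    · simp [co]
    · intro R _; rw [cmp_big _ (by omega), mul_zero]
end
end

section
open UpperHalfPlane ModularForm MatrixGroups OnePoint in
lemma mform {u : ℂ → ℂ} {k : ℤ} (hd : ∀ t : ℂ, 0 < t.im → DifferentiableAt ℂ u t) (hT : ∀ t : ℂ, 0 < t.im → u (t + 1) = u t)
    (hS : ∀ t : ℂ, 0 < t.im → u (-1 / t) = t ^ k * u t) (hb : ∃ A C : ℝ, ∀ t : ℂ, A ≤ t.im → ‖u t‖ ≤ C) :
    ∃ F : ModularForm 𝒮ℒ k, ∀ z : UpperHalfPlane, F z = u z := by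
  have h1 : (fun z : UpperHalfPlane => u z) ∣[k] ModularGroup.T = fun z : UpperHalfPlane => u z := by
    ext z
    have hd : denom (ModularGroup.T : SL(2, ℤ)) z = 1 := by simp [ModularGroup.denom_apply, ModularGroup.coe_T]
    rw [SL_slash_apply, hd, modular_T_smul, _root_.one_zpow, mul_one, coe_vadd, ofReal_one, add_comm]
    exact hT z z.2
  have h2 : (fun z : UpperHalfPlane => u z) ∣[k] ModularGroup.S = fun z : UpperHalfPlane => u z := by
    ext z
    rw [SL_slash_apply, UpperHalfPlane.modular_S_smul, ModularGroup.denom_S]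
    have := hS z z.2
    show u ((-(z:ℂ))⁻¹) * _ = _
    rw [show (-(z:ℂ))⁻¹ = -1 / z by rw [← neg_inv, neg_div, one_div], this, _root_.zpow_neg]
    have := zpow_ne_zero k z.ne_zero
    field_simp
  have h3 := SlashInvariantForm.slash_action_generators_SL2Z h2 h1
  refine ⟨{ toFun := fun z => u z, slash_action_eq' := ?_, holo' := ?_, bdd_at_cusps' := ?_ }, fun z => rfl⟩
  · rintro _ ⟨A, rfl⟩
    exact h3 A
  · rw [UpperHalfPlane.mdifferentiable_iff]
    refine .congr (fun z hz ↦ (hd z hz).differentiableWithinAt) fun z hz ↦ ?_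
    simp [ofComplex_apply_of_im_pos hz]
  · intro c hc
    rw [Subgroup.IsArithmetic.isCusp_iff_isCusp_SL2Z] at hc
    rw [isBoundedAt_iff_forall_SL2Z hc]
    intro γ _
    show IsBoundedAtImInfty ((fun z : UpperHalfPlane => u z) ∣[k] γ)
    rw [h3, isBoundedAtImInfty_iff]
    obtain ⟨A, C, h⟩ := hb
    exact ⟨C, A, fun z hz => h z hz⟩

lemma mzero {u : ℂ → ℂ} {k : ℤ} (hd : ∀ t : ℂ, 0 < t.im → DifferentiableAt ℂ u t) (hT : ∀ t : ℂ, 0 < t.im → u (t + 1) = u t)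
    (hS : ∀ t : ℂ, 0 < t.im → u (-1 / t) = t ^ k * u t) (hb : ∃ A C : ℝ, ∀ t : ℂ, A ≤ t.im → ‖u t‖ ≤ C) (hk : k < 0 ∨ k = 2)
    (t : ℂ) (ht : 0 < t.im) : u t = 0 := by
  obtain ⟨F, hF⟩ := mform hd hT hS hb
  have : F = 0 := by
    rcases hk with hk | rfl
    · exact rank_zero_iff_forall_zero.mp (ModularForm.levelOne_neg_weight_rank_zero hk) F
    · exact rank_zero_iff_forall_zero.mp ModularForm.levelOne_weight_two_rank_zero F
  have h2 := hF ⟨t, ht⟩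
  rw [this] at h2
  exact h2.symm

def e12 (t : ℂ) : ℂ := ModularForm.eta t ^ 12
def ue (t : ℂ) : ℂ := e12 t * qq (-1) t

lemma ue_eq (t : ℂ) : ue t = (∏' n, (1 - eta_q n t)) ^ 12 := by
  rw [ue, e12, ModularForm.eta, mul_pow]
  have : Function.Periodic.qParam 24 t ^ 12 * qq (-1) t = 1 := by
    rw [Function.Periodic.qParam, ← Complex.exp_nat_mul, qq, ← exp_add, exp_eq_one_iff]
    refine ⟨0, ?_⟩
    push_cast; ring
  rw [mul_right_comm, this, one_mul]
lemma e12_ue (t) : e12 t = ue t * qq 1 t := by rw [ue, mul_assoc, qq_neg, mul_one]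
lemma ue_T (t : ℂ) : ue (t + 1) = ue t := by
  rw [ue_eq, ue_eq]
  have : ∀ n, eta_q n (t + 1) = eta_q n t := by
    intro n
    rw [ModularForm.eta_q_eq_pow, ModularForm.eta_q_eq_pow, mul_add, mul_one, exp_add, exp_two_pi_mul_I, mul_one]
  simp only [this]
lemma e12_T (t : ℂ) : e12 (t + 1) = - e12 t := by
  rw [e12_ue, e12_ue, ue_T, qq_add, qq_one]; ring
lemma e12_ne {t : ℂ} (ht : 0 < t.im) : e12 t ≠ 0 := pow_ne_zero _ (ModularForm.eta_ne_zero ht)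
lemma ue_ne {t : ℂ} (ht : 0 < t.im) : ue t ≠ 0 := mul_ne_zero (e12_ne ht) (qq_ne _ _)
lemma e12_d {t : ℂ} (ht : 0 < t.im) : DifferentiableAt ℂ e12 t := (ModularForm.differentiableAt_eta_of_mem_upperHalfPlaneSet ht).fun_pow 12
lemma ue_d {t : ℂ} (ht : 0 < t.im) : DifferentiableAt ℂ ue t := (e12_d ht).mul (qq_diff _ t)
lemma sqrt12 {z : ℂ} (hz : z ≠ 0) : sqrt z ^ 12 = z ^ 6 := by
  rw [sqrt_eq_exp hz, ← exp_nat_mul]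
  rw [show ((12:ℕ):ℂ) * (log z / 2) = (6 : ℕ) * log z by push_cast; ring, exp_nat_mul, exp_log hz]
lemma e12_S {t : ℂ} (ht : 0 < t.im) : e12 (-1 / t) = - t ^ 6 * e12 t := by
  have := ModularForm.eta_comp_eq_csqrt_I_inv ht
  simp only [Function.comp, Pi.smul_apply, Pi.mul_apply, smul_eq_mul] at this
  rw [e12, this, mul_pow, mul_pow, inv_pow, sqrt12 I_ne_zero, sqrt12 (by rintro rfl; simp at ht), e12]
  have : (I:ℂ) ^ 6 = -1 := by rw [show 6 = 4 + 2 by rfl, pow_add, I_pow_four, I_sq, one_mul]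
  rw [this]; norm_num
lemma ue_sq (z : UpperHalfPlane) : ue z ^ 2 = ∏' n, (1 - eta_q n z) ^ 24 := by
  rw [ue_eq, ← pow_mul]
  exact ((ModularForm.multipliableLocallyUniformlyOn_eta.multipliable z.2).tprod_pow _).symm
lemma ue_bd : ∃ A : ℝ, ∀ t : ℂ, A ≤ t.im → 1 / 2 ≤ ‖ue t‖ ∧ ‖ue t‖ ≤ 2 := by
  have h := ModularForm.tendsto_atImInfty_tprod_one_sub_eta_q_pow.norm
  rw [norm_one] at h
  have h2 := h.eventually (Icc_mem_nhds (show (1/4:ℝ) < 1 by norm_num) (show (1:ℝ) < 4 by norm_num))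
  rw [UpperHalfPlane.atImInfty, eventually_comap, eventually_atTop] at h2
  obtain ⟨A, hA⟩ := h2
  refine ⟨max A 1, fun t ht => ?_⟩
  have ht0 : 0 < t.im := by linarith [le_max_right A 1]
  have h3 := hA t.im (le_trans (le_max_left _ _) ht) ⟨t, ht0⟩ rfl
  rw [← ue_sq, norm_pow] at h3
  change (1/4:ℝ) ≤ ‖ue t‖^2 ∧ ‖ue t‖^2 ≤ 4 at h3
  have := norm_nonneg (ue t)
  constructor <;> nlinarith

lemma qq_pow (N : ℤ) (n : ℕ) (w) : qq N w ^ n = qq (n * N) w := by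
  rw [qq, qq, ← Complex.exp_nat_mul]; congr 1; push_cast; ring

/-- vanishing: order at least `N0`, weight `w` -/
lemma AP.van {g : ℂ → ℂ} (h : AP 0 g) {w : ℤ} (hS : ∀ t : ℂ, 0 < t.im → g (-1 / t) = - t ^ w * g t) {N0 : ℕ} (hN : Odd N0)
    (hc : ∀ N : ℤ, Odd N → N < N0 → co 1 g N = 0) (hw : w - 6 * N0 < 0 ∨ w - 6 * N0 = 2) (t : ℂ) (ht : 0 < t.im) : g t = 0 := by
  have key := mzero (u := fun t => g t * (e12 t ^ N0)⁻¹) (k := w - 6 * N0) ?_ ?_ ?_ ?_ hw t ht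
  · rcases mul_eq_zero.1 key with h | h
    · exact h
    · exact absurd h (inv_ne_zero (pow_ne_zero _ (e12_ne ht)))
  · intro t ht
    exact (h.d t ht).mul (((e12_d ht).fun_pow _).fun_inv (pow_ne_zero _ (e12_ne ht)))
  · intro t ht
    simp only [h.p t ht, e12_T, hN.neg_pow]; simp
  · intro t ht
    have h0 : t ≠ 0 := by rintro rfl; simp at ht
    have := pow_ne_zero N0 (e12_ne ht)
    simp only [hS t ht, e12_S ht]
    rw [neg_mul, neg_mul (t ^ 6), hN.neg_pow, mul_pow, _root_.zpow_sub₀ h0, ← pow_mul]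
    have e : t ^ (6 * (N0:ℤ)) = t ^ (6 * N0) := by rw [← zpow_natCast]; norm_cast
    rw [e]
    field_simp
  · obtain ⟨A, hA⟩ := ue_bd
    obtain ⟨C, hC⟩ := h.bdd 1 one_pos N0 hc 1 one_pos
    refine ⟨max A 1, C * 2 ^ N0, fun t ht => ?_⟩
    have h1 := (hA t (le_trans (le_max_left _ _) ht)).1
    have h2 := hC t (le_trans (le_max_right _ _) ht)
    have e : g t * (e12 t ^ N0)⁻¹ = g t * qq (-N0) t * (ue t ^ N0)⁻¹ := by
      rw [e12_ue, mul_pow, qq_pow, mul_inv, mul_one, mul_assoc]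
      congr 1
      have := qq_neg N0 t
      rw [mul_comm, eq_inv_of_mul_eq_one_left this]
    show ‖g t * (e12 t ^ N0)⁻¹‖ ≤ _
    rw [e, norm_mul, norm_inv, norm_pow]
    have h3 : (‖ue t‖ ^ N0)⁻¹ ≤ 2 ^ N0 := by
      rw [← inv_pow]
      refine pow_le_pow_left₀ (by positivity) ?_ _
      rw [inv_le_comm₀ (by linarith) (by norm_num)]; linarith
    exact mul_le_mul h2 h3 (by positivity) (le_trans (norm_nonneg _) h2)
end

section
lemma AP.co_van {g : ℂ → ℂ} (h : AP 0 g) {N0 : ℤ} {A C : ℝ} (hb : ∀ t : ℂ, A ≤ t.im → ‖g t‖ ≤ C * ‖qq N0 t‖) {N : ℤ} (hN : Odd N) (hl : N < N0) :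
    co 1 g N = 0 := by
  have h1 : ∀ Y : ℝ, max A 1 ≤ Y → ‖co 1 g N‖ ≤ C * rexp (-(Real.pi * Y)) := by
    intro Y hY
    have hY0 : 0 < Y := by linarith [le_max_right A 1]
    have hC : 0 ≤ C := by
      have := hb (Y * I) (by simpa using le_trans (le_max_left _ _) hY)
      have h3 : 0 < ‖qq N0 (Y * I)‖ := norm_pos_iff.2 (qq_ne _ _)
      by_contra hc; push Not at hc
      have h4 := norm_nonneg (g (Y * I))
      nlinarith
    rw [← h.co_eq (Y * I) (by simpa using hY0) 1 one_pos hN]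
    refine (norm_integral_le_of_norm_le_const (C := C * rexp (-(Real.pi * Y))) fun x _ => ?_).trans (by simp)
    rw [norm_mul]
    have h2 := hb (Y * I + x) (by simpa using le_trans (le_max_left _ _) hY)
    refine (mul_le_mul_of_nonneg_right h2 (norm_nonneg _)).trans ?_
    rw [mul_assoc]
    refine mul_le_mul_of_nonneg_left ?_ hC
    rw [norm_qq, norm_qq, ← Real.exp_add, exp_le_exp]
    simp only [add_im, mul_im, ofReal_re, I_im, mul_one, ofReal_im, I_re, mul_zero, add_zero]
    push_cast
    have : (N:ℝ) + 1 ≤ N0 := by exact_mod_cast hl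
    have := mul_nonneg (mul_nonneg Real.pi_pos.le hY0.le) (sub_nonneg.2 this)
    nlinarith
  have h2 : Tendsto (fun Y : ℝ => C * rexp (-(Real.pi * Y))) atTop (𝓝 (C * 0)) := by
    refine Tendsto.const_mul _ (Real.tendsto_exp_neg_atTop_nhds_zero.comp ?_)
    exact tendsto_id.const_mul_atTop pi_pos
  rw [mul_zero] at h2
  have h3 := ge_of_tendsto h2 ((eventually_ge_atTop (max A 1)).mono h1)
  exact norm_le_zero_iff.1 h3

lemma AP.co_cts {g : ℂ → ℂ} (h : AP 0 g) (N : ℤ) : Continuous fun x : ℝ => g (x ⊹) * qq (-N) (x ⊹) := by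
  refine Continuous.mul ?_ (by fun_prop)
  rw [continuous_iff_continuousAt]
  intro x
  exact (h.d _ (by simp)).continuousAt.comp (f := fun x : ℝ => (x ⊹ : ℂ)) (by fun_prop)

lemma AP.comb {g g2 : ℂ → ℂ} (h : AP 0 g) (h2 : AP 0 g2) (c : ℂ) : AP 0 (fun t => g t - c * g2 t) where
  d w hw := (h.d w hw).sub ((h2.d w hw).const_mul c)
  p w hw := by simp only [h.p w hw, h2.p w hw]; ring
lemma AP.comb_co {g g2 : ℂ → ℂ} (h : AP 0 g) (h2 : AP 0 g2) (c : ℂ) (N : ℤ) : co 1 (fun t => g t - c * g2 t) N = co 1 g N - c * co 1 g2 N := by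
  rw [co, co, co, ← integral_const_mul, ← intervalIntegral.integral_sub]
  · refine integral_congr fun x _ => ?_
    ring
  · exact (h.co_cts N).intervalIntegrable _ _
  · exact ((h2.co_cts N).const_mul c).intervalIntegrable _ _


section
open UpperHalfPlane hiding I
open ModularForm MatrixGroups Manifold

structure Nice (f : ℍ → ℂ) : Prop where
  p : Function.Periodic (f ∘ ofComplex) ((1:ℝ) : ℂ)
  d : MDiff f
  b : IsBoundedAtImInfty f

lemma Nice.an {f : ℍ → ℂ} (h : Nice f) : AnalyticAt ℂ (cuspFunction 1 f) 0 := analyticAt_cuspFunction_zero one_pos h.p h.d h.b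
lemma Nice.mul {f g : ℍ → ℂ} (h : Nice f) (h2 : Nice g) : Nice (f * g) where
  p := h.p.mul h2.p
  d := h.d.mul h2.d
  b := h.b.mul h2.b
lemma Nice.sub {f g : ℍ → ℂ} (h : Nice f) (h2 : Nice g) : Nice (f - g) where
  p := h.p.sub h2.p
  d := h.d.sub h2.d
  b := by
    show IsBoundedAtImInfty (f - g)
    rw [sub_eq_add_neg]
    exact h.b.add h2.b.neg
lemma Nice.qmul {f g : ℍ → ℂ} (h : Nice f) (h2 : Nice g) : qExpansion 1 (f * g) = qExpansion 1 f * qExpansion 1 g := qExpansion_mul h.an h2.an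
lemma Nice.of_mf {k : ℤ} (f : ModularForm 𝒮ℒ k) : Nice f where
  p := SlashInvariantFormClass.periodic_comp_ofComplex f one_mem_strictPeriods_SL
  d := f.holo'
  b := ModularFormClass.bdd_at_infty f

lemma Nice.of_fun {u : ℂ → ℂ} (hd : ∀ t : ℂ, 0 < t.im → DifferentiableAt ℂ u t) (hT : ∀ t : ℂ, 0 < t.im → u (t + 1) = u t)
    (hb : ∃ A C : ℝ, ∀ t : ℂ, A ≤ t.im → ‖u t‖ ≤ C) : Nice (fun z => u z) where
  p := by
    intro w
    by_cases hw : 0 < im w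
    · have : 0 < im (w + (1:ℝ)) := by simp [hw]
      simp only [Function.comp, ofComplex_apply_of_im_pos this, ofComplex_apply_of_im_pos hw]
      simpa using hT w hw
    · have h2 : im (w + (1:ℝ)) ≤ 0 := by simpa using hw
      simp only [Function.comp, ofComplex_apply_of_im_nonpos h2, ofComplex_apply_of_im_nonpos (not_lt.1 hw)]
  d := by
    rw [UpperHalfPlane.mdifferentiable_iff]
    refine .congr (fun z hz ↦ (hd z hz).differentiableWithinAt) fun z hz ↦ ?_
    simp [ofComplex_apply_of_im_pos hz]
  b := by
    rw [isBoundedAtImInfty_iff]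
    obtain ⟨A, C, h⟩ := hb
    exact ⟨C, A, fun z hz => h z hz⟩

def UE : ℍ → ℂ := fun z => ue z
lemma UE_nice : Nice UE := Nice.of_fun (fun t ht => ue_d ht) (fun t _ => ue_T t) (by obtain ⟨A, h⟩ := ue_bd; exact ⟨A, 2, fun t ht => (h t ht).2⟩)

lemma Nice.int {f : ℍ → ℂ} (h : Nice f) (n : ℕ) : (qExpansion 1 f).coeff n = ∫ x in (0:ℝ)..1, qq (-(2 * n)) (x ⊹) * f ⟨x ⊹, by simp⟩ := by
  rw [qExpansion_coeff_eq_intervalIntegral one_pos h.p h.d h.b n one_pos]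
  simp only [ofReal_one, div_one, one_mul]
  refine integral_congr fun x _ => ?_
  have : qq (-(2 * n)) (x + I) = 1 / Function.Periodic.qParam 1 (x + I) ^ n := by
    rw [Function.Periodic.qParam, ← Complex.exp_nat_mul, qq, one_div, ← Complex.exp_neg]; congr 1; push_cast; ring
  simp only [this]
  rfl

lemma E4co (n : ℕ) (hn : n ≠ 0) : (qExpansion 1 E₄).coeff n = 240 * (ArithmeticFunction.sigma 3 n) := by
  norm_num [EisensteinSeries.E_qExpansion_coeff _ (⟨2, rfl⟩ : Even 4), show bernoulli 4 = -1 / 30 by decide +kernel, hn]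
lemma E6co (n : ℕ) (hn : n ≠ 0) : (qExpansion 1 E₆).coeff n = -504 * (ArithmeticFunction.sigma 5 n) := by
  norm_num [EisensteinSeries.E_qExpansion_coeff _ (⟨3, rfl⟩ : Even 6), show bernoulli 6 = 1 / 42 by decide +kernel, hn]
lemma E4c : (qExpansion 1 E₄).coeff 0 = 1 ∧ (qExpansion 1 E₄).coeff 1 = 240 ∧ (qExpansion 1 E₄).coeff 2 = 2160 ∧ (qExpansion 1 E₄).coeff 3 = 6720 := by
  refine ⟨EisensteinSeries.E_qExpansion_coeff_zero _ ⟨2, rfl⟩, ?_, ?_, ?_⟩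
  · rw [E4co _ (by norm_num), show ArithmeticFunction.sigma 3 1 = 1 by decide +kernel]; norm_num
  · rw [E4co _ (by norm_num), show ArithmeticFunction.sigma 3 2 = 9 by decide +kernel]; norm_num
  · rw [E4co _ (by norm_num), show ArithmeticFunction.sigma 3 3 = 28 by decide +kernel]; norm_num
lemma E6c : (qExpansion 1 E₆).coeff 0 = 1 ∧ (qExpansion 1 E₆).coeff 1 = -504 ∧ (qExpansion 1 E₆).coeff 2 = -16632 ∧ (qExpansion 1 E₆).coeff 3 = -122976 := by
  refine ⟨EisensteinSeries.E_qExpansion_coeff_zero _ ⟨3, rfl⟩, ?_, ?_, ?_⟩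
  · rw [E6co _ (by norm_num), show ArithmeticFunction.sigma 5 1 = 1 by decide +kernel]; norm_num
  · rw [E6co _ (by norm_num), show ArithmeticFunction.sigma 5 2 = 33 by decide +kernel]; norm_num
  · rw [E6co _ (by norm_num), show ArithmeticFunction.sigma 5 3 = 244 by decide +kernel]; norm_num

lemma cf0 (p q : PowerSeries ℂ) : (p * q).coeff 0 = p.coeff 0 * q.coeff 0 := by
  simp [coeff_mul]
lemma cf1 (p q : PowerSeries ℂ) : (p * q).coeff 1 = p.coeff 0 * q.coeff 1 + p.coeff 1 * q.coeff 0 := by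
  simp [coeff_mul, Finset.Nat.sum_antidiagonal_eq_sum_range_succ_mk, sum_range_succ]
lemma cf2 (p q : PowerSeries ℂ) : (p * q).coeff 2 = p.coeff 0 * q.coeff 2 + p.coeff 1 * q.coeff 1 + p.coeff 2 * q.coeff 0 := by
  simp [coeff_mul, Finset.Nat.sum_antidiagonal_eq_sum_range_succ_mk, sum_range_succ]
lemma cf3 (p q : PowerSeries ℂ) : (p * q).coeff 3 = p.coeff 0 * q.coeff 3 + p.coeff 1 * q.coeff 2 + p.coeff 2 * q.coeff 1 + p.coeff 3 * q.coeff 0 := by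
  simp [coeff_mul, Finset.Nat.sum_antidiagonal_eq_sum_range_succ_mk, sum_range_succ]

lemma Dfun (z : ℍ) : 1728 * qq 2 z * (ue z * ue z) = E₄ z * E₄ z * E₄ z - E₆ z * E₆ z := by
  have h := discriminant_eq_E₄_cube_sub_E₆_sq z
  have h2 : discriminant z = qq 2 z * (ue z * ue z) := by
    have h3 : qq 2 (z:ℂ) = qq 1 z * qq 1 z := by rw [← qq_idx]; norm_num
    have h4 : discriminant z = e12 z * e12 z := by rw [discriminant, e12, ← pow_add]
    rw [h4, e12_ue, h3]; ring
  rw [h2] at h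
  linear_combination 1728 * h

lemma UUco (n : ℕ) : 1728 * (qExpansion 1 UE * qExpansion 1 UE).coeff n = (qExpansion 1 E₄ * qExpansion 1 E₄ * qExpansion 1 E₄ - qExpansion 1 E₆ * qExpansion 1 E₆).coeff (n + 1) := by
  have n4 := Nice.of_mf E₄
  have n6 := Nice.of_mf E₆
  rw [← UE_nice.qmul UE_nice, ← n4.qmul n4, ← (n4.mul n4).qmul n4, ← n6.qmul n6, ← qExpansion_sub ((n4.mul n4).mul n4).an (n6.mul n6).an,
    (UE_nice.mul UE_nice).int, (((n4.mul n4).mul n4).sub (n6.mul n6)).int, ← integral_const_mul]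
  refine integral_congr fun x _ => ?_
  simp only [Pi.mul_apply, Pi.sub_apply]
  rw [← Dfun]
  simp only [UE]
  have : qq (-(2 * n)) (x ⊹) = qq (-(2 * (n + 1 : ℕ))) (x ⊹) * qq 2 (x ⊹) := by
    rw [← qq_idx]; congr 1; push_cast; ring
  rw [this]
  ring

lemma UEc : (qExpansion 1 UE).coeff 0 ≠ 0 ∧ (qExpansion 1 UE).coeff 1 = -12 * (qExpansion 1 UE).coeff 0 ∧ (qExpansion 1 UE).coeff 2 = 54 * (qExpansion 1 UE).coeff 0 := by
  obtain ⟨a0, a1, a2, a3⟩ := E4c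
  obtain ⟨b0, b1, b2, b3⟩ := E6c
  have h0 := UUco 0
  have h1 := UUco 1
  have h2 := UUco 2
  simp only [map_sub, zero_add, Nat.reduceAdd, cf0, cf1, cf2, cf3, a0, a1, a2, a3, b0, b1, b2, b3] at h0 h1 h2
  set u0 := (qExpansion 1 UE).coeff 0
  set u1 := (qExpansion 1 UE).coeff 1
  set u2 := (qExpansion 1 UE).coeff 2
  have k0 : u0 * u0 = 1 := by linear_combination h0 / 1728
  have hu : u0 ≠ 0 := by rintro h; rw [h] at k0; simp at k0
  have k1 : u0 * (u1 + 12 * u0) = 0 := by linear_combination h1 / (2 * 1728) + 12 * k0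
  have k1' : u1 = -12 * u0 := by
    have := (mul_eq_zero.1 k1).resolve_left hu
    linear_combination this
  refine ⟨hu, k1', ?_⟩
  rw [k1'] at h2
  have k2 : u0 * (u2 - 54 * u0) = 0 := by linear_combination h2 / (2 * 1728) - (54 + 72) * k0
  have := (mul_eq_zero.1 k2).resolve_left hu
  linear_combination this

/-- weight-one-dimensional case -/
lemma AP.v1 {g : ℂ → ℂ} (h : AP 0 g) {k : ℤ} (hS : ∀ t : ℂ, 0 < t.im → g (-1 / t) = - t ^ (k + 6) * g t)
    (hc : ∀ N : ℤ, Odd N → N < 1 → co 1 g N = 0) (hk : k < 12 ∨ k = 14) (m : ModularForm 𝒮ℒ k) {m1 m2 : ℂ} (hm0 : (qExpansion 1 m).coeff 0 = 1)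
    (hm1 : (qExpansion 1 m).coeff 1 = m1) (hm2 : (qExpansion 1 m).coeff 2 = m2) :
    co 1 g 3 = (m1 - 12) * co 1 g 1 ∧ co 1 g 5 = (m2 - 12 * m1 + 54) * co 1 g 1 := by
  obtain ⟨u0, u1, u2⟩ := UEc
  have nm := Nice.of_mf m
  set M : ℂ → ℂ := fun t => m (ofComplex t) with hM
  set g2 : ℂ → ℂ := fun t => e12 t * M t with hg2
  have hMz : ∀ z : ℍ, M z = m z := fun z => by simp [hM]
  have ap2 : AP 0 g2 := by
    refine ⟨fun w hw => (e12_d hw).mul ?_, fun w hw => ?_⟩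
    · exact UpperHalfPlane.mdifferentiableAt_iff.mp (nm.d ⟨w, hw⟩)
    · have := nm.p w
      simp only [Function.comp, ofReal_one] at this
      simp only [hg2, hM, this, e12_T]; ring
  have gS : ∀ t : ℂ, 0 < t.im → g2 (-1 / t) = - t ^ (k + 6) * g2 t := by
    intro t ht
    have h0 : t ≠ 0 := by rintro rfl; simp at ht
    have hm : M (-1 / t) = t ^ k * M t := by
      have h2 : (⇑m ∣[k] ModularGroup.S) = m := SlashInvariantFormClass.slash_action_eq m _ ⟨ModularGroup.S, rfl⟩
      have h1 := congr_fun h2 ⟨t, ht⟩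
      rw [SL_slash_apply, UpperHalfPlane.modular_S_smul, ModularGroup.denom_S, _root_.zpow_neg, mul_inv_eq_iff_eq_mul₀ (zpow_ne_zero _ (by exact h0)), mul_comm] at h1
      rw [show (-1 / t) = ((UpperHalfPlane.mk (-((⟨t, ht⟩ : ℍ) : ℂ))⁻¹ (UpperHalfPlane.im_inv_neg_coe_pos ⟨t, ht⟩) : ℍ) : ℂ) by
        show -1 / t = (-t)⁻¹
        rw [← neg_inv, neg_div, one_div], hMz, h1]
      exact congrArg _ (hMz ⟨t, ht⟩).symm
    simp only [hg2, e12_S ht, hm]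
    rw [_root_.zpow_add₀ h0]
    norm_cast
    ring
  have cneg : ∀ N : ℤ, Odd N → N < 1 → co 1 g2 N = 0 := by
    obtain ⟨A, C, hb⟩ := isBoundedAtImInfty_iff.1 nm.b
    obtain ⟨A', hb'⟩ := ue_bd
    intro N hN hl
    refine ap2.co_van (N0 := 1) (A := max (max C A') 1) (C := 2 * A) (fun t ht => ?_) hN hl
    have ht0 : 0 < t.im := by linarith [le_max_right (max C A') 1]
    have h1 := hb ⟨t, ht0⟩ (le_trans (le_max_left _ _) (le_trans (le_max_left _ _) ht))
    rw [← hMz] at h1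
    have h2 := (hb' t (le_trans (le_max_right _ _) (le_trans (le_max_left _ _) ht))).2
    simp only [hg2]
    rw [e12_ue, norm_mul, norm_mul, mul_right_comm]
    exact mul_le_mul_of_nonneg_right (mul_le_mul h2 h1 (norm_nonneg _) (by norm_num)) (norm_nonneg _)
  have cpos : ∀ n : ℕ, co 1 g2 (2 * n + 1) = (qExpansion 1 UE * qExpansion 1 m).coeff n := by
    intro n
    rw [← UE_nice.qmul nm, (UE_nice.mul nm).int, co]
    refine integral_congr fun x _ => ?_
    simp only [Pi.mul_apply, ← hMz, UE, hg2]
    rw [e12_ue]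
    have : qq (-(2 * n)) (x ⊹) = qq (-(2 * n + 1)) (x ⊹) * qq 1 (x ⊹) := by
      rw [← qq_idx]; congr 1; ring
    rw [this]; ring
  have c1 := cpos 0
  have c3 := cpos 1
  have c5 := cpos 2
  rw [cf0, hm0] at c1
  rw [cf1, hm0, hm1, u1] at c3
  rw [cf2, hm0, hm1, hm2, u1, u2] at c5
  rw [show (2 * ((0:ℕ):ℤ) + 1) = 1 by norm_num] at c1
  rw [show (2 * ((1:ℕ):ℤ) + 1) = 3 by norm_num] at c3
  rw [show (2 * ((2:ℕ):ℤ) + 1) = 5 by norm_num] at c5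
  set u := (qExpansion 1 UE).coeff 0
  have z := (h.comb ap2 (co 1 g 1 / u)).van (w := k + 6) (N0 := 3) (fun t ht => by simp only [hS t ht, gS t ht]; ring) (by decide) ?_ (by omega)
  · have e : ∀ N, co 1 g N = co 1 g 1 / u * co 1 g2 N := by
      intro N
      have : co 1 (fun t => g t - co 1 g 1 / u * g2 t) N = 0 := by
        rw [co]
        refine (integral_congr fun x _ => ?_).trans integral_zero
        rw [z _ (by simp), zero_mul]
      rw [h.comb_co ap2] at this
      linear_combination this
    constructor
    · rw [e 3, c3]; field_simp; ring
    · rw [e 5, c5]; field_simp; ring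
  · intro N hN hl
    rw [h.comb_co ap2]
    obtain h1 | rfl : N < 1 ∨ N = 1 := by
      obtain ⟨a, rfl⟩ := hN
      push_cast at hl; omega
    · rw [hc N hN h1, cneg N hN h1]; ring
    · rw [c1]; field_simp; ring

def HasM (k : ℤ) (m1 m2 : ℂ) : Prop := ∃ m : ModularForm 𝒮ℒ k, (qExpansion 1 m).coeff 0 = 1 ∧ (qExpansion 1 m).coeff 1 = m1 ∧ (qExpansion 1 m).coeff 2 = m2
lemma HasM.mul {k k' : ℤ} {a b c d : ℂ} (h : HasM k a b) (h2 : HasM k' c d) : HasM (k + k') (c + a) (d + a * c + b) := by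
  obtain ⟨m, a0, a1, a2⟩ := h
  obtain ⟨n, b0, b1, b2⟩ := h2
  refine ⟨m.mul n, ?_, ?_, ?_⟩ <;> rw [ModularForm.coe_mul, (Nice.of_mf m).qmul (Nice.of_mf n)]
  · rw [cf0, a0, b0]; ring
  · rw [cf1, a0, b0, a1, b1]; ring
  · rw [cf2, a0, b0, a1, b1, a2, b2]; ring
lemma hm4 : HasM 4 240 2160 := ⟨E₄, E4c.1, E4c.2.1, E4c.2.2.1⟩
lemma hm6 : HasM 6 (-504) (-16632) := ⟨E₆, E6c.1, E6c.2.1, E6c.2.2.1⟩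
lemma hm8 : HasM 8 480 61920 := by have := hm4.mul hm4; norm_num at this; exact this
lemma hm10 : HasM 10 (-264) (-135432) := by have := hm4.mul hm6; norm_num at this; exact this
lemma hm14 : HasM 14 (-24) (-196632) := by have := hm4.mul hm10; norm_num at this; exact this
end
end

section
section
variable {j : ℕ} {M : ℤ} {φ : ℂ → ℂ → Vc j} {f : ℂ → ℂ → ℂ → Vc j}

def SB (f : ℂ → ℂ → ℂ → Vc j) (M N : ℤ) (B ν i : ℕ) : ℂ := ∑ R ∈ oddR B, (R : ℂ) ^ ν * cmpo (AC f N R M) i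

lemma mem_oddR {B : ℕ} {R : ℤ} (h : R ∈ oddR B) : Odd R := (Finset.mem_filter.1 h).2

lemma Form.co0 (h : Form j f) (hM : Odd M) {N : ℤ} (hN : Odd N) (hc : ∀ R : ℤ, Odd R → AC f N R M = 0) (ν i : ℕ) :
    co 1 (ch (phi f M) ν i) N = 0 := by
  have hb : 4 * N * M ≤ ((((4 * N * M).natAbs : ℕ) : ℤ) + 1) ^ 2 := by
    have := Int.le_natAbs (a := 4 * N * M)
    nlinarith
  rw [h.ch_co hN hM (4 * N * M).natAbs hb, sum_eq_zero, mul_zero]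
  intro R hR
  rw [hc R (mem_oddR hR)]
  simp [cmpo]

lemma Form.van (h : Form j f) (hM : Odd M) {N0 : ℕ} (hN0 : Odd N0) (hc : ∀ N R : ℤ, Odd N → Odd R → N < N0 → AC f N R M = 0) :
    ∀ n : ℕ, ∀ ν i : ℕ, (ν:ℤ) - i + j ≤ n → (ν:ℤ) - i + j + 2 < 6 * N0 → ∀ t : ℂ, 0 < t.im → ch (phi f M) ν i t = 0 := by
  have hJ := h.jac hM
  intro n
  induction n using Nat.strong_induction_on with
  | _ n ih =>
  intro ν i h1 h2
  by_cases hi : j < i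
  · intro t _; exact ch_big _ hi t
  push Not at hi
  have lo : ∀ μ l : ℕ, (μ:ℤ) - l + 1 ≤ ν - i → ∀ t : ℂ, 0 < t.im → ch (phi f M) μ l t = 0 := by
    intro μ l hl t ht
    by_cases hlj : j < l
    · exact ch_big _ hlj t
    exact ih (n - 1) (by omega) μ l (by omega) (by omega) t ht
  intro t ht
  refine (hJ.chAP ν i).van (w := ((2 + j - i + ν : ℕ) : ℤ)) (fun t ht => ?_) hN0 (fun N hN hl => ?_) (by omega) t ht
  · rw [hJ.chS ht hi (fun μ l hl => lo μ l (by omega) t ht)]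
    have : G0 M (phi f M) ν i t = 0 := by
      rw [G0]
      split_ifs
      · rw [lo _ _ (by omega) t ht, lo _ _ (by omega) t ht]; ring
      · rw [lo _ _ (by omega) t ht]; ring
      · omega
      · ring
    rw [this, mul_zero, add_zero, zpow_natCast]
  · exact h.co0 hM hN (fun R hR => hc N R hN hR hl) ν i

lemma pi_ne (ν : ℕ) : ((Real.pi : ℂ) * I) ^ ν * ((ν.factorial : ℂ))⁻¹ ≠ 0 := by
  exact mul_ne_zero (pow_ne_zero _ (mul_ne_zero (by exact_mod_cast pi_ne_zero) I_ne_zero)) (inv_ne_zero (by exact_mod_cast ν.factorial_ne_zero))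

lemma Form.V0 (h : Form j f) (hM : Odd M) {N0 : ℕ} (hN0 : Odd N0) (hc : ∀ N R : ℤ, Odd N → Odd R → N < N0 → AC f N R M = 0)
    {N : ℤ} (hN : Odd N) (B : ℕ) (hB : 4 * N * M ≤ (B + 1) ^ 2) (ν i : ℕ) (hw : (ν:ℤ) - i + j + 2 < 6 * N0) : SB f M N B ν i = 0 := by
  have z : co 1 (ch (phi f M) ν i) N = 0 := by
    rw [co]
    refine (integral_congr fun x _ => ?_).trans integral_zero
    rw [h.van hM hN0 hc ((ν:ℤ) - i + j).toNat ν i (by omega) hw _ (by simp), zero_mul]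
  rw [h.ch_co hN hM B hB] at z
  exact (mul_eq_zero.1 z).resolve_left (pi_ne ν)

lemma Form.hc1 (h : Form j f) (hM : Odd M) : ∀ N R : ℤ, Odd N → Odd R → N < (1:ℕ) → AC f N R M = 0 := by
  intro N R hN hR hl
  refine h.koe hN hR hM (Or.inr (Or.inl ?_))
  obtain ⟨a, rfl⟩ := hN
  omega

lemma Jac.ch0S (h : Jac j M φ) {t : ℂ} (ht : 0 < t.im) {i : ℕ} (hi : i ≤ j) : ch φ 0 i (-1 / t) = - t ^ (2 + j - i) * ch φ 0 i t := by
  have e : ∀ t, ch φ 0 i t = cmpo (φ t 0) i := fun t => by simp [ch, TT]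
  rw [e, e, h.cS ht 0 hi, Finset.sum_eq_single 0]
  · simp [qq]
  · intro s _ hs; simp [hs]
  · simp

lemma Form.V1 (h : Form j f) {k i : ℕ} {m1 m2 : ℂ} (hm : HasM k m1 m2) (hk : k < 12 ∨ k = 14) (hij : i + k + 4 = j) {B B' : ℕ} (hB : 12 ≤ (B + 1) ^ 2) (hB' : 20 ≤ (B' + 1) ^ 2) :
    SB f 1 3 B 0 i = (m1 - 12) * SB f 1 1 1 0 i ∧ SB f 1 5 B' 0 i = (m2 - 12 * m1 + 54) * SB f 1 1 1 0 i := by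
  have hJ := h.jac (M := 1) (by decide)
  obtain ⟨m, a0, a1, a2⟩ := hm
  have := (hJ.chAP 0 i).v1 (k := k) (fun t ht => ?_) (fun N hN hl => h.co0 (by decide) hN (fun R hR => h.hc1 (by decide) N R hN hR hl) 0 i) (by omega) m a0 a1 a2
  · rw [h.ch_co (N := 3) (by decide) (by decide) B (by norm_num; exact_mod_cast hB), h.ch_co (N := 5) (by decide) (by decide) B' (by norm_num; exact_mod_cast hB'), h.ch_co (N := 1) (by decide) (by decide) 1 (by norm_num)] at this
    simpa [SB] using this
  · rw [hJ.ch0S ht (by omega), show 2 + j - i = k + 6 by omega]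
    norm_cast

lemma co_deriv {g : ℂ → ℂ} (h : AP 0 g) (N : ℤ) (hN : Odd N) : co 1 (deriv g) N = Real.pi * I * N * co 1 g N := by
  have hd : ∀ x : ℝ, HasDerivAt (fun x : ℝ => g (x ⊹) * qq (-N) (x ⊹))
      (deriv g (x ⊹) * qq (-N) (x ⊹) - Real.pi * I * N * (g (x ⊹) * qq (-N) (x ⊹))) x := by
    intro x
    have h1 : HasDerivAt (fun w : ℂ => g w * qq (-N) w) (deriv g (x ⊹) * qq (-N) (x ⊹) + g (x ⊹) * (qq (-N) (x ⊹) * (Real.pi * I * (-N : ℤ)))) (x ⊹) := by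
      refine (h.d _ (by simp)).hasDerivAt.mul ?_
      have := ((hasDerivAt_id ((x:ℂ) ⊹)).const_mul ((Real.pi : ℂ) * I * (-N : ℤ))).cexp
      simp only [id, mul_one] at this
      exact this
    have h2 : HasDerivAt (fun x : ℝ => ((x:ℂ) ⊹)) 1 x := (Complex.ofRealCLM.hasDerivAt (x := x)).add_const _
    have := h1.comp x h2
    refine this.congr_deriv ?_
    push_cast; ring
  have hcont : Continuous fun x : ℝ => deriv g (x ⊹) * qq (-N) (x ⊹) := by
    refine Continuous.mul ?_ (by fun_prop)
    rw [continuous_iff_continuousAt]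
    intro x
    have ho : IsOpen {w : ℂ | 0 < w.im} := isOpen_lt (by fun_prop) (by fun_prop)
    have hA : AnalyticAt ℂ g (x ⊹) := (DifferentiableOn.analyticAt (s := {w : ℂ | 0 < w.im}) (fun w hw => (h.d w hw).differentiableWithinAt) (ho.mem_nhds (by simp)))
    exact hA.deriv.continuousAt.comp (f := fun x : ℝ => (x ⊹ : ℂ)) (by fun_prop)
  have hI := intervalIntegral.integral_eq_sub_of_hasDerivAt (a := 0) (b := 1) (fun x _ => hd x) ((hcont.sub ((h.co_cts N).const_mul _)).intervalIntegrable _ _)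
  rw [intervalIntegral.integral_sub (hcont.intervalIntegrable _ _) (((h.co_cts N).const_mul _).intervalIntegrable _ _), integral_const_mul] at hI
  have e : g ((1:ℝ) ⊹) * qq (-N) ((1:ℝ) ⊹) = g ((0:ℝ) ⊹) * qq (-N) ((0:ℝ) ⊹) := by
    have h1 := h.p ((1:ℝ) * I) (by simp)
    have h2 := qq_odd hN.neg
    rw [show (((1:ℝ):ℂ) ⊹) = (1:ℝ) * I + 1 by push_cast; ring, h1, qq_add, h2]
    simp
  rw [e, sub_self] at hI
  rw [co, co]
  linear_combination hI

lemma co_lin {g1 g2 : ℂ → ℂ} (h1 : AP 0 g1) (h2 : AP 0 g2) (a b : ℂ) : AP 0 (fun t => a * g1 t + b * g2 t) ∧ ∀ N, co 1 (fun t => a * g1 t + b * g2 t) N = a * co 1 g1 N + b * co 1 g2 N := by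
  refine ⟨⟨fun w hw => ((h1.d w hw).const_mul a).add ((h2.d w hw).const_mul b), fun w hw => by simp only [h1.p w hw, h2.p w hw]; ring⟩, fun N => ?_⟩
  rw [co, co, co, ← integral_const_mul, ← integral_const_mul, ← intervalIntegral.integral_add]
  · refine integral_congr fun x _ => ?_
    ring
  · exact ((h1.co_cts N).const_mul a).intervalIntegrable _ _
  · exact ((h2.co_cts N).const_mul b).intervalIntegrable _ _

lemma AP.deriv {g : ℂ → ℂ} (h : AP 0 g) : AP 0 (deriv g) := by
  have ho : IsOpen {w : ℂ | 0 < w.im} := isOpen_lt (by fun_prop) (by fun_prop)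
  refine ⟨fun w hw => ?_, fun w hw => ?_⟩
  · exact (DifferentiableOn.analyticAt (s := {w : ℂ | 0 < w.im}) (fun w hw => (h.d w hw).differentiableWithinAt) (ho.mem_nhds hw)).deriv.differentiableAt
  · rw [← deriv_comp_add_const, ← deriv.fun_neg]
    refine Filter.EventuallyEq.deriv_eq ?_
    filter_upwards [ho.mem_nhds hw] with x hx
    exact h.p x hx

lemma deriv_S {g : ℂ → ℂ} (h : AP 0 g) {w : ℕ} (hS : ∀ t : ℂ, 0 < t.im → g (-1 / t) = - t ^ w * g t) (t : ℂ) (ht : 0 < t.im) :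
    t * _root_.deriv g (-1 / t) = - t ^ (w + 3) * _root_.deriv g t - w * t ^ (w + 2) * g t := by
  have ho : IsOpen {w : ℂ | 0 < w.im} := isOpen_lt (by fun_prop) (by fun_prop)
  have h0 : t ≠ 0 := by rintro rfl; simp at ht
  have hp : 0 < (-1 / t).im := by
    rw [div_im]; simp only [neg_im, one_im, neg_re, one_re]
    have : 0 < normSq t := normSq_pos.2 h0
    field_simp; linarith
  have e1 : HasDerivAt (fun t => g (-1 / t)) (_root_.deriv g (-1 / t) * (t ^ 2)⁻¹) t := by
    have a := (h.d _ hp).hasDerivAt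
    have b : HasDerivAt (fun t : ℂ => -1 / t) ((t ^ 2)⁻¹) t := by
      have := (hasDerivAt_inv h0).neg
      simpa [neg_div, one_div, Pi.neg_def] using this
    exact a.comp t b
  have e2 : HasDerivAt (fun t => - t ^ w * g t) (-(w * t ^ (w - 1)) * g t + - t ^ w * _root_.deriv g t) t := (hasDerivAt_pow w t).neg.mul (h.d t ht).hasDerivAt
  have e3 : (fun t => g (-1 / t)) =ᶠ[𝓝 t] (fun t => - t ^ w * g t) := by
    filter_upwards [ho.mem_nhds ht] with x hx using hS x hx
  have e4 := e1.unique (e2.congr_of_eventuallyEq e3)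
  have e5 : _root_.deriv g (-1 / t) = t ^ 2 * (-(w * t ^ (w - 1)) * g t + - t ^ w * _root_.deriv g t) := by
    rw [← e4]; field_simp
  rw [e5]
  cases w with
  | zero => simp; ring
  | succ w => simp only [Nat.add_sub_cancel]; push_cast; ring

lemma Form.V2 (h : Form j f) (hM : Odd M) {N : ℤ} (hN : Odd N) (B : ℕ) (hB : 4 * N * M ≤ (B + 1) ^ 2) (ν i : ℕ) (hw : (ν:ℤ) - i + j = 6) (hi : i ≤ j) :
    6 * SB f M N B ν i = N * ((i + 1) * ν * (if 1 ≤ ν then SB f M N B (ν - 1) (i + 1) else 0) + M * (ν * (ν - 1)) * (if 2 ≤ ν then SB f M N B (ν - 2) i else 0)) := by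
  have hJ := h.jac hM
  have V := h.van hM (N0 := 1) (by decide) (h.hc1 hM)
  have lo : ∀ μ l : ℕ, (μ:ℤ) - l + 3 ≤ ν - i → ∀ t : ℂ, 0 < t.im → ch (phi f M) μ l t = 0 := fun μ l hl t ht => V ((μ:ℤ) - l + j).toNat μ l (by omega) (by omega) t ht
  have six : ∀ μ l : ℕ, (μ:ℤ) - l + j = 4 → l ≤ j → ∀ t : ℂ, 0 < t.im → ch (phi f M) μ l (-1 / t) = - t ^ 6 * ch (phi f M) μ l t := by
    intro μ l hl hlj t ht
    rw [hJ.chS ht hlj (fun μ l hl => lo μ l (by omega) t ht)]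
    have : G0 M (phi f M) μ l t = 0 := by
      rw [G0]
      split_ifs
      · rw [lo _ _ (by omega) t ht, lo _ _ (by omega) t ht]; ring
      · rw [lo _ _ (by omega) t ht]; ring
      · omega
      · ring
    rw [this, mul_zero, add_zero, show 2 + j - l + μ = 6 by omega]
  set g1 : ℂ → ℂ := fun t => if 1 ≤ ν then ch (phi f M) (ν - 1) (i + 1) t else 0 with hg1
  set g2 : ℂ → ℂ := fun t => if 2 ≤ ν then ch (phi f M) (ν - 2) i t else 0 with hg2
  have a0 : AP 0 (fun _ => (0:ℂ)) := ⟨fun w _ => differentiableAt_const _, fun w _ => by simp⟩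
  have co0 : ∀ N, co 1 (fun _ => (0:ℂ)) N = 0 := fun N => by simp [co]
  have a1 : AP 0 g1 := by
    rw [hg1]; split_ifs
    · exact hJ.chAP _ _
    · exact a0
  have a2 : AP 0 g2 := by
    rw [hg2]; split_ifs
    · exact hJ.chAP _ _
    · exact a0
  have s1 : ∀ t : ℂ, 0 < t.im → g1 (-1 / t) = - t ^ 6 * g1 t := by
    intro t ht
    simp only [hg1]; split_ifs with hv
    · by_cases hij : i + 1 ≤ j
      · exact six _ _ (by omega) hij t ht
      · rw [ch_big _ (by omega), ch_big _ (by omega), mul_zero]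
    · simp
  have s2 : ∀ t : ℂ, 0 < t.im → g2 (-1 / t) = - t ^ 6 * g2 t := by
    intro t ht
    simp only [hg2]; split_ifs with hv
    · exact six _ _ (by omega) hi t ht
    · simp
  obtain ⟨aG, cG⟩ := co_lin a1 a2 (i + 1) (Real.pi * I * M)
  set G : ℂ → ℂ := fun t => (i + 1) * g1 t + Real.pi * I * M * g2 t with hG
  have sG : ∀ t : ℂ, 0 < t.im → G (-1 / t) = - t ^ 6 * G t := by
    intro t ht
    simp only [hG, s1 t ht, s2 t ht]; ring
  have eG : ∀ t, G0 M (phi f M) ν i t = G t := fun t => rfl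
  have ac := hJ.chAP ν i
  have hD := ac.comb aG.deriv (1 / 6)
  have hz := hD.van (w := 8) (N0 := 1) (fun t ht => ?_) (by decide) (fun N hN hl => ?_) (by norm_num)
  · have hc : co 1 (ch (phi f M) ν i) N = 1 / 6 * (Real.pi * I * N * co 1 G N) := by
      rw [← co_deriv aG N hN]
      have : co 1 (fun t => ch (phi f M) ν i t - 1 / 6 * _root_.deriv G t) N = 0 := by
        rw [co]
        refine (integral_congr fun x _ => ?_).trans integral_zero
        rw [hz _ (by simp), zero_mul]
      rw [ac.comb_co aG.deriv] at this
      linear_combination this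
    rw [cG, h.ch_co hN hM B hB] at hc
    have c1 : co 1 g1 N = if 1 ≤ ν then (Real.pi * I) ^ (ν - 1) * ((ν - 1).factorial : ℂ)⁻¹ * SB f M N B (ν - 1) (i + 1) else 0 := by
      simp only [hg1]; split_ifs
      · rw [h.ch_co hN hM B hB]; rfl
      · exact co0 N
    have c2 : co 1 g2 N = if 2 ≤ ν then (Real.pi * I) ^ (ν - 2) * ((ν - 2).factorial : ℂ)⁻¹ * SB f M N B (ν - 2) i else 0 := by
      simp only [hg2]; split_ifs
      · rw [h.ch_co hN hM B hB]; rfl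
      · exact co0 N
    rw [c1, c2] at hc
    change _ * SB f M N B ν i = _ at hc
    refine mul_left_cancel₀ (pi_ne ν) ?_
    rw [mul_left_comm, hc]
    obtain _ | _ | n := ν
    · simp
    · simp; ring
    · have q1 : ((n + 1).factorial : ℂ) = (n + 1) * n.factorial := by push_cast [Nat.factorial_succ]; ring
      have q2 : ((n + 1 + 1).factorial : ℂ) = (n + 2) * ((n + 1) * n.factorial) := by push_cast [Nat.factorial_succ]; ring
      have q3 : (n.factorial : ℂ) ≠ 0 := by exact_mod_cast n.factorial_ne_zero
      have q4 : (n : ℂ) + 1 ≠ 0 := by exact_mod_cast n.succ_ne_zero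
      have q5 : (n : ℂ) + 2 ≠ 0 := by exact_mod_cast (n + 1).succ_ne_zero
      rw [if_pos (by omega), if_pos (by omega), if_pos (by omega), if_pos (by omega)]
      simp only [show n + 1 + 1 - 1 = n + 1 by omega, show n + 1 + 1 - 2 = n by omega, q1, q2]
      push_cast
      field_simp
      ring
  · have h0 : t ≠ 0 := by rintro rfl; simp at ht
    have d := deriv_S aG sG t ht
    rw [hJ.chS ht hi (fun μ l hl => lo μ l (by omega) t ht), eG, show 2 + j - i + ν = 8 by omega]
    refine mul_left_cancel₀ h0 ?_
    have : t * t⁻¹ = 1 := mul_inv_cancel₀ h0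
    have e8 : t ^ (8:ℤ) = t ^ 8 := by norm_cast
    rw [e8]
    push_cast at d
    linear_combination (-t ^ 8 * G t) * this - 1 / 6 * d
  · rw [ac.comb_co aG.deriv, co_deriv aG N hN, cG, h.co0 hM hN (fun R hR => h.hc1 hM N R hN hR hl)]
    have c1 : co 1 g1 N = 0 := by
      simp only [hg1]; split_ifs
      · exact h.co0 hM hN (fun R hR => h.hc1 hM N R hN hR hl) _ _
      · exact co0 N
    have c2 : co 1 g2 N = 0 := by
      simp only [hg2]; split_ifs
      · exact h.co0 hM hN (fun R hR => h.hc1 hM N R hN hR hl) _ _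
      · exact co0 N
    rw [c1, c2]; ring
end
end

section
def cI (l i : ℕ) : ℤ := if i ≤ l then ((l.factorial / (i.factorial * (l - i).factorial) : ℕ) : ℤ) else 0
def Dz (h b : ℕ) (R : ℤ) (i c : ℕ) : ℤ :=
  if (if R.natAbs = 1 then c / h = b else c / h + 1 = b) then (if R = 1 ∨ R = -3 then 1 else -1) * (cI (2 * (c % h) + 1) i * 2 ^ i * R ^ (2 * (c % h) + 1 - i)) else 0
def Ez (h b ν i c : ℕ) : ℤ := Dz h b 1 i c + (-1) ^ ν * Dz h b (-1) i c + 3 ^ ν * Dz h b 3 i c + (-3) ^ ν * Dz h b (-3) i c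
def rws (h : ℕ) (sw : ℕ) (us : ℕ) (nk : ℕ) : List (ℕ → ℤ) :=
  (List.range sw).map (fun i c => Dz h 0 1 i c + Dz h 0 1 (2 * h - i) c) ++
  [(0, 6), (0, 2), (1, 6), (1, 2), (2, 6), (2, 2)].map (fun (q : ℕ × ℕ) c => Ez h q.1 0 (2 * h - q.2) c) ++
  [1, 2].map (fun b c => 6 * Ez h b 1 (2 * h - 5) c - (2 * b + 1) * (2 * h - 4) * Ez h b 0 (2 * h - 4) c) ++
  [(1, 0, 0), (1, 0, 2), (1, 0, 6), (1, 1, 1), (2, 0, 0), (2, 0, 2), (2, 0, 6), (2, 1, 1), (2, 2, 0)].map (fun (q : ℕ × ℕ × ℕ) c => Ez h q.1 q.2.1 q.2.2 c) ++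
  [(1, 1, 5), (1, 2, 4), (2, 1, 5), (2, 2, 4), (2, 3, 3), (2, 4, 2)].map (fun (q : ℕ × ℕ × ℕ) c => 6 * Ez h q.1 q.2.1 q.2.2 c - (2 * h - q.2.2 + 1) * q.2.1 * Ez h q.1 (q.2.1 - 1) (q.2.2 - 1) c - (2 * q.1 + 1) * (q.2.1 * (q.2.1 - 1)) * Ez h q.1 (q.2.1 - 2) q.2.2 c) ++
  (([(1, 4, 228), (2, 4, -666), (1, 6, -516), (2, 6, -10530), (1, 8, 468), (2, 8, 56214), (1, 10, -276), (2, 10, -132210), (1, 14, -36), (2, 14, -196290)] : List (ℕ × ℕ × ℤ)).take nk).map (fun q c => Ez h q.1 0 (2 * h - 4 - q.2.1) c - q.2.2 * Ez h 0 0 (2 * h - 4 - q.2.1) c) ++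
  (List.range us).map (fun s c => if c = s then 1 else 0)

def WW : ℕ := 2 ^ 720
def pkf : ℕ → (ℕ → ℕ) → ℕ
  | 0, _ => 0
  | n + 1, v => pkf n v + v n * WW ^ n
def md (v : ℕ → ℤ) (c : ℕ) : ℕ := (v c % 101).toNat
def frc {α : Type} (n : ℕ) (k : ℕ → α) : α := match n with
  | 0 => k 0
  | m + 1 => k (m + 1)
def smap {α : Type} (g : α → ℕ) : List α → (List ℕ → Bool) → Bool
  | [], k => k []
  | a :: l, k => frc (g a) fun x => smap g l fun y => k (x :: y)
def aug (n : ℕ) : ℕ → List ℕ → List ℕ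
  | _, [] => []
  | i, x :: l => (x + WW ^ (n + i)) :: aug n (i + 1) l
def fpv : List ℕ → List ℕ → ℕ × List ℕ
  | [], acc => (0, acc)
  | r :: l, acc => if r % WW % 101 = 0 then fpv l (r :: acc) else (r, acc ++ l)
def elm (q r : ℕ) : ℕ := r / WW + (101 - r % WW % 101) * q
def gs : ℕ → List ℕ → List ℕ → (List ℕ → Bool) → Bool
  | 0, d, _, k => k d
  | n + 1, d, t, k =>
    frc (fpv t []).1 fun pv =>
    frc (pv / WW * ((pv % WW % 101) ^ 99 % 101)) fun q =>
    smap (elm q) d fun d' => smap (elm q) (fpv t []).2 fun t' => gs n (d' ++ [q]) t' k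
def unp : ℕ → ℕ → List ℕ
  | 0, _ => []
  | n + 1, x => x % WW :: unp n (x / WW)
def ckc (r : ℕ) : ℕ → ℕ → Bool
  | 0, _ => true
  | n + 1, x => x / WW ^ n % WW % 101 == (if n = r then 1 else 0) && ckc r n x
def ckr (n r : ℕ) (P : List ℕ) (b : List ℕ) : Bool :=
  frc (b.zipWith (· * ·) P).sum fun x => ckc r n x && decide (b.sum * 101 < WW)
def cks (n : ℕ) (P : List ℕ) : ℕ → List ℕ → Bool
  | r, [] => r == n
  | r, x :: l => ckr n r P (unp n x) && cks n P (r + 1) l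
def chk (n : ℕ) (R : List (ℕ → ℤ)) : Bool := smap (fun v => pkf n (md v)) R fun P => gs n [] (aug n 0 P) fun B => cks n P 0 B

lemma frc_eq {α : Type} (n : ℕ) (k : ℕ → α) : frc n k = k n := by cases n <;> rfl
lemma smap_eq {α : Type} (g : α → ℕ) (l : List α) (k : List ℕ → Bool) : smap g l k = k (l.map g) := by
  induction l generalizing k with
  | nil => rfl
  | cons a l ih => rw [smap, frc_eq, ih]; rfl
lemma gs_ex (n : ℕ) (d t : List ℕ) (k : List ℕ → Bool) (h : gs n d t k = true) : ∃ B, k B = true := by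
  induction n generalizing d t with
  | zero => exact ⟨d, h⟩
  | succ n ih =>
    rw [gs, frc_eq, frc_eq, smap_eq, smap_eq] at h
    exact ih _ _ h
lemma cks_ex (n : ℕ) (P : List ℕ) (L : List ℕ) (r : ℕ) (h : cks n P r L = true) (s : ℕ) (h1 : r ≤ s) (h2 : s < n) : ∃ b, ckr n s P b = true := by
  induction L generalizing r with
  | nil => simp [cks] at h; omega
  | cons x L ih =>
    rw [cks, Bool.and_eq_true] at h
    obtain rfl | h3 := h1.eq_or_lt
    · exact ⟨_, h.1⟩
    · exact ih _ h.2 (by omega)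
lemma ckc_ex (r n x : ℕ) (h : ckc r n x = true) (c : ℕ) (hc : c < n) : x / WW ^ c % WW % 101 = if c = r then 1 else 0 := by
  induction n with
  | zero => omega
  | succ n ih =>
    rw [ckc, Bool.and_eq_true, beq_iff_eq] at h
    obtain rfl | h3 := (Nat.lt_succ_iff.1 hc).eq_or_lt
    · exact h.1
    · exact ih h.2 h3
lemma WW_pos : 0 < WW := by rw [WW]; positivity
lemma pkf_lt (n : ℕ) (v : ℕ → ℕ) (h : ∀ c < n, v c < WW) : pkf n v < WW ^ n := by
  induction n with
  | zero => simp [pkf]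
  | succ n ih =>
    rw [pkf, pow_succ]
    have h1 := ih fun c hc => h c (by omega)
    have h2 := Nat.mul_le_mul_right (WW ^ n) (h n (by omega))
    rw [Nat.succ_mul] at h2
    rw [mul_comm (WW ^ n)]; omega
lemma pkf_dig (n : ℕ) (v : ℕ → ℕ) (h : ∀ c < n, v c < WW) (c : ℕ) (hc : c < n) : pkf n v / WW ^ c % WW = v c := by
  induction n with
  | zero => omega
  | succ n ih =>
    have h0 : ∀ c < n, v c < WW := fun c hc => h c (by omega)
    have hp : 0 < WW ^ c := Nat.pow_pos WW_pos
    obtain rfl | h3 := (Nat.lt_succ_iff.1 hc).eq_or_lt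
    · rw [pkf, Nat.add_mul_div_right _ _ hp, Nat.div_eq_of_lt (pkf_lt c v h0), zero_add, Nat.mod_eq_of_lt (h c hc)]
    · have e : pkf (n + 1) v = pkf n v + WW ^ c * (WW * (v n * WW ^ (n - c - 1))) := by
        rw [pkf, show n = c + 1 + (n - c - 1) by omega, pow_add, pow_succ, show c + 1 + (n - c - 1) - c - 1 = n - c - 1 by omega]; ring
      rw [e, Nat.add_mul_div_left _ _ hp, Nat.add_mul_mod_self_left, ih h0 h3]
lemma pkf_add (n : ℕ) (v w : ℕ → ℕ) (b : ℕ) : b * pkf n v + pkf n w = pkf n (fun c => b * v c + w c) := by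
  induction n with
  | zero => simp [pkf]
  | succ n ih => simp only [pkf, ← ih]; ring
lemma pkf_zip (n : ℕ) (b : List ℕ) (R : List (ℕ → ℤ)) :
    (b.zipWith (· * ·) (R.map fun v => pkf n (md v))).sum = pkf n (fun c => (b.zipWith (fun b v => b * md v c) R).sum) := by
  have z : ∀ n, 0 = pkf n (fun _ => 0) := fun n => by induction n with | zero => rfl | succ n ih => simp [pkf, ← ih]
  induction b generalizing R with
  | nil => simpa using z n
  | cons a b ih =>
    cases R with
    | nil => simpa using z n
    | cons v R => simp only [List.map_cons, List.zipWith_cons_cons, List.sum_cons, ih, pkf_add]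
lemma md_lt (v : ℕ → ℤ) (c) : md v c < 101 := by rw [md]; omega
lemma zip_le (b : List ℕ) (R : List (ℕ → ℤ)) (c : ℕ) : (b.zipWith (fun b v => b * md v c) R).sum ≤ b.sum * 101 := by
  induction b generalizing R with
  | nil => simp
  | cons a b ih =>
    cases R with
    | nil => simp
    | cons v R =>
      simp only [List.zipWith_cons_cons, List.sum_cons]
      have := ih R
      have := Nat.mul_le_mul_left a (md_lt v c).le
      rw [add_mul]; omega
lemma zip_cast (b : List ℕ) (R : List (ℕ → ℤ)) (c : ℕ) :
    (((b.zipWith (fun (b : ℕ) (v : ℕ → ℤ) => (b : ℤ) * v c) R).sum : ℤ) : ZMod 101) = (((b.zipWith (fun b v => b * md v c) R).sum : ℕ) : ZMod 101) := by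
  induction b generalizing R with
  | nil => simp
  | cons a b ih =>
    cases R with
    | nil => simp
    | cons v R =>
      simp only [List.zipWith_cons_cons, List.sum_cons]
      rw [Int.cast_add, Int.cast_mul, Nat.cast_add, Nat.cast_mul, Int.cast_natCast, ih R]
      congr 2
      have : ((md v c : ℕ) : ℤ) = v c % 101 := by rw [md]; omega
      have h2 : ((md v c : ℕ) : ZMod 101) = (((md v c : ℕ) : ℤ) : ZMod 101) := by push_cast; rfl
      rw [h2, this]
      exact (ZMod.intCast_mod (v c) 101).symm
lemma zip_x (n : ℕ) (b : List ℕ) (R : List (ℕ → ℤ)) (x : ℕ → ℂ) (hx : ∀ v ∈ R, ∑ c ∈ Finset.range n, (v c : ℂ) * x c = 0) :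
    ∑ c ∈ Finset.range n, (((b.zipWith (fun (b : ℕ) (v : ℕ → ℤ) => (b : ℤ) * v c) R).sum : ℤ) : ℂ) * x c = 0 := by
  induction b generalizing R with
  | nil => simp
  | cons a b ih =>
    cases R with
    | nil => simp
    | cons v R =>
      simp only [List.zipWith_cons_cons, List.sum_cons]
      have h1 := ih R fun v hv => hx v (List.mem_cons_of_mem _ hv)
      have h2 := hx v List.mem_cons_self
      push_cast at h1 ⊢
      simp only [add_mul, sum_add_distrib, h1, mul_assoc, ← Finset.mul_sum, h2]
      simp

lemma chk_zero {n : ℕ} {R : List (ℕ → ℤ)} (h : chk n R = true) (x : ℕ → ℂ) (hx : ∀ v ∈ R, ∑ c ∈ Finset.range n, (v c : ℂ) * x c = 0) : ∀ c < n, x c = 0 := by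
  rw [chk, smap_eq] at h
  obtain ⟨B, hB⟩ := gs_ex _ _ _ _ h
  have hb : ∀ r : Fin n, ∃ b : List ℕ, ∀ c : Fin n, ((((b.zipWith (fun (b : ℕ) (v : ℕ → ℤ) => (b : ℤ) * v c) R).sum : ℤ)) : ZMod 101) = if c = r then 1 else 0 := by
    intro r
    obtain ⟨b, hb⟩ := cks_ex _ _ _ _ hB r (Nat.zero_le _) r.2
    refine ⟨b, fun c => ?_⟩
    rw [ckr, frc_eq, Bool.and_eq_true, decide_eq_true_eq] at hb
    have h1 := ckc_ex _ _ _ hb.1 c c.2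
    rw [pkf_zip, pkf_dig _ _ (fun c _ => (zip_le b R c).trans_lt hb.2) c c.2] at h1
    rw [zip_cast, ← ZMod.natCast_mod, h1]
    simp only [Fin.val_inj]
    split_ifs <;> simp
  choose b hb using hb
  set C : Matrix (Fin n) (Fin n) ℤ := fun r c => ((b r).zipWith (fun (b : ℕ) (v : ℕ → ℤ) => (b : ℤ) * v c) R).sum with hC
  have hdet : C.det ≠ 0 := by
    intro h0
    have h1 : ((C.det : ℤ) : ZMod 101) = (C.map (Int.castRingHom (ZMod 101))).det := by
      have := RingHom.map_det (Int.castRingHom (ZMod 101)) C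
      simpa using this
    have h2 : C.map (Int.castRingHom (ZMod 101)) = 1 := by
      ext r c
      simp only [map_apply, hC]
      rw [Matrix.one_apply]
      have := hb r c
      simp only [eq_comm (a := r)]
      exact this
    rw [h2, h0, det_one] at h1
    revert h1; decide
  have hdet2 : (C.map (Int.castRingHom ℂ)).det ≠ 0 := by
    have := RingHom.map_det (Int.castRingHom ℂ) C
    rw [RingHom.mapMatrix_apply] at this
    rw [← this]; simpa using hdet
  have hz := eq_zero_of_mulVec_eq_zero hdet2 (v := fun c : Fin n => x c) (by
    ext r
    have := zip_x n (b r) R x hx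
    rw [Finset.sum_range] at this
    exact this)
  intro c hc
  exact congr_fun hz ⟨c, hc⟩
end

section
section
variable {j : ℕ} {f : ℂ → ℂ → ℂ → Vc j}

def ww (f : ℂ → ℂ → ℂ → Vc j) (N : ℤ) : Vc j := fun i => ∑ l ∈ Finset.range (j + 1), cmpo (AC f N 1 1) l * 1 ^ (j - l) * ((-1 / 2 : ℂ) ^ (l - (i:ℕ)) * (l.choose i))

lemma ev_ww (N : ℤ) (y : ℂ) : ev j (AC f N 1 1) 1 y = ev j (ww f N) 1 (y + 1 / 2) := by
  have := ev_tr (AC f N 1 1) 1 (-1 / 2) (y + 1 / 2)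
  refine Eq.trans ?_ this
  congr 1; ring

lemma Form.ww_odd (h : Form j f) (N : ℤ) (y : ℂ) : ev j (ww f N) 1 (-y) = - ev j (ww f N) 1 y := by
  have hJ := h.jac (M := 1) (by decide)
  have h1 := hJ.shift N (R := -1) (by decide) 1 (y - 1 / 2)
  have h2 := hJ.sgn N (R := 1) (by decide) 1 (y - 1 / 2 + 1)
  rw [h2] at h1
  have h3 := ev_ww (f := f) N (y - 1 / 2)
  have h4 := ev_ww (f := f) N (-(y - 1 / 2 + 1))
  simp only [AC] at h3 h4
  rw [h4, show N + -1 + 1 = N by ring, show (-1 + 2 * 1 : ℤ) = 1 by norm_num, h3] at h1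
  rw [sub_add_cancel] at h1
  rw [h1, neg_neg]; congr 1; ring

lemma Form.ww_even (h : Form j f) (N : ℤ) {l : ℕ} (hl : Even l) : cmpo (ww f N) l = 0 := by
  by_cases hj : l < j + 1
  · have : ww f N = fun i : Fin (j + 1) => - ((-1) ^ (i : ℕ) * ww f N i) := by
      refine ev_ext fun y => ?_
      have h1 := h.ww_odd N y
      rw [ev_cmp (ww f N) 1 (-y)] at h1
      rw [← neg_neg (ev j (ww f N) 1 y), ← h1, ev_cmp, ← sum_neg_distrib]
      refine sum_congr rfl fun i hi => ?_
      rw [cmpo, cmpo, dif_pos (Finset.mem_range.1 hi), dif_pos (Finset.mem_range.1 hi), neg_pow y]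
      ring
    have h2 := congr_fun this ⟨l, hj⟩
    rw [cmpo, dif_pos hj]
    simp only [hl.neg_pow, one_pow, one_mul] at h2
    linear_combination (1 / 2 : ℂ) * h2
  · exact cmp_big _ (by omega)

def xx (f : ℂ → ℂ → ℂ → Vc j) (h c : ℕ) : ℂ := cmpo (ww f ((2 * (c / h) + 1 : ℕ) : ℤ)) (2 * (c % h) + 1) / 2 ^ (2 * (c % h) + 1)

lemma sum3 (h a : ℕ) (ha : a < 3) (g : ℕ → ℂ) : ∑ c ∈ Finset.range (3 * h), (if c / h = a then g (c % h) else 0) = ∑ s ∈ Finset.range h, g s := by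
  rcases Nat.eq_zero_or_pos h with rfl | hp
  · simp
  have e : ∀ b, ∑ s ∈ Finset.range h, (if (b * h + s) / h = a then g ((b * h + s) % h) else 0) = if b = a then ∑ s ∈ Finset.range h, g s else 0 := by
    intro b
    rw [sum_congr rfl fun s hs => by
      rw [mul_comm b, Nat.mul_add_div hp, Nat.div_eq_of_lt (Finset.mem_range.1 hs), add_zero, Nat.mul_add_mod, Nat.mod_eq_of_lt (Finset.mem_range.1 hs)]]
    split_ifs <;> simp
  rw [show 3 * h = h + h + h by ring, Finset.sum_range_add, Finset.sum_range_add]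
  have e0 := e 0; have e1 := e 1; have e2 := e 2
  simp only [zero_mul, zero_add, one_mul] at e0 e1
  rw [← two_mul, e0, e1, e2]
  interval_cases a <;> simp

lemma cI_eq (l i : ℕ) : cI l i = l.choose i := by
  rw [cI]
  split_ifs with h
  · rw [Nat.choose_eq_factorial_div_factorial h]
  · rw [choose_eq_zero_of_lt (by omega)]; rfl

lemma ww_co (hw : ∀ N l, Even l → cmpo (ww f N) l = 0) {h : ℕ} (hj : j = 2 * h) (a : ℕ) (ha : a < 3) (v : Vc j) (R : ℤ) (e : ℤ) (hv : ∀ y, ev j v 1 y = e * ev j (ww f ((2 * a + 1 : ℕ) : ℤ)) 1 (y + R / 2)) (i : ℕ) :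
    cmpo v i = ∑ c ∈ Finset.range (3 * h), (if c / h = a then ((e * (cI (2 * (c % h) + 1) i * 2 ^ i * R ^ (2 * (c % h) + 1 - i)) : ℤ) : ℂ) else 0) * xx f h c := by
  have h1 : ∀ c, (if c / h = a then ((e * (cI (2 * (c % h) + 1) i * 2 ^ i * R ^ (2 * (c % h) + 1 - i)) : ℤ) : ℂ) else 0) * xx f h c
      = if c / h = a then (fun s => e * (cmpo (ww f ((2 * a + 1 : ℕ) : ℤ)) (2 * s + 1) * ((R / 2 : ℂ) ^ (2 * s + 1 - i) * (2 * s + 1).choose i))) (c % h) else 0 := by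
    intro c
    split_ifs with hc
    · rw [xx, hc]
      simp only [cI_eq]
      by_cases hi : i ≤ 2 * (c % h) + 1
      · push_cast
        rw [div_pow, show (2:ℂ) ^ (2 * (c % h) + 1) = 2 ^ (2 * (c % h) + 1 - i) * 2 ^ i by rw [← pow_add]; congr 1; omega]
        field_simp
      · rw [choose_eq_zero_of_lt (by omega)]; simp
    · simp
  rw [sum_congr rfl fun c _ => h1 c, sum3 h a ha (fun s => e * (cmpo (ww f ((2 * a + 1 : ℕ) : ℤ)) (2 * s + 1) * ((R / 2 : ℂ) ^ (2 * s + 1 - i) * (2 * s + 1).choose i)))]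
  by_cases hi : i < j + 1
  · have h2 : v = fun i : Fin (j + 1) => e * ∑ l ∈ Finset.range (j + 1), cmpo (ww f ((2 * a + 1 : ℕ) : ℤ)) l * 1 ^ (j - l) * ((R / 2 : ℂ) ^ (l - (i:ℕ)) * (l.choose i)) := by
      refine ev_ext fun y => ?_
      rw [hv, ev_tr, ← ev_smul]; rfl
    rw [cmpo, dif_pos hi, h2]
    simp only
    simp only [one_pow, mul_one]
    have hW := hw ((2 * a + 1 : ℕ) : ℤ)
    generalize cmpo (ww f ((2 * a + 1 : ℕ) : ℤ)) = W at hW ⊢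
    rw [Finset.mul_sum, show Finset.range (j + 1) = Finset.range (2 * h + 1) by rw [hj], sum_range_succ, hW (2 * h) (by simp)]
    simp only [zero_mul, mul_zero, add_zero]
    clear hv h1 h2 hi hj
    induction h with
    | zero => simp
    | succ n ih =>
      rw [show 2 * (n + 1) = 2 * n + 1 + 1 by ring, sum_range_succ, sum_range_succ, sum_range_succ, ih, hW (2 * n) (by simp)]
      simp
  · rw [cmp_big _ (by omega), sum_eq_zero]
    intro s hs
    have := Finset.mem_range.1 hs
    rw [choose_eq_zero_of_lt (by omega)]; simp

lemma Form.Dl (h : Form j f) {g : ℕ} (hj : j = 2 * g) (b : ℕ) (hb : b < 3) {R : ℤ} (hR : R = 1 ∨ R = -1 ∨ R = 3 ∨ R = -3) (i : ℕ) :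
    cmpo (AC f ((2 * b + 1 : ℕ) : ℤ) R 1) i = ∑ c ∈ Finset.range (3 * g), (Dz g b R i c : ℂ) * xx f g c := by
  have hJ := h.jac (M := 1) (by decide)
  have hw : ∀ N l, Even l → cmpo (ww f N) l = 0 := fun N l hl => h.ww_even N hl
  rcases hR with rfl | rfl | rfl | rfl
  · rw [ww_co hw hj b hb _ 1 1 (fun y => by rw [ev_ww]; simp) i]
    refine sum_congr rfl fun c _ => ?_
    congr 1; simp [Dz]
  · rw [ww_co hw hj b hb _ (-1) (-1) (fun y => by
      have := hJ.sgn ((2 * b + 1 : ℕ) : ℤ) (R := 1) (by decide) 1 y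
      rw [AC, this]
      have h3 := ev_ww (f := f) ((2 * b + 1 : ℕ) : ℤ) (-y)
      rw [AC] at h3
      rw [h3, ← neg_neg (-y + 1 / 2), h.ww_odd]
      push_cast
      rw [neg_one_mul]
      congr 2; ring) i]
    refine sum_congr rfl fun c _ => ?_
    congr 1; simp [Dz]
  all_goals
    cases b with
    | zero =>
      rw [h.koe (by decide) (by decide) (by decide) (by norm_num)]
      simp [Dz, cmpo]
    | succ a => ?_
  · have h3 : ∀ y, ev j (AC f ((2 * (a + 1) + 1 : ℕ) : ℤ) 3 1) 1 y = -1 * ev j (ww f ((2 * a + 1 : ℕ) : ℤ)) 1 (y + 3 / 2) := fun y => by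
      have := hJ.shift ((2 * a + 1 : ℕ) : ℤ) (R := 1) (by decide) 1 y
      have h3 := ev_ww (f := f) ((2 * a + 1 : ℕ) : ℤ) (y + 1)
      rw [AC] at h3 ⊢
      rw [h3] at this
      rw [neg_one_mul, show y + 3 / 2 = y + 1 + 1 / 2 by ring, ← this]
      congr 2
    rw [ww_co hw hj a (by omega) _ 3 (-1) (fun y => by rw [h3]; norm_num) i]
    refine sum_congr rfl fun c _ => ?_
    congr 1; simp [Dz]
  · have h3 : ∀ y, ev j (AC f ((2 * (a + 1) + 1 : ℕ) : ℤ) 3 1) 1 y = -1 * ev j (ww f ((2 * a + 1 : ℕ) : ℤ)) 1 (y + 3 / 2) := fun y => by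
      have := hJ.shift ((2 * a + 1 : ℕ) : ℤ) (R := 1) (by decide) 1 y
      have h3 := ev_ww (f := f) ((2 * a + 1 : ℕ) : ℤ) (y + 1)
      rw [AC] at h3 ⊢
      rw [h3] at this
      rw [neg_one_mul, show y + 3 / 2 = y + 1 + 1 / 2 by ring, ← this]
      congr 2
    rw [ww_co hw hj a (by omega) _ (-3) 1 (fun y => by
      have := hJ.sgn ((2 * (a + 1) + 1 : ℕ) : ℤ) (R := 3) (by decide) 1 y
      rw [AC, this]
      have h4 := h3 (-y)
      rw [AC] at h4
      rw [h4, ← neg_neg (-y + 3 / 2), h.ww_odd]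
      push_cast
      rw [neg_one_mul, neg_neg, one_mul]
      congr 1; ring) i]
    refine sum_congr rfl fun c _ => ?_
    congr 1; simp [Dz]

lemma oddR4 : oddR 4 = {1, -1, 3, -3} := by decide
lemma oddR1 : oddR 1 = {1, -1} := by decide

lemma Form.El (h : Form j f) {g : ℕ} (hj : j = 2 * g) (b : ℕ) (hb : b < 3) (ν i : ℕ) :
    SB f 1 ((2 * b + 1 : ℕ) : ℤ) 4 ν i = ∑ c ∈ Finset.range (3 * g), (Ez g b ν i c : ℂ) * xx f g c := by
  rw [SB, oddR4, sum_insert (by decide), sum_insert (by decide), sum_insert (by decide), Finset.sum_singleton]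
  rw [h.Dl hj b hb (by decide), h.Dl hj b hb (by decide), h.Dl hj b hb (by decide), h.Dl hj b hb (by decide)]
  simp only [Finset.mul_sum, ← sum_add_distrib]
  refine sum_congr rfl fun c _ => ?_
  rw [Ez]; push_cast; ring
end
end

section
section
variable {j : ℕ} {f : ℂ → ℂ → ℂ → Vc j}

lemma Form.cswap (h : Form j f) {N R M : ℤ} (hN : Odd N) (hM : Odd M) {i : ℕ} (hi : i ≤ j) :
    cmpo (AC f N R M) i = - cmpo (AC f M R N) (j - i) := by
  have : AC f N R M = fun i => - AC f M R N (Fin.rev i) := by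
    refine ev_ext fun y => ?_
    rw [h.swap hN hM, ev, ev, ← sum_neg_distrib, ← Equiv.sum_comp Fin.revPerm]
    refine sum_congr rfl fun l _ => ?_
    simp only [Fin.revPerm_apply, Fin.val_rev, one_pow]
    have := l.isLt
    rw [show j - (j + 1 - (l + 1 : ℕ)) = (l:ℕ) by omega]; ring
  rw [cmpo, dif_pos (by omega), this, cmpo, dif_pos (by omega)]
  simp only
  congr 2
  ext; simp [Fin.val_rev]

lemma Form.SBswap (h : Form j f) {N M : ℤ} (hN : Odd N) (hM : Odd M) (B ν : ℕ) {i : ℕ} (hi : i ≤ j) :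
    SB f M N B ν i = - SB f N M B ν (j - i) := by
  rw [SB, SB, ← sum_neg_distrib]
  refine sum_congr rfl fun R _ => ?_
  rw [h.cswap hN hM hi]; ring

lemma Form.SB1 (h : Form j f) (i : ℕ) : SB f 1 1 1 0 i = SB f 1 1 4 0 i := by
  rw [SB, SB, oddR4, oddR1]
  refine sum_subset (by decide) fun R hR hn => ?_
  have : R = 3 ∨ R = -3 := by revert R; decide
  rw [h.koe (by decide) (by rcases this with rfl | rfl <;> decide) (by decide) (by rcases this with rfl | rfl <;> norm_num)]
  simp [cmpo]

lemma Form.rows (h : Form j f) {g : ℕ} (hj : j = 2 * g) (hg : 10 ≤ g) (sw us nk : ℕ) (hs : sw ≤ 10) (hus : us ≤ g) (hx : ∀ s < us, xx f g s = 0) :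
    ∀ v ∈ rws g sw us nk, ∑ c ∈ Finset.range (3 * g), (v c : ℂ) * xx f g c = 0 := by
  have oN : ∀ b : ℕ, Odd (((2 * b + 1 : ℕ)) : ℤ) := fun b => ⟨b, by push_cast; ring⟩
  have e0 : (((2 * 0 + 1 : ℕ)) : ℤ) = 1 := rfl
  have hE := fun (b : ℕ) (hb : b < 3) (ν i : ℕ) => h.El hj b hb ν i
  have hD := fun i => h.Dl hj 0 (by norm_num) (R := 1) (by decide) i
  rw [e0] at hD
  have hB : ∀ b < 3, 4 * ((2 * b + 1 : ℕ) : ℤ) * 1 ≤ (((4:ℕ) : ℤ) + 1) ^ 2 := fun b hb => by push_cast; omega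
  have hB' : ∀ b < 3, 4 * 1 * ((2 * b + 1 : ℕ) : ℤ) ≤ (((4:ℕ) : ℤ) + 1) ^ 2 := fun b hb => by push_cast; omega
  have hsb : ∀ b ν i, i ≤ j → SB f 1 ((2 * b + 1 : ℕ) : ℤ) 4 ν i = - SB f ((2 * b + 1 : ℕ) : ℤ) 1 4 ν (j - i) := fun b ν i hi => h.SBswap (oN b) (by decide) 4 ν hi
  intro v hv
  simp only [rws, List.mem_append, List.mem_map] at hv
  rcases hv with (((((⟨i, hi, rfl⟩ | ⟨q, hq, rfl⟩) | ⟨b, hb, rfl⟩) | ⟨q, hq, rfl⟩) | ⟨q, hq, rfl⟩) | ⟨q, hq, rfl⟩) | ⟨s, hs, rfl⟩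
  · have := List.mem_range.1 hi
    push_cast
    simp only [add_mul, sum_add_distrib]
    rw [← hD, ← hD, h.cswap (by decide) (by decide) (by omega), show j - i = 2 * g - i by omega]
    ring
  · have hq' : q.1 < 3 ∧ (q.2 = 2 ∨ q.2 = 6) := by revert q; decide
    rw [← hE _ hq'.1]
    rcases hq'.2 with h2 | h2
    · exact h.V0 (by decide) (N0 := 1) (by decide) (h.hc1 (by decide)) (oN _) 4 (hB _ hq'.1) _ _ (by push_cast; omega)
    · have := h.V2 (by decide) (oN q.1) 4 (hB _ hq'.1) 0 (2 * g - q.2) (by push_cast; omega) (by omega)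
      simpa using this
  · have hb' : b < 3 := by revert b; decide
    push_cast
    simp only [sub_mul, sum_sub_distrib, mul_assoc, ← Finset.mul_sum]
    rw [← hE _ hb', ← hE _ hb']
    have := h.V2 (by decide) (oN b) 4 (hB _ hb') 1 (2 * g - 5) (by push_cast; omega) (by omega)
    rw [this, show 2 * g - 5 + 1 = 2 * g - 4 by omega]
    have e : ((2 * g - 5 : ℕ) : ℂ) = 2 * g - 5 := by rw [Nat.cast_sub (by omega)]; push_cast; ring
    rw [e]; simp; ring
  · have hq' : q.1 < 3 ∧ (q.2.1 + q.2.2 < 4 ∨ (q.2.1 = 0 ∧ q.2.2 = 6)) := by revert q; decide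
    rw [← hE _ hq'.1, hsb _ _ _ (by omega), neg_eq_zero]
    rcases hq'.2 with h2 | h2
    · exact h.V0 (oN _) (N0 := 1) (by decide) (h.hc1 (oN _)) (by decide) 4 (hB' _ hq'.1) _ _ (by push_cast; omega)
    · have := h.V2 (oN q.1) (N := 1) (by decide) 4 (hB' _ hq'.1) 0 (j - q.2.2) (by push_cast; omega) (by omega)
      rw [h2.1]
      simpa using this
  · have hq' : q.1 < 3 ∧ 1 ≤ q.2.1 ∧ 1 ≤ q.2.2 ∧ q.2.1 + q.2.2 = 6 := by revert q; decide
    obtain ⟨b, ν, i⟩ := q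
    obtain ⟨h1, h2, h3, h4⟩ := hq'
    simp only at h1 h2 h3 h4
    push_cast
    simp only [sub_mul, sum_sub_distrib, mul_assoc, ← Finset.mul_sum]
    rw [← hE _ h1, ← hE _ h1, ← hE _ h1, hsb _ _ _ (by omega), hsb _ _ _ (by omega), hsb _ _ _ (by omega)]
    have := h.V2 (oN b) (N := 1) (by decide) 4 (hB' _ h1) ν (j - i) (by push_cast; omega) (by omega)
    rw [if_pos h2, show j - i + 1 = j - (i - 1) by omega, show ((j - i : ℕ) : ℂ) = 2 * g - i by rw [Nat.cast_sub (by omega), hj]; push_cast; ring] at this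
    have e2 : (ν : ℂ) * (ν - 1) * (if 2 ≤ ν then SB f ((2 * b + 1 : ℕ) : ℤ) 1 4 (ν - 2) (j - i) else 0) = (ν : ℂ) * (ν - 1) * SB f ((2 * b + 1 : ℕ) : ℤ) 1 4 (ν - 2) (j - i) := by
      split_ifs with hh
      · rfl
      · rw [show ν = 1 by omega]; simp
    push_cast at this e2 ⊢
    linear_combination -this - (2 * b + 1) * e2
  · have key : ∀ (k : ℕ) (m1 m2 : ℂ), HasM k m1 m2 → (k < 12 ∨ k = 14) → k + 4 ≤ j →
        SB f 1 ((2 * 1 + 1 : ℕ) : ℤ) 4 0 (2 * g - 4 - k) - (m1 - 12) * SB f 1 ((2 * 0 + 1 : ℕ) : ℤ) 4 0 (2 * g - 4 - k) = 0 ∧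
        SB f 1 ((2 * 2 + 1 : ℕ) : ℤ) 4 0 (2 * g - 4 - k) - (m2 - 12 * m1 + 54) * SB f 1 ((2 * 0 + 1 : ℕ) : ℤ) 4 0 (2 * g - 4 - k) = 0 := by
      intro k m1 m2 hm hk hkj
      have := h.V1 hm hk (i := 2 * g - 4 - k) (by omega) (B := 4) (B' := 4) (by norm_num) (by norm_num)
      rw [h.SB1] at this
      exact ⟨sub_eq_zero.2 this.1, sub_eq_zero.2 this.2⟩
    have hq1 : q.1 < 3 := by have := List.mem_of_mem_take hq; clear hq; revert q; decide
    have hq := List.mem_of_mem_take hq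
    push_cast
    simp only [sub_mul, sum_sub_distrib, mul_assoc, ← Finset.mul_sum]
    rw [← hE _ hq1, ← hE _ (by norm_num)]
    simp only [List.mem_cons, List.not_mem_nil, or_false] at hq
    rcases hq with rfl | rfl | rfl | rfl | rfl | rfl | rfl | rfl | rfl | rfl
    · have := (key 4 _ _ hm4 (by norm_num) (by omega)).1; norm_num at this ⊢; exact this
    · have := (key 4 _ _ hm4 (by norm_num) (by omega)).2; norm_num at this ⊢; exact this
    · have := (key 6 _ _ hm6 (by norm_num) (by omega)).1; norm_num at this ⊢; exact this
    · have := (key 6 _ _ hm6 (by norm_num) (by omega)).2; norm_num at this ⊢; exact this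
    · have := (key 8 _ _ hm8 (by norm_num) (by omega)).1; norm_num at this ⊢; exact this
    · have := (key 8 _ _ hm8 (by norm_num) (by omega)).2; norm_num at this ⊢; exact this
    · have := (key 10 _ _ hm10 (by norm_num) (by omega)).1; norm_num at this ⊢; exact this
    · have := (key 10 _ _ hm10 (by norm_num) (by omega)).2; norm_num at this ⊢; exact this
    · have := (key 14 _ _ hm14 (by norm_num) (by omega)).1; norm_num at this ⊢; exact this
    · have := (key 14 _ _ hm14 (by norm_num) (by omega)).2; norm_num at this ⊢; exact this
  · have := List.mem_range.1 hs
    simp only [Int.cast_ite, Int.cast_one, Int.cast_zero, ite_mul, one_mul, zero_mul]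
    rw [Finset.sum_ite_eq', if_pos (by rw [mem_range]; omega), hx s this]

lemma ck13 : chk (3 * 13) (rws 13 9 1 6) = true := by decide +kernel
lemma ck14 : chk (3 * 14) (rws 14 10 1 8) = true := by decide +kernel
lemma ck15 : chk (3 * 15) (rws 15 10 2 10) = true := by decide +kernel

lemma Form.xx0 (h : Form j f) {g us : ℕ} (hg : g = 13 ∧ us = 1 ∨ g = 14 ∧ us = 1 ∨ g = 15 ∧ us = 2) (hj : j = 2 * g) (hx : ∀ s < us, xx f g s = 0) : ∀ c < 3 * g, xx f g c = 0 := by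
  rcases hg with ⟨rfl, rfl⟩ | ⟨rfl, rfl⟩ | ⟨rfl, rfl⟩
  · exact chk_zero ck13 _ (h.rows hj (by norm_num) 9 1 6 (by norm_num) (by norm_num) hx)
  · exact chk_zero ck14 _ (h.rows hj (by norm_num) 10 1 8 (by norm_num) (by norm_num) hx)
  · exact chk_zero ck15 _ (h.rows hj (by norm_num) 10 2 10 (by norm_num) (by norm_num) hx)

lemma cmp0 {v : Vc j} (h : ∀ i, cmpo v i = 0) : v = 0 := by
  ext i; exact (cmp_fin v i).symm.trans (h i)

lemma Form.AC0 (h : Form j f) {g us : ℕ} (hg : g = 13 ∧ us = 1 ∨ g = 14 ∧ us = 1 ∨ g = 15 ∧ us = 2) (hj : j = 2 * g) (hx : ∀ s < us, xx f g s = 0)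
    (N R : ℤ) (hN : Odd N) (hR : Odd R) (hl : N < 7) : AC f N R 1 = 0 := by
  have hz := h.xx0 hg hj hx
  by_cases hk : N < 0 ∨ 4 * N * 1 ≤ R ^ 2
  · exact h.koe hN hR (by decide) (Or.inr hk)
  push Not at hk
  obtain ⟨b, rfl⟩ := hN
  lift b to ℕ using by omega
  have hb : b < 3 := by omega
  have hR4 : R ∈ oddR 4 := by
    simp only [oddR, mem_filter, mem_Icc]
    refine ⟨⟨?_, ?_⟩, hR⟩ <;> push_cast <;> nlinarith
  rw [oddR4] at hR4
  simp only [Finset.mem_insert, Finset.mem_singleton] at hR4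
  refine cmp0 fun i => ?_
  have := h.Dl hj b hb hR4 i
  push_cast at this
  rw [this]
  exact sum_eq_zero fun c hc => by rw [hz c (Finset.mem_range.1 hc), mul_zero]
end
end

section
lemma vand (S T : Finset ℤ) (c : ℤ → ℂ) (hT : ∀ R ∈ T, R ∉ S → c R = 0) (n : ℕ) (hS : S.card ≤ n + 1)
    (h : ∀ ν ≤ n, ∑ R ∈ T, (R:ℂ) ^ ν * c R = 0) {R0 : ℤ} (h0 : R0 ∈ S) (h0' : R0 ∈ T) : c R0 = 0 := by
  classical
  set P : Polynomial ℂ := ∏ R ∈ S.erase R0, (Polynomial.X - Polynomial.C (R:ℂ)) with hP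
  have hd : P.natDegree ≤ n := by
    rw [hP, Polynomial.natDegree_prod_of_monic _ _ fun R _ => Polynomial.monic_X_sub_C _]
    simp only [Polynomial.natDegree_X_sub_C, Finset.sum_const, smul_eq_mul, mul_one]
    rw [Finset.card_erase_of_mem h0]; omega
  have h1 : ∑ R ∈ T, P.eval (R:ℂ) * c R = 0 := by
    simp only [Polynomial.eval_eq_sum_range' (Nat.lt_succ_of_le hd), Finset.sum_mul]
    rw [sum_comm]
    refine sum_eq_zero fun ν hν => ?_
    simp only [mul_assoc, ← Finset.mul_sum]
    rw [h ν (Nat.lt_succ_iff.1 (Finset.mem_range.1 hν)), mul_zero]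
  rw [Finset.sum_eq_single R0] at h1
  · refine (mul_eq_zero.1 h1).resolve_left ?_
    rw [hP, Polynomial.eval_prod]
    refine Finset.prod_ne_zero_iff.2 ?_
    intro R hR
    simp only [Polynomial.eval_sub, Polynomial.eval_X, eval_C, sub_ne_zero, ne_eq, Int.cast_inj]
    exact (Finset.ne_of_mem_erase hR).symm
  · intro R hR hne
    by_cases hRS : R ∈ S
    · rw [hP, Polynomial.eval_prod, Finset.prod_eq_zero (Finset.mem_erase.2 ⟨hne, hRS⟩) (by simp), zero_mul]
    · rw [hT R hR hRS, mul_zero]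
  · exact fun hn => absurd h0' hn

lemma oddR_card {M : ℕ} (hM : Odd M) : (oddR M).card ≤ M + 1 := by
  have : oddR M ⊆ (Finset.range (M + 1)).image (fun k : ℕ => 2 * (k:ℤ) - M) := by
    intro R hR
    simp only [oddR, mem_filter, mem_Icc] at hR
    obtain ⟨⟨a, b⟩, r, hr⟩ := hR
    obtain ⟨m, hm⟩ := hM
    simp only [Finset.mem_image, mem_range]
    exact ⟨(r + m + 1).toNat, by omega, by omega⟩
  exact (Finset.card_le_card this).trans (Finset.card_image_le.trans (by simp))

section
variable {j : ℕ} {f : ℂ → ℂ → ℂ → Vc j}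

lemma Form.ord (h : Form j f) {M N0 : ℕ} (hM : Odd M) (hN0 : Odd N0) (hc : ∀ N R : ℤ, Odd N → Odd R → N < N0 → AC f N R M = 0)
    {i : ℕ} (hi : (M:ℤ) - i + j + 2 < 6 * N0) {R : ℤ} (hR : Odd R) : cmpo (AC f N0 R M) i = 0 := by
  have hM' : Odd (M : ℤ) := by exact_mod_cast hM
  have hN' : Odd (N0 : ℤ) := by exact_mod_cast hN0
  have out : ∀ R : ℤ, Odd R → R ∉ oddR M → AC f N0 R M = 0 := by
    intro R hR hn
    simp only [oddR, mem_filter, mem_Icc, hR, and_true, not_and_or, not_le] at hn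
    rcases hn with hn | hn
    · refine (h.jac hM').shift0 1 hR (hc _ _ ?_ ?_ (by omega))
      · rw [one_mul, one_pow, one_mul, add_assoc]; exact hN'.add_even (hR.add_odd hM')
      · exact hR.add_even ⟨M, by ring⟩
    · refine (h.jac hM').shift0 (-1) hR (hc _ _ ?_ ?_ (by omega))
      · rw [show (N0:ℤ) + -1 * R + (-1) ^ 2 * M = N0 + (M - R) by ring]; exact hN'.add_even (hM'.sub_odd hR)
      · exact hR.add_even ⟨-M, by ring⟩
  by_cases hRM : R ∈ oddR M
  · refine vand (oddR M) (oddR (4 * N0 * M + M)) (fun R => cmpo (AC f N0 R M) i) (fun R hR hn => ?_) M (oddR_card hM) (fun ν hν => ?_) hRM ?_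
    · simp only [out R (mem_oddR hR) hn]; simp [cmpo]
    · exact h.V0 hM' hN0 hc hN' (4 * N0 * M + M) (by push_cast; nlinarith) ν i (by omega)
    · simp only [oddR, mem_filter, mem_Icc] at hRM ⊢
      refine ⟨?_, hRM.2⟩
      have : 0 ≤ 4 * (N0:ℤ) * M := by positivity
      push_cast; constructor <;> linarith [hRM.1.1, hRM.1.2]
  · rw [out R hR hRM]; simp [cmpo]

lemma Form.ordall (h : Form j f) {M : ℕ} (hM : Odd M) {N1 : ℕ} (hw : j + M + 2 < 6 * N1) (hc : ∀ N R : ℤ, Odd N → Odd R → N < N1 → AC f N R M = 0) :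
    ∀ N R : ℤ, Odd N → Odd R → AC f N R M = 0 := by
  have : ∀ n : ℕ, ∀ N R : ℤ, Odd N → Odd R → N < n → AC f N R M = 0 := by
    intro n
    induction n with
    | zero => exact fun N R hN hR hl => hc N R hN hR (by push_cast at hl; omega)
    | succ n ih =>
      intro N R hN hR hl
      by_cases h1 : N < n
      · exact ih N R hN hR h1
      by_cases h2 : N < N1
      · exact hc N R hN hR h2
      have e : N = n := by push_cast at hl; omega
      subst e
      exact cmp0 fun i => h.ord hM (by exact_mod_cast hN) ih (by omega) hR
  exact fun N R hN hR => this (N.toNat + 1) N R hN hR (by push_cast; omega)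

lemma poly_kill (v w : Vc j) (hv : ∀ i, i < 13 ∨ 18 ≤ i → cmpo v i = 0) (hw : ∀ i < 11, cmpo w i = 0)
    (a e : ℂ) (ha : a ≠ 0) (he : e * e = 1) (hh : ∀ y, ev j w 1 y = e * ev j v 1 (y + a)) : v = 0 := by
  let P : (Vc j) → Polynomial ℂ := fun v => ∑ l ∈ Finset.range (j + 1), Polynomial.monomial l (cmpo v l)
  have hc : ∀ v i, (P v).coeff i = cmpo v i := by
    intro v i
    simp only [P, Polynomial.finsetSum_coeff, Polynomial.coeff_monomial, Finset.sum_ite_eq', mem_range]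
    split_ifs with hi
    · rfl
    · exact (cmp_big v (by omega)).symm
  have hev : ∀ v y, (P v).eval y = ev j v 1 y := by
    intro v y
    rw [ev_cmp]; simp [P, Polynomial.eval_finsetSum]
  have h1 : (Polynomial.X : Polynomial ℂ) ^ 13 ∣ P v := by
    rw [Polynomial.X_pow_dvd_iff]; exact fun d hd => by rw [hc, hv d (Or.inl hd)]
  have h2 : (Polynomial.X : Polynomial ℂ) ^ 11 ∣ P w := by
    rw [Polynomial.X_pow_dvd_iff]; exact fun d hd => by rw [hc, hw d hd]
  have h3 : P v = Polynomial.C e * (P w).comp (Polynomial.X - Polynomial.C a) := by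
    refine Polynomial.funext fun y => ?_
    rw [Polynomial.eval_mul, eval_C, Polynomial.eval_comp, hev, hev, hh]
    simp [← mul_assoc, he]
  have h4 : (Polynomial.X - Polynomial.C a) ^ 11 ∣ P v := by
    obtain ⟨q, hq⟩ := h2
    refine ⟨Polynomial.C e * q.comp (Polynomial.X - Polynomial.C a), ?_⟩
    rw [h3, hq]; simp; ring
  have cop : IsCoprime ((Polynomial.X : Polynomial ℂ) ^ 13) ((Polynomial.X - Polynomial.C a) ^ 11) := by
    refine IsCoprime.pow ?_
    have := Polynomial.isCoprime_X_sub_C_of_isUnit_sub (R := ℂ) (a := 0) (b := a) (by simpa using ha)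
    simpa using this
  have h5 := cop.mul_dvd h1 h4
  have h6 : P v = 0 := by
    by_contra hne
    have h7 := Polynomial.natDegree_le_of_dvd h5 hne
    rw [Polynomial.natDegree_mul (pow_ne_zero _ Polynomial.X_ne_zero) (pow_ne_zero _ (Polynomial.X_sub_C_ne_zero a))] at h7
    simp only [Polynomial.natDegree_pow, Polynomial.natDegree_X, Polynomial.natDegree_X_sub_C] at h7
    have h8 : (P v).natDegree ≤ 17 := by
      rw [Polynomial.natDegree_le_iff_coeff_eq_zero]
      intro N hN
      rw [hc, hv N (Or.inr hN)]
    omega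
  exact cmp0 fun i => by rw [← hc, h6, Polynomial.coeff_zero]

set_option maxHeartbeats 1000000 in
lemma Form.allzero (h : Form j f) (hj : j ≤ 30) (h1 : ∀ N R : ℤ, Odd N → Odd R → N < (7:ℕ) → AC f N R (1:ℕ) = 0) :
    ∀ M : ℕ, Odd M → ∀ N R : ℤ, Odd N → Odd R → AC f N R M = 0 := by
  have od : ∀ {n : ℕ}, Odd n → Odd (n : ℤ) := fun h => by exact_mod_cast h
  have a1 := h.ordall (by decide) (by omega) h1
  have lt3 : ∀ M : ℕ, Odd M → ∀ N R : ℤ, Odd N → Odd R → N < (3:ℕ) → AC f N R M = 0 := by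
    intro M hM N R hN hR hl
    by_cases h0 : N < 0
    · exact h.koe hN hR (od hM) (Or.inr (Or.inl h0))
    have : N = (1:ℕ) := by obtain ⟨k, rfl⟩ := hN; push_cast at hl ⊢; omega
    rw [this]
    exact h.swap0 (by decide) (od hM) (a1 _ _ (od hM) hR)
  have o3 : ∀ M : ℕ, Odd M → ∀ R : ℤ, Odd R → ∀ i, M + j + 2 < 18 + i → cmpo (AC f (3:ℕ) R M) i = 0 := by
    intro M hM R hR i hi
    exact h.ord hM (by decide) (lt3 M hM) (by push_cast; omega) hR
  have c53 : ∀ R : ℤ, Odd R → ∀ i < 11, cmpo (AC f 5 R (3:ℕ)) i = 0 := by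
    intro R hR i hi
    by_cases hij : i ≤ j
    · rw [h.cswap (by decide) (by decide) hij]
      have := o3 5 (by decide) R hR (j - i) (by omega)
      push_cast at this ⊢
      rw [this, neg_zero]
    · exact cmp_big _ (by omega)
  have c33 : ∀ R : ℤ, Odd R → ∀ i < 13, cmpo (AC f 3 R (3:ℕ)) i = 0 := by
    intro R hR i hi
    by_cases hij : i ≤ j
    · rw [h.cswap (by decide) (by decide) hij]
      have := o3 3 (by decide) R hR (j - i) (by omega)
      push_cast at this ⊢
      rw [this, neg_zero]
    · exact cmp_big _ (by omega)
  have z33 : ∀ R : ℤ, Odd R → AC f (3:ℕ) R (3:ℕ) = 0 := by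
    intro R hR
    by_cases hb : R ∈ oddR 3
    swap
    · have hJ := h.jac (M := (3:ℕ)) (by decide)
      simp only [oddR, mem_filter, mem_Icc, hR, and_true, not_and_or, not_le] at hb
      obtain ⟨r, rfl⟩ := hR
      rcases hb with hn | hn
      · refine hJ.shift0 1 ⟨r, rfl⟩ (lt3 3 (by decide) _ _ ⟨r + 3, ?_⟩ ⟨r + 3, ?_⟩ ?_) <;> push_cast at * <;> omega
      · refine hJ.shift0 (-1) ⟨r, rfl⟩ (lt3 3 (by decide) _ _ ⟨2 - r, ?_⟩ ⟨r - 3, ?_⟩ ?_) <;> push_cast at * <;> omega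
    have hv : ∀ i, i < 13 ∨ 18 ≤ i → cmpo (AC f (3:ℕ) R (3:ℕ)) i = 0 := by
      rintro i (hi | hi)
      · exact c33 R hR i hi
      · exact o3 3 (by decide) R hR i (by omega)
    have hJ := h.jac (M := (3:ℕ)) (by decide)
    have fin : ∀ l N' R' : ℤ, l ≠ 0 → (3:ℕ) + l * R + l ^ 2 * (3:ℕ) = N' → R + 2 * l * (3:ℕ) = R' → (∀ i < 11, cmpo (AC f N' R' (3:ℕ)) i = 0) → AC f (3:ℕ) R (3:ℕ) = 0 := by
      intro l N' R' hl e1 e2 hw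
      obtain ⟨e, he, hh⟩ := hJ.shiftz l (3:ℕ) hR
      rw [e1, e2] at hh
      exact poly_kill _ _ hv hw l e (by exact_mod_cast hl) he (fun y => by rw [AC, hh]; simp [AC])
    have hR4 : R = -3 ∨ R = -1 ∨ R = 1 ∨ R = 3 := (by decide : ∀ R ∈ oddR 3, R = -3 ∨ R = -1 ∨ R = 1 ∨ R = 3) R hb
    rcases hR4 with rfl | rfl | rfl | rfl
    · exact fin 1 3 3 (by norm_num) (by norm_num) (by norm_num) fun i hi => c33 3 (by decide) i (by omega)
    · exact fin 1 5 5 (by norm_num) (by norm_num) (by norm_num) fun i hi => c53 5 (by decide) i (by omega)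
    · exact fin (-1) 5 (-5) (by norm_num) (by norm_num) (by norm_num) fun i hi => c53 (-5) (by decide) i (by omega)
    · exact fin (-1) 3 (-3) (by norm_num) (by norm_num) (by norm_num) fun i hi => c33 (-3) (by decide) i (by omega)
  have step : ∀ (M k : ℕ), (∀ N R : ℤ, Odd N → Odd R → N < k → AC f N R M = 0) → (Odd k → ∀ R : ℤ, Odd R → AC f k R M = 0) → ∀ N R : ℤ, Odd N → Odd R → N < ((k + 1 : ℕ)) → AC f N R M = 0 := by
    intro M k h1 h2 N R hN hR hl
    by_cases hk : N < k
    · exact h1 N R hN hR hk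
    · have : N = k := by push_cast at hl; omega
      subst this; exact h2 (by exact_mod_cast hN) R hR
  have l3 : ∀ N R : ℤ, Odd N → Odd R → N < (5:ℕ) → AC f N R (3:ℕ) = 0 :=
    step 3 4 (step 3 3 (lt3 3 (by decide)) fun _ => z33) (fun h => absurd h (by decide))
  have z53 : ∀ R : ℤ, Odd R → AC f (5:ℕ) R (3:ℕ) = 0 := by
    intro R hR
    refine cmp0 fun i => ?_
    by_cases hi : i < 11
    · exact c53 R hR i hi
    · exact h.ord (by decide) (by decide) l3 (by push_cast; omega) hR
  have a3 := h.ordall (M := 3) (N1 := 7) (by decide) (by omega) (step 3 6 (step 3 5 l3 fun _ => z53) fun h => absurd h (by decide))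
  have l5 : ∀ N R : ℤ, Odd N → Odd R → N < (5:ℕ) → AC f N R (5:ℕ) = 0 :=
    step 5 4 (step 5 3 (lt3 5 (by decide)) fun _ R hR => h.swap0 (by decide) (by decide) (a3 _ _ (by decide) hR)) (fun h => absurd h (by decide))
  have o5 : ∀ R : ℤ, Odd R → ∀ i, j + 7 < 30 + i → cmpo (AC f (5:ℕ) R (5:ℕ)) i = 0 := fun R hR i hi => h.ord (by decide) (by decide) l5 (by push_cast; omega) hR
  have z55 : ∀ R : ℤ, Odd R → AC f (5:ℕ) R (5:ℕ) = 0 := by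
    intro R hR
    refine cmp0 fun i => ?_
    by_cases hi : j + 7 < 30 + i
    · exact o5 R hR i hi
    · rw [h.cswap (by decide) (by decide) (by omega), o5 R hR _ (by omega), neg_zero]
  have a5 := h.ordall (M := 5) (N1 := 7) (by decide) (by omega) (step 5 6 (step 5 5 l5 fun _ => z55) fun h => absurd h (by decide))
  intro M
  induction M using Nat.strong_induction_on with
  | _ M ih =>
  intro hM
  by_cases hM7 : M < 7
  · have : M = 1 ∨ M = 3 ∨ M = 5 := by obtain ⟨m, rfl⟩ := hM; omega
    rcases this with rfl | rfl | rfl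
    · exact a1
    · exact a3
    · exact a5
  · refine h.ordall hM (N1 := M) (by omega) fun N R hN hR hl => ?_
    by_cases h0 : N < 0
    · exact h.koe hN hR (od hM) (Or.inr (Or.inl h0))
    lift N to ℕ using by omega
    exact h.swap0 hN (od hM) (ih N (by omega) (by exact_mod_cast hN) _ _ (od hM) hR)

lemma Form.fzero (h : Form j f) (h0 : ∀ M : ℕ, Odd M → ∀ N R : ℤ, Odd N → Odd R → AC f N R M = 0) {t z s : ℂ} (hD : DD t z s) : f t z s = 0 := by
  have hp : ∀ M : ℤ, Odd M → ∀ t z : ℂ, 0 < t.im → phi f M t z = 0 := by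
    intro M hM t z ht
    have hJ := h.jac hM
    have hpp : ∀ N : ℤ, Odd N → pp (phi f M) N z = 0 := by
      intro N hN
      ext i
      have hb : 4 * N * M ≤ ((((4 * N * M).natAbs : ℕ) : ℤ) + 1) ^ 2 := by
        have := Int.le_natAbs (a := 4 * N * M)
        nlinarith
      rw [h.pp_sum hN hM _ hb]
      refine sum_eq_zero fun R hR => ?_
      by_cases hM0 : M < 0
      · rw [h.koe hN (mem_oddR hR) hM (Or.inl hM0)]; simp
      · lift M to ℕ using by omega
        rw [h0 M (by exact_mod_cast hM) N R hN (mem_oddR hR)]; simp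
    refine ev_inj fun x y => ?_
    rw [ev_zero]
    have hAP : AP 0 (fun t => ev j (phi f M t z) x y) := by
      constructor
      · intro w hw
        simp only [← evL_apply]
        exact (evL j x y).differentiableAt.comp w (hJ.dt w z hw)
      · intro w hw
        simp only [hJ.T w z hw, ev_neg]
    refine hAP.zero 1 one_pos (fun N hN => ?_) t ht
    have := congrArg (fun v => ev j v x y) (hpp N hN)
    simp only [ev_zero] at this
    rw [← this, pp, ev_int, co]
    · refine integral_congr fun u _ => ?_
      simp only [ev_smul]; ring
    · refine Continuous.smul (f := fun v : ℝ => qq (-N) (v ⊹)) (by fun_prop) ?_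
      exact hJ.cc (by fun_prop) (by fun_prop) (by intro p; simp)
  have ht := hD.1
  refine ev_inj fun x y => ?_
  rw [ev_zero]
  have hAP : AP (z.im ^ 2 / t.im) (fun s => ev j (f t z s) x y) := by
    constructor
    · intro w hw
      simp only [← evL_apply]
      refine (evL j x y).differentiableAt.comp w ?_
      exact (h.d t z w ((DD_iff ht).2 hw)).comp w (f := fun s => (t, z, s)) (by fun_prop)
    · intro w hw
      simp only [h.Ts ((DD_iff ht).2 hw), ev_neg]
  refine hAP.zero (hgt t z) (by simp [hgt]) (fun N hN => ?_) s ((DD_iff ht).1 hD)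
  have := congrArg (fun v => ev j v x y) (hp N hN t z ht)
  simp only [ev_zero] at this
  rw [← this, phi, ev_int, co]
  · refine integral_congr fun u _ => ?_
    simp only [ev_smul]; ring
  · refine Continuous.smul (f := fun v : ℝ => qq (-N) (v + hgt t z * I)) (by fun_prop) ?_
    rw [continuous_iff_continuousAt]
    intro u
    exact (h.ca (show DD t z ((u:ℂ) + hgt t z * I) from (DD_iff ht).2 (by
      rw [show ((u:ℂ) + hgt t z * I).im = hgt t z by simp, hgt]; linarith))).comp (f := fun u : ℝ => ((t, z, (u:ℂ) + hgt t z * I) : ℂ × ℂ × ℂ)) (by fun_prop)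
end
end

section
section
variable {j : ℕ} {f g : ℂ → ℂ → ℂ → Vc j}

lemma int_lin {u v : ℝ → Vc j} (q : ℝ → ℂ) (hu : Continuous fun x => q x • u x) (hv : Continuous fun x => q x • v x) (a : ℂ) :
    ∫ x in (0:ℝ)..1, q x • (a • u x + v x) = a • (∫ x in (0:ℝ)..1, q x • u x) + ∫ x in (0:ℝ)..1, q x • v x := by
  rw [← integral_smul, ← intervalIntegral.integral_add]
  · refine integral_congr fun x _ => ?_
    simp only [smul_add, smul_comm a]
  · exact (hu.const_smul a).intervalIntegrable _ _
  · exact hv.intervalIntegrable _ _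

lemma Form.phi_c (h : Form j f) (M : ℤ) {t z : ℂ} (ht : 0 < t.im) : Continuous fun x : ℝ => qq (-M) (x + hgt t z * I) • f t z (x + hgt t z * I) := by
  refine Continuous.smul (f := fun v : ℝ => qq (-M) (v + hgt t z * I)) (by fun_prop) ?_
  rw [continuous_iff_continuousAt]
  intro u
  exact (h.ca (show DD t z ((u:ℂ) + hgt t z * I) from (DD_iff ht).2 (by
      rw [show ((u:ℂ) + hgt t z * I).im = hgt t z by simp, hgt]; linarith))).comp (f := fun u : ℝ => ((t, z, (u:ℂ) + hgt t z * I) : ℂ × ℂ × ℂ)) (by fun_prop)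

lemma Form.AC_lin (hf : Form j f) (hg : Form j g) (a : ℂ) (N R : ℤ) {M : ℤ} (hM : Odd M) :
    AC (fun t z s => a • f t z s + g t z s) N R M = a • AC f N R M + AC g N R M := by
  have h1 : ∀ t z : ℂ, 0 < t.im → phi (fun t z s => a • f t z s + g t z s) M t z = a • phi f M t z + phi g M t z := by
    intro t z ht
    exact int_lin (fun x => qq (-M) (x + hgt t z * I)) (hf.phi_c M ht) (hg.phi_c M ht) a
  have hp : ∀ {f : ℂ → ℂ → ℂ → Vc j} (h : Form j f) (z : ℂ), Continuous fun x : ℝ => qq (-N) (x ⊹) • phi f M (x ⊹) z := fun h z =>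
    Continuous.smul (f := fun v : ℝ => qq (-N) (v ⊹)) (by fun_prop) ((h.jac hM).cc (by fun_prop) (by fun_prop) (by intro p; simp))
  have h2 : ∀ z, pp (phi (fun t z s => a • f t z s + g t z s) M) N z = a • pp (phi f M) N z + pp (phi g M) N z := by
    intro z
    refine Eq.trans ?_ (int_lin (fun x => qq (-N) (x ⊹)) (hp hf z) (hp hg z) a)
    refine integral_congr fun x _ => ?_
    simp only [h1 _ z (show 0 < ((x:ℂ) ⊹).im by simp)]
  have hq : ∀ {f : ℂ → ℂ → ℂ → Vc j} (h : Form j f), Continuous fun u : ℝ => qq (-R) (u + (0:ℝ) * I) • pp (phi f M) N (u + (0:ℝ) * I) := fun h =>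
    Continuous.smul (f := fun v : ℝ => qq (-R) (v + (0:ℝ) * I)) (by fun_prop) (((h.jac hM).pp_cont N).comp (by fun_prop))
  rw [AC, aa]
  simp only [h2]
  exact int_lin (fun x => qq (-R) (x + (0:ℝ) * I)) (hq hf) (hq hg) a

lemma cmp_lin (a : ℂ) (v w : Vc j) (i : ℕ) : cmpo (a • v + w) i = a * cmpo v i + cmpo w i := by
  unfold cmpo; split_ifs <;> simp

lemma Form.xx_lin (hf : Form j f) (hg : Form j g) (a : ℂ) (n c : ℕ) :
    xx (fun t z s => a • f t z s + g t z s) n c = a * xx f n c + xx g n c := by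
  have : ∀ N, ww (fun t z s => a • f t z s + g t z s) N = a • ww f N + ww g N := by
    intro N
    ext i
    simp only [ww, Pi.add_apply, Pi.smul_apply, smul_eq_mul, hf.AC_lin hg a N 1 (M := 1) (by decide), cmp_lin, Finset.mul_sum, ← sum_add_distrib]
    refine sum_congr rfl fun l _ => by ring
  rw [xx, xx, xx, this, cmp_lin]; ring
end

lemma form_of {j : ℕ} (hj : Even j) {ε} (hε : IsEps ε) {F} (hF : IsSiegelCuspForm j 2 Sp4Z ε F) : Form j (fun t z s => F (mkH t z s)) := by
  refine ⟨hj, fun t z s hD => ?_, laws_of_form hε hF⟩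
  have h1 := hF.1 (mkH t z s) ((mkH_mem _ _ _).2 hD)
  have hm : DifferentiableAt ℂ (fun p : ℂ × ℂ × ℂ => mkH p.1 p.2.1 p.2.2) (t, z, s) := by
    rw [differentiableAt_pi]; intro a
    rw [differentiableAt_pi]; intro b
    fin_cases a <;> fin_cases b <;> simp [mkH] <;> fun_prop
  have ho : {p : ℂ × ℂ × ℂ | DD p.1 p.2.1 p.2.2} ∈ 𝓝 ((t, z, s) : ℂ × ℂ × ℂ) := by
    refine IsOpen.mem_nhds ?_ hD
    simp only [DD, ofPred_and]
    exact (isOpen_lt (by fun_prop) (by fun_prop)).inter (isOpen_lt (by fun_prop) (by fun_prop))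
  exact (DifferentiableWithinAt.comp (s := {p : ℂ × ℂ × ℂ | DD p.1 p.2.1 p.2.2}) (t := H2) (f := fun p : ℂ × ℂ × ℂ => mkH p.1 p.2.1 p.2.2) ((t, z, s) : ℂ × ℂ × ℂ) h1 hm.differentiableWithinAt (fun p hp => (mkH_mem _ _ _).2 hp)).differentiableAt ho

lemma upper {ε} (hε : IsEps ε) {g us : ℕ} (hg : g = 13 ∧ us = 1 ∨ g = 14 ∧ us = 1 ∨ g = 15 ∧ us = 2) :
    Module.Finite ℂ ↥(SiegelCusp (2 * g) 2 Sp4Z ε) ∧ Module.finrank ℂ ↥(SiegelCusp (2 * g) 2 Sp4Z ε) ≤ us := by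
  have hF : ∀ F : ↥(SiegelCusp (2 * g) 2 Sp4Z ε), Form (2 * g) (fun t z s => F.1 (mkH t z s)) := fun F => form_of (by simp) hε F.2
  have lin : ∀ (a : ℂ) (F G : ↥(SiegelCusp (2 * g) 2 Sp4Z ε)) (c : ℕ), xx (fun t z s => (a • F + G).1 (mkH t z s)) g c = a * xx (fun t z s => F.1 (mkH t z s)) g c + xx (fun t z s => G.1 (mkH t z s)) g c :=
    fun a F G c => (hF F).xx_lin (hF G) a g c
  let Φ : ↥(SiegelCusp (2 * g) 2 Sp4Z ε) →ₗ[ℂ] (Fin us → ℂ) :=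
    { toFun := fun F c => xx (fun t z s => F.1 (mkH t z s)) g c
      map_add' := fun F G => by
        ext c; have := lin 1 F G c; rwa [one_smul, one_mul] at this
      map_smul' := fun a F => by
        ext c
        have h0 := lin (-1) 0 0 c
        rw [smul_zero, add_zero] at h0
        have := lin a F 0 c
        rw [add_zero] at this
        simp only [RingHom.id_apply, Pi.smul_apply, smul_eq_mul]
        linear_combination this + h0 }
  have hi : Function.Injective Φ := by
    rw [← LinearMap.ker_eq_bot, LinearMap.ker_eq_bot']
    intro F h0
    have hx : ∀ s < us, xx (fun t z s => F.1 (mkH t z s)) g s = 0 := fun s hs => congr_fun h0 ⟨s, hs⟩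
    have h1 := (hF F).AC0 hg rfl hx
    have h2 := (hF F).allzero (by omega) (fun N R hN hR hl => h1 N R hN hR (by exact_mod_cast hl))
    ext τ : 2
    by_cases hτ : τ ∈ H2
    · have e := eq_mk hτ
      rw [e] at hτ ⊢
      exact (hF F).fzero h2 ((mkH_mem _ _ _).1 hτ)
    · exact F.2.2.2.2 τ hτ
  refine ⟨Module.Finite.of_injective Φ hi, ?_⟩
  have := LinearMap.finrank_le_finrank_of_injective hi
  rwa [Module.finrank_fin_fun] at this
end

section
abbrev I4 := ℤ × ℤ × ℤ × ℤ
abbrev C4 := ℂ × ℂ × ℂ × ℂ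

def cv (c : C4) (n : I4) : ℂ := c.1 * (n.1 / 2) + c.2.1 * (n.1 / 2 + n.2.1) +
  c.2.2.1 * (n.1 / 2 + n.2.2.1) + c.2.2.2 * (n.1 / 2 + n.2.2.2)
def bq (n m : I4) : ℝ := (n.1 / 2) * (m.1 / 2) + (n.1 / 2 + n.2.1) * (m.1 / 2 + m.2.1) +
  (n.1 / 2 + n.2.2.1) * (m.1 / 2 + m.2.2.1) + (n.1 / 2 + n.2.2.2) * (m.1 / 2 + m.2.2.2)
def szI (n : I4) : ℝ := |(n.1 : ℝ)| + |(n.2.1 : ℝ)| + |(n.2.2.1 : ℝ)| + |(n.2.2.2 : ℝ)|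
def nsq (n : I4) : ℝ := (n.1 : ℝ) ^ 2 + (n.2.1 : ℝ) ^ 2 + (n.2.2.1 : ℝ) ^ 2 + (n.2.2.2 : ℝ) ^ 2
def Kc (c : C4) : ℝ := ‖c.1‖ + ‖c.2.1‖ + ‖c.2.2.1‖ + ‖c.2.2.2‖
def MM (R δ : ℝ) (p : I4 × I4) : ℝ := rexp (R * (szI p.1 + szI p.2) - δ * (nsq p.1 + nsq p.2))

lemma sum1 (R : ℝ) {δ : ℝ} (h : 0 < δ) : Summable fun n : ℤ => rexp (R * |(n : ℝ)| - δ * (n : ℝ) ^ 2) := by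
  have := summable_pow_mul_jacobiTheta₂_term_bound (R / (2 * Real.pi)) (T := δ / Real.pi) (by positivity) 0
  refine this.congr fun n => ?_
  have hp := pi_ne_zero
  rw [pow_zero, one_mul]; congr 1; push_cast; field_simp; ring

lemma sum4 (R : ℝ) {δ : ℝ} (h : 0 < δ) : Summable fun n : I4 => rexp (R * szI n - δ * nsq n) := by
  have s := sum1 R h
  have p : ∀ {ι : Type} (f : ι → ℝ), 0 ≤ fun i => rexp (f i) := fun f i => (exp_pos _).le
  have s2 := s.mul_of_nonneg s (p _) (p _)
  have s3 := s.mul_of_nonneg s2 (p _) (fun i => by positivity)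
  have s4 := s.mul_of_nonneg s3 (p _) (fun i => by positivity)
  refine s4.congr fun n => ?_
  simp only [← Real.exp_add]; congr 1; simp only [szI, nsq]; ring

lemma sumM (R : ℝ) {δ : ℝ} (h : 0 < δ) : Summable (MM R δ) := by
  refine ((sum4 R h).mul_of_nonneg (sum4 R h) (fun i => (exp_pos _).le) (fun i => (exp_pos _).le)).congr fun n => ?_
  rw [← Real.exp_add, MM]; congr 1; ring

def EH (t z s : ℂ) (p : I4 × I4) : ℂ :=
  cexp (Real.pi * I * (t * bq p.1 p.1 + 2 * z * bq p.1 p.2 + s * bq p.2 p.2))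

lemma norm_EH (t z s p) : ‖EH t z s p‖ =
    rexp (-Real.pi * (t.im * bq p.1 p.1 + 2 * z.im * bq p.1 p.2 + s.im * bq p.2 p.2)) := by
  rw [EH, norm_exp]; congr 1; simp

lemma bq_nonneg (n) : 0 ≤ bq n n := by rw [bq]; nlinarith [mul_self_nonneg ((n.1:ℝ)/2), mul_self_nonneg ((n.1:ℝ)/2 + n.2.1), mul_self_nonneg ((n.1:ℝ)/2 + n.2.2.1), mul_self_nonneg ((n.1:ℝ)/2 + n.2.2.2)]

lemma nsq_le (n) : nsq n ≤ 10 * bq n n := by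
  rw [bq, nsq]
  nlinarith [sq_nonneg ((n.1:ℝ) + n.2.1), sq_nonneg ((n.1:ℝ) + n.2.2.1), sq_nonneg ((n.1:ℝ) + n.2.2.2), sq_nonneg ((n.1:ℝ)+ 2*n.2.1), sq_nonneg ((n.1:ℝ)+ 2*n.2.2.1), sq_nonneg ((n.1:ℝ)+ 2*n.2.2.2)]

def DDd (δ : ℝ) (t z s : ℂ) : Prop := DD (t - δ * I) z (s - δ * I)

lemma EH_le {δ : ℝ} (hδ : 0 < δ) {t z s} (h : DDd δ t z s) (p) : ‖EH t z s p‖ ≤ MM 0 (δ / 10) p := by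
  rw [norm_EH, MM, exp_le_exp]
  have h1 := h.1
  have h2 := h.2
  simp at h1 h2
  have key : ∀ v w : ℝ, 0 ≤ (t.im - δ) * (v * v) + 2 * z.im * (v * w) + (s.im - δ) * (w * w) := by
    intro v w
    have : 0 ≤ (t.im - δ) * ((t.im - δ) * (v * v) + 2 * z.im * (v * w) + (s.im - δ) * (w * w)) := by
      nlinarith [sq_nonneg ((t.im - δ) * v + z.im * w), mul_nonneg (sub_nonneg.2 h2.le) (mul_self_nonneg w)]
    exact nonneg_of_mul_nonneg_right this (by linarith)
  have k : δ * (bq p.1 p.1 + bq p.2 p.2) ≤ t.im * bq p.1 p.1 + 2 * z.im * bq p.1 p.2 + s.im * bq p.2 p.2 := by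
    have a := key ((p.1.1:ℝ)/2) (p.2.1/2)
    have b := key ((p.1.1:ℝ)/2+p.1.2.1) (p.2.1/2+p.2.2.1)
    have c := key ((p.1.1:ℝ)/2+p.1.2.2.1) (p.2.1/2+p.2.2.2.1)
    have d := key ((p.1.1:ℝ)/2+p.1.2.2.2) (p.2.1/2+p.2.2.2.2)
    simp only [bq]; linarith
  have n1 := nsq_le p.1
  have n2 := nsq_le p.2
  have b1 := bq_nonneg p.1
  have b2 := bq_nonneg p.2
  have hp := Real.pi_gt_three
  set Q := t.im * bq p.1 p.1 + 2 * z.im * bq p.1 p.2 + s.im * bq p.2 p.2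
  have : δ / 10 * (nsq p.1 + nsq p.2) ≤ δ * (bq p.1 p.1 + bq p.2 p.2) := by nlinarith
  have : 0 ≤ Q := le_trans (by positivity) k
  nlinarith

lemma DD.ex {t z s} (h : DD t z s) : ∃ δ > 0, DDd δ t z s := by
  have hp := h.pos
  have h2 := h.2
  set D := t.im * s.im - z.im ^ 2 with hD
  have hD0 : 0 < D := by rw [hD]; linarith
  refine ⟨min (t.im / 2) (D / (2 * (t.im + s.im))), by have := hp.1; have := hp.2; positivity, ?_, ?_⟩
  · have := min_le_left (t.im / 2) (D / (2 * (t.im + s.im)))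
    simp only [sub_im, mul_im, ofReal_re, I_im, ofReal_im, I_re]; linarith
  · have h3 := min_le_right (t.im / 2) (D / (2 * (t.im + s.im)))
    rw [le_div_iff₀ (by linarith)] at h3
    set d := min (t.im / 2) (D / (2 * (t.im + s.im)))
    simp only [sub_im, mul_im, ofReal_re, I_im, ofReal_im, I_re]
    nlinarith [sq_nonneg d]

lemma cv_le (c n) : ‖cv c n‖ ≤ Kc c * szI n := by
  have e : cv c n = (c.1 + c.2.1 + c.2.2.1 + c.2.2.2) * ((n.1 : ℝ) / 2 : ℝ) + c.2.1 * (n.2.1 : ℝ) + c.2.2.1 * (n.2.2.1 : ℝ) + c.2.2.2 * (n.2.2.2:ℝ) := by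
    rw [cv]; push_cast; ring
  have a := norm_add_le (c.1 + c.2.1 + c.2.2.1) c.2.2.2
  have b := norm_add_le (c.1 + c.2.1) c.2.2.1
  have d := norm_add_le (c.1) c.2.1
  rw [e]
  refine (norm_add_le _ _).trans ?_
  refine (add_le_add (norm_add_le _ _) le_rfl).trans ?_
  refine (add_le_add (add_le_add (norm_add_le _ _) le_rfl) le_rfl).trans ?_
  simp only [norm_mul, Complex.norm_real, norm_eq_abs, abs_div, abs_two, Kc, szI]
  have h0 := abs_nonneg (n.1 : ℝ)
  have h1 := abs_nonneg (n.2.1 : ℝ)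
  have h2 := abs_nonneg (n.2.2.1 : ℝ)
  have h3 := abs_nonneg (n.2.2.2 : ℝ)
  have g0 := norm_nonneg c.1
  have g1 := norm_nonneg c.2.1
  have g2 := norm_nonneg c.2.2.1
  have g3 := norm_nonneg c.2.2.2
  have := mul_le_mul_of_nonneg_right (a.trans (add_le_add (b.trans (add_le_add d le_rfl)) le_rfl)) h0
  nlinarith [mul_nonneg g0 h1, mul_nonneg g0 h2, mul_nonneg g0 h3, mul_nonneg g1 h0, mul_nonneg g1 h2, mul_nonneg g1 h3, mul_nonneg g2 h0, mul_nonneg g2 h1, mul_nonneg g2 h3, mul_nonneg g3 h0, mul_nonneg g3 h1, mul_nonneg g3 h2, mul_nonneg g0 h0]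

/- classes -/
abbrev Cl := ZMod 2 × ZMod 2
def cl (n : I4) : Cl := ((n.1 : ZMod 2), ((n.2.1 + n.2.2.1 + n.2.2.2 : ℤ) : ZMod 2))
def phiV (a b : Cl) : ℤ := if b = (0, 1) then (if a = (1, 0) then -1 else if a = (1, 1) then 1 else 0) else 0
def rotC (a : Cl) : Cl := (a.2, a.1 + a.2)
def phC (a b : Cl) : ℤ := phiV a b + phiV (rotC a) (rotC b) + phiV (rotC (rotC a)) (rotC (rotC b))
lemma phi_swap : ∀ a b, phC b a = - phC a b := by decide
lemma phi_add : ∀ a b, phC (a + b) b = - phC a b := by decide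
lemma phi_abs : ∀ a b, |phC a b| ≤ 1 := by decide
lemma phiV_abs : ∀ a b, |phiV a b| ≤ 1 := by decide
lemma phi_ne : ∀ a b, phC a b ≠ 0 → a.1 + a.1 * a.2 + a.2 = 1 ∧ b.1 + b.1 * b.2 + b.2 = 1 := by decide
lemma cl_add (n m) : cl (n + m) = cl n + cl m := by
  simp only [cl, fst_add, snd_add, Prod.mk_add_mk]; push_cast; congr 1; ring

def Nq (n : I4) : ℤ := n.1 ^ 2 + n.1 * (n.2.1 + n.2.2.1 + n.2.2.2) + n.2.1 ^ 2 + n.2.2.1 ^ 2 + n.2.2.2 ^ 2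
lemma bq_self (n) : bq n n = Nq n := by rw [bq, Nq]; push_cast; ring
lemma Nq_odd (n) (h : (cl n).1 + (cl n).1 * (cl n).2 + (cl n).2 = 1) : Odd (Nq n) := by
  rw [← ZMod.intCast_eq_one_iff_odd, ← h]
  have sq : ∀ a : ZMod 2, a ^ 2 = a := by decide
  simp only [cl, Nq]; push_cast; simp only [sq]; ring

def wf (p : I4 × I4) : ℂ := (phC (cl p.1) (cl p.2) : ℤ)
lemma wf_le (p) : ‖wf p‖ ≤ 1 := by
  rw [wf, norm_intCast]; exact_mod_cast phi_abs _ _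
lemma wf_ne {p} (h : wf p ≠ 0) : Odd (Nq p.1) ∧ Odd (Nq p.2) := by
  have := phi_ne _ _ (fun h' => h (by rw [wf, h', Int.cast_zero]))
  exact ⟨Nq_odd _ this.1, Nq_odd _ this.2⟩

/-- general summability -/
lemma term_le {δ : ℝ} (hδ : 0 < δ) {t z s} (h : DDd δ t z s) {w A : I4 × I4 → ℂ} (hw : ∀ p, ‖w p‖ ≤ 1) {C R : ℝ}
    (hA : ∀ p, ‖A p‖ ≤ C * rexp (R * (szI p.1 + szI p.2))) (p) :
    ‖w p * A p * EH t z s p‖ ≤ C * MM R (δ / 10) p := by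
  have e : MM R (δ / 10) p = rexp (R * (szI p.1 + szI p.2)) * MM 0 (δ / 10) p := by
    rw [MM, MM, ← Real.exp_add]; congr 1; ring
  rw [norm_mul, norm_mul, e, ← mul_assoc]
  refine mul_le_mul ?_ (EH_le hδ h p) (norm_nonneg _) ((norm_nonneg _).trans (hA p))
  calc _ ≤ 1 * ‖A p‖ := by gcongr; exact hw p
    _ ≤ _ := by rw [one_mul]; exact hA p

lemma term_summable {t z s} (h : DD t z s) {w A : I4 × I4 → ℂ} (hw : ∀ p, ‖w p‖ ≤ 1) {C R : ℝ}
    (hA : ∀ p, ‖A p‖ ≤ C * rexp (R * (szI p.1 + szI p.2))) :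
    Summable fun p => w p * A p * EH t z s p := by
  obtain ⟨δ, hδ, h'⟩ := h.ex
  exact Summable.of_norm_bounded ((sumM R (by positivity : 0 < δ / 10)).mul_left C) (term_le hδ h' hw hA)

lemma Kc_nonneg (c) : 0 ≤ Kc c := by rw [Kc]; positivity
lemma szI_nonneg (n) : 0 ≤ szI n := by rw [szI]; positivity

lemma mono_le (c : C4) (a b : ℕ) (p : I4 × I4) : ‖cv c p.1 ^ a * cv c p.2 ^ b‖ ≤
    (a.factorial * b.factorial : ℝ) * rexp (Kc c * (szI p.1 + szI p.2)) := by
  have key : ∀ (k : ℕ) n, ‖cv c n‖ ^ k ≤ k.factorial * rexp (Kc c * szI n) := by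
    intro k n
    have h := Real.pow_div_factorial_le_exp _ (mul_nonneg (Kc_nonneg c) (szI_nonneg n)) k
    rw [div_le_iff₀ (by positivity)] at h
    calc _ ≤ (Kc c * szI n) ^ k := by gcongr; exact cv_le c n
      _ ≤ _ := by rw [mul_comm (k.factorial : ℝ)]; exact h
  rw [norm_mul, norm_pow, norm_pow, mul_add, Real.exp_add]
  calc _ ≤ (a.factorial * rexp (Kc c * szI p.1)) * (b.factorial * rexp (Kc c * szI p.2)) :=
        mul_le_mul (key _ _) (key _ _) (by positivity) (by positivity)
    _ = _ := by ring

def XX (c : C4) (x y : ℂ) (p : I4 × I4) : ℂ := x * cv c p.1 + y * cv c p.2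
lemma XX_le (c x y p) : ‖XX c x y p‖ ≤ (‖x‖ + ‖y‖) * Kc c * (szI p.1 + szI p.2) := by
  refine (norm_add_le _ _).trans ?_
  rw [norm_mul, norm_mul]
  have := mul_le_mul_of_nonneg_left (cv_le c p.1) (norm_nonneg x)
  have := mul_le_mul_of_nonneg_left (cv_le c p.2) (norm_nonneg y)
  have := mul_nonneg (norm_nonneg x) (mul_nonneg (Kc_nonneg c) (szI_nonneg p.2))
  have := mul_nonneg (norm_nonneg y) (mul_nonneg (Kc_nonneg c) (szI_nonneg p.1))
  nlinarith
lemma exp_le_sz (c x y p) : ‖cexp (XX c x y p)‖ ≤ 1 * rexp ((‖x‖ + ‖y‖) * Kc c * (szI p.1 + szI p.2)) := by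
  rw [one_mul]
  refine (norm_exp_le_exp_norm _).trans (Real.exp_le_exp.2 (XX_le c x y p))

/-- the components -/
def fC (c : C4) (j : ℕ) (t z s : ℂ) (i : Fin (j + 1)) : ℂ :=
  (j.choose i) * ∑' p, wf p * (cv c p.1 ^ (j - (i : ℕ)) * cv c p.2 ^ (i : ℕ)) * EH t z s p
def Th (c : C4) (t z s x y : ℂ) : ℂ := ∑' p, wf p * cexp (XX c x y p) * EH t z s p

lemma mono_summable (c a b) {t z s} (h : DD t z s) :
    Summable fun p => wf p * (cv c p.1 ^ a * cv c p.2 ^ b) * EH t z s p :=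
  term_summable h wf_le (mono_le c a b)

lemma ev_fC (c j) {t z s} (h : DD t z s) (x y : ℂ) :
    ev j (fC c j t z s) x y = ∑' p, wf p * EH t z s p * XX c x y p ^ j := by
  have e : ∀ p, wf p * EH t z s p * XX c x y p ^ j = ∑ i : Fin (j + 1), (j.choose i * (x ^ (j - (i : ℕ)) * y ^ (i : ℕ)))
      * (wf p * (cv c p.1 ^ (j - (i : ℕ)) * cv c p.2 ^ (i : ℕ)) * EH t z s p) := by
    intro p
    rw [XX, add_comm (x * _), add_pow, ← Fin.sum_univ_eq_sum_range (fun m => (y * cv c p.2) ^ m * (x * cv c p.1) ^ (j - m) * (j.choose m)), Finset.mul_sum]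
    refine sum_congr rfl fun i _ => ?_
    rw [mul_pow, mul_pow]; ring
  simp_rw [e]
  rw [Summable.tsum_finsetSum fun i _ => (mono_summable c _ _ h).mul_left _, ev]
  refine sum_congr rfl fun i _ => ?_
  rw [tsum_mul_left, fC]; ring

/-- comparison of moments -/
lemma moments {ι : Type} (X Y : ι → ℂ) (K : ℂ) : ∀ (j : ℕ) (a b : ι → ℂ)
    (_ : ∀ R : ℝ, Summable fun i => ‖a i‖ * rexp (R * ‖X i‖))
    (_ : ∀ R : ℝ, Summable fun i => ‖b i‖ * rexp (R * ‖Y i‖))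
    (_ : ∀ α : ℂ, ∑' i, a i * cexp (α * X i) = K * ∑' i, b i * cexp (α * Y i)),
    ∑' i, a i * X i ^ j = K * ∑' i, b i * Y i ^ j := by
  have der : ∀ (a X : ι → ℂ) (_ : ∀ R : ℝ, Summable fun i => ‖a i‖ * rexp (R * ‖X i‖)) (α : ℂ),
      deriv (fun w => ∑' i, a i * cexp (w * X i)) α = ∑' i, (a i * X i) * cexp (α * X i) := by
    intro a X ha α
    have h := hasSum_deriv_of_summable_norm (F := fun i w => a i * cexp (w * X i)) (ha (‖α‖ + 1))
      (U := Metric.ball 0 (‖α‖ + 1)) (fun i => by fun_prop) Metric.isOpen_ball (fun i w hw => by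
        rw [norm_mul]
        gcongr
        refine (norm_exp_le_exp_norm _).trans (Real.exp_le_exp.2 ?_)
        rw [norm_mul]
        gcongr
        simpa using (mem_ball_zero_iff.1 hw).le) (z := α) (by simp)
    rw [← h.tsum_eq]
    refine tsum_congr fun i => ?_
    have : HasDerivAt (fun w => a i * cexp (w * X i)) (a i * (cexp (α * X i) * (1 * X i))) α :=
      (((hasDerivAt_id α).mul_const (X i)).cexp).const_mul (a i)
    rw [this.deriv]; ring
  have sm : ∀ (a X : ι → ℂ) (_ : ∀ R : ℝ, Summable fun i => ‖a i‖ * rexp (R * ‖X i‖)) (R : ℝ),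
      Summable fun i => ‖a i * X i‖ * rexp (R * ‖X i‖) := by
    intro a X ha R
    refine Summable.of_nonneg_of_le (fun i => by positivity) (fun i => ?_) (ha (R + 1))
    rw [norm_mul, mul_assoc, add_mul, one_mul, add_comm, Real.exp_add]
    gcongr
    have := Real.add_one_le_exp ‖X i‖
    linarith
  intro j
  induction j with
  | zero => intro a b _ _ h; simpa using h 0
  | succ j ih =>
    intro a b ha hb h
    have := ih (fun i => a i * X i) (fun i => b i * Y i) (sm a X ha) (sm b Y hb) (fun α => by
      rw [← der a X ha, ← der b Y hb, funext h]
      exact deriv_const_mul_field K)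
    simpa [pow_succ', mul_assoc] using this

lemma transfer (c c' j) {t z s t' z' s'} (h : DD t z s) (h' : DD t' z' s') {x y x' y' K : ℂ}
    (H : ∀ α : ℂ, Th c t' z' s' (α * x') (α * y') = K * Th c' t z s (α * x) (α * y)) :
    ev j (fC c j t' z' s') x' y' = K * ev j (fC c' j t z s) x y := by
  have sm : ∀ c {t z s} (_ : DD t z s) x y, ∀ R : ℝ, Summable fun p => ‖wf p * EH t z s p‖ * rexp (R * ‖XX c x y p‖) := by
    intro c t z s h x y R
    have := (term_summable h wf_le (A := fun p => (rexp (R * ‖XX c x y p‖) : ℝ)) (C := 1) (R := |R| * ((‖x‖ + ‖y‖) * Kc c)) (fun p => by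
      rw [Complex.norm_real, norm_eq_abs, abs_exp, one_mul, exp_le_exp, mul_assoc]
      exact mul_le_mul (le_abs_self R) (XX_le c x y p) (norm_nonneg _) (abs_nonneg _))).norm
    refine this.congr fun p => ?_
    simp only [norm_mul, Complex.norm_real, norm_eq_abs, abs_exp]; ring
  have hX : ∀ c x y α p, α * XX c x y p = XX c (α * x) (α * y) p := by intros; simp only [XX]; ring
  rw [ev_fC c j h', ev_fC c' j h]
  refine moments _ _ K j _ _ (sm c h' x' y') (sm c' h x y) fun α => ?_
  have := H α
  simp only [Th] at this
  simp_rw [hX]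
  simp only [mul_right_comm _ _ (EH _ _ _ _)] at this
  exact this
end

section
lemma exp_odd {N : ℤ} (h : Odd N) : cexp (Real.pi * I * N) = -1 := by
  obtain ⟨k, rfl⟩ := h
  rw [show (Real.pi * I * ((2 * k + 1 : ℤ) : ℂ)) = k * (2 * Real.pi * I) + Real.pi * I by push_cast; ring, exp_add,
    exp_int_mul_two_pi_mul_I, exp_pi_mul_I, one_mul]
lemma exp_even {N : ℤ} (h : Even N) : cexp (Real.pi * I * N) = 1 := by
  obtain ⟨k, rfl⟩ := h
  rw [show (Real.pi * I * ((k + k : ℤ) : ℂ)) = k * (2 * Real.pi * I) by push_cast; ring,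
    exp_int_mul_two_pi_mul_I]

lemma Th_T (c t z s x y) : Th c (t + 1) z s x y = (-1) * Th c t z s x y := by
  rw [Th, Th, ← tsum_mul_left]
  refine tsum_congr fun p => ?_
  by_cases h : wf p = 0
  · simp [h]
  · have : EH (t + 1) z s p = EH t z s p * cexp (Real.pi * I * (Nq p.1 : ℤ)) := by
      rw [EH, EH, ← exp_add, bq_self]; congr 1; push_cast; ring
    rw [this, exp_odd (wf_ne h).1]; ring

lemma Th_W (c t z s x y) : Th c s z t x y = (-1) * Th c t z s y x := by
  rw [Th, Th, ← (Equiv.prodComm I4 I4).tsum_eq, ← tsum_mul_left]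
  refine tsum_congr fun p => ?_
  have h1 : wf ((Equiv.prodComm I4 I4) p) = - wf p := by
    simp only [wf, prodComm_apply, fst_swap, snd_swap, phi_swap (cl p.1)]; push_cast; rfl
  have h2 : EH s z t ((Equiv.prodComm I4 I4) p) = EH t z s p := by
    simp only [EH, prodComm_apply, fst_swap, snd_swap, bq]; congr 1; push_cast; ring
  have h3 : XX c x y ((Equiv.prodComm I4 I4) p) = XX c y x p := by
    simp only [XX, prodComm_apply, fst_swap, snd_swap]; ring
  rw [h1, h2, h3]; ring

lemma cv_add (c n m) : cv c (n + m) = cv c n + cv c m := by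
  simp only [cv, fst_add, snd_add]; push_cast; ring

def shearE : I4 × I4 ≃ I4 × I4 where
  toFun p := (p.1 + p.2, p.2)
  invFun p := (p.1 - p.2, p.2)
  left_inv p := by simp
  right_inv p := by simp

lemma Th_U (c t z s x y) : Th c t (z + t) (s + 2 * z + t) x y = (-1) * Th c t z s x (y - x) := by
  rw [Th, Th, ← shearE.tsum_eq (fun p => wf p * cexp (XX c x (y - x) p) * EH t z s p), ← tsum_mul_left]
  refine tsum_congr fun p => ?_
  have h1 : wf (shearE p) = - wf p := by
    simp only [wf, shearE, coe_fn_mk, cl_add, phi_add]; push_cast; rfl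
  have h2 : EH t z s (shearE p) = EH t (z + t) (s + 2 * z + t) p := by
    simp only [EH, shearE, coe_fn_mk, bq, fst_add, snd_add]; congr 1; push_cast; ring
  have h3 : XX c x (y - x) (shearE p) = XX c x y p := by
    simp only [XX, shearE, coe_fn_mk, cv_add]; ring
  rw [h1, h2, h3]; ring

/- the theta factor -/
def thT (u t : ℂ) (m : ℤ) : ℂ := cexp (Real.pi * I * (m + t * (m + 1 / 2) ^ 2 + 2 * (m + 1 / 2) * u))
def th1 (u t : ℂ) : ℂ := ∑' m, thT u t m

lemma thT_eq (u t m) : thT u t m = cexp (Real.pi * I * (t / 4 + u)) * jacobiTheta₂_term m (u + 1 / 2 + t / 2) t := by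
  rw [thT, jacobiTheta₂_term, ← exp_add]; congr 1; ring

lemma thT_sum (u) {t : ℂ} (h : 0 < t.im) : Summable fun m => ‖thT u t m‖ := by
  simp_rw [thT_eq]
  exact (((summable_jacobiTheta₂_term_iff _ _).2 h).mul_left _).norm

lemma th1_eq (u t) : th1 u t = cexp (Real.pi * I * (t / 4 + u)) * jacobiTheta₂ (u + 1 / 2 + t / 2) t := by
  simp_rw [th1, thT_eq, tsum_mul_left]; rfl

lemma th1_S (u) {t : ℂ} (h : t ≠ 0) : th1 (u / t) (-1 / t) =
    (-I * (-I * t) ^ (1 / 2 : ℂ)) * cexp (Real.pi * I * (u ^ 2 / t)) * th1 u t := by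
  have fe := jacobiTheta₂_functional_equation (u + t / 2 - 1 / 2) t
  have per := jacobiTheta₂_add_left (u + t / 2 - 1 / 2) t
  rw [show u + t / 2 - 1 / 2 + 1 = u + 1 / 2 + t / 2 by ring] at per
  have hz : (u + t / 2 - 1 / 2) / t = u / t + 1 / 2 + (-1 / t) / 2 := by field_simp; ring
  rw [hz] at fe
  have hk : (-I * t) ^ (1 / 2 : ℂ) ≠ 0 := by
    rw [Ne, cpow_eq_zero_iff]; simp [h]
  rw [th1_eq, th1_eq, per, fe]
  set J := jacobiTheta₂ (u / t + 1 / 2 + (-1 / t) / 2) (-1 / t)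
  have hI : -I = cexp (Real.pi * I * (-(1 / 2))) := by
    rw [show Real.pi * I * (-(1 / 2)) = -(Real.pi / 2 * I) by ring, Complex.exp_neg, exp_pi_div_two_mul_I, inv_I]
  have e : cexp (Real.pi * I * (-1 / t / 4 + u / t)) = -I * cexp (Real.pi * I * (u ^ 2 / t)) *
      cexp (Real.pi * I * (t / 4 + u)) * cexp (-Real.pi * I * (u + t / 2 - 1 / 2) ^ 2 / t) := by
    rw [hI, ← exp_add, ← exp_add, ← exp_add]; congr 1; field_simp; ring
  rw [e]
  field_simp

lemma kappa4 (t : ℂ) : (-I * (-I * t) ^ (1 / 2 : ℂ)) ^ 4 = - t ^ 2 := by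
  have h : ((-I * t) ^ (1 / 2 : ℂ)) ^ 2 = -I * t := by
    rw [show (1 / 2 : ℂ) = ((2 : ℕ) : ℂ)⁻¹ by norm_num, cpow_nat_inv_pow _ two_ne_zero]
  have h4 : (-I * (-I * t) ^ (1 / 2 : ℂ)) ^ 4 = I ^ 4 * (((-I * t) ^ (1 / 2 : ℂ)) ^ 2) ^ 2 := by ring
  rw [h4, h, Complex.I_pow_four]
  ring_nf; rw [Complex.I_sq]; ring

/- the V part -/
def wV (p : I4 × I4) : ℂ := (phiV (cl p.1) (cl p.2) : ℤ)
lemma wV_le (p) : ‖wV p‖ ≤ 1 := by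
  rw [wV, norm_intCast]; exact_mod_cast phiV_abs _ _
def GV (c : C4) (t z s x y : ℂ) : ℂ := ∑' p, wV p * cexp (XX c x y p) * EH t z s p

def embI (m : I4) : I4 := (2 * m.1 + 1, m.2.1 - m.1, m.2.2.1 - m.1, m.2.2.2 - m.1)
lemma embI_inj : Function.Injective embI := by
  rintro ⟨a, b, c, d⟩ ⟨a', b', c', d'⟩ h
  simp only [embI, Prod.mk.injEq] at h ⊢
  omega

lemma wV_emb {n : I4} (hn : cl n = (0, 1)) (m : I4) : wV (embI m, n) = - cexp (Real.pi * I * (m.1 + m.2.1 + m.2.2.1 + m.2.2.2 : ℤ)) := by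
  have h1 : cl (embI m) = (1, ((m.1 + m.2.1 + m.2.2.1 + m.2.2.2 : ℤ) : ZMod 2)) := by
    have h2 : (2 : ZMod 2) = 0 := by decide
    simp only [cl, embI, Prod.mk.injEq]; push_cast
    exact ⟨by linear_combination (m.1 : ZMod 2) * h2, by linear_combination (-2 * m.1 : ZMod 2) * h2⟩
  rcases Int.even_or_odd (m.1 + m.2.1 + m.2.2.1 + m.2.2.2) with h | h
  · rw [wV, hn, h1, exp_even h, (ZMod.intCast_eq_zero_iff_even).2 h]; simp [phiV]
  · rw [wV, hn, h1, exp_odd h, (ZMod.intCast_eq_one_iff_odd).2 h]; simp [phiV]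

lemma tsum4 {a b c d : ℤ → ℂ} (ha : Summable fun m => ‖a m‖) (hb : Summable fun m => ‖b m‖) (hc : Summable fun m => ‖c m‖)
    (hd : Summable fun m => ‖d m‖) : ∑' m : I4, a m.1 * (b m.2.1 * (c m.2.2.1 * d m.2.2.2)) =
    (∑' m, a m) * ((∑' m, b m) * ((∑' m, c m) * ∑' m, d m)) := by
  have h1 := hc.mul_norm hd
  have h2 := hb.mul_norm h1
  rw [tsum_mul_tsum_of_summable_norm hc hd, tsum_mul_tsum_of_summable_norm hb h1, tsum_mul_tsum_of_summable_norm ha h2]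

def uu (c : C4) (z x : ℂ) (n : I4) : C4 := (z * (n.1 / 2) + x * c.1 / (2 * Real.pi * I),
  z * (n.1 / 2 + n.2.1) + x * c.2.1 / (2 * Real.pi * I), z * (n.1 / 2 + n.2.2.1) + x * c.2.2.1 / (2 * Real.pi * I),
  z * (n.1 / 2 + n.2.2.2) + x * c.2.2.2 / (2 * Real.pi * I))

lemma inner_eq (c : C4) {t : ℂ} (ht : 0 < t.im) (z s x y : ℂ) {n : I4} (hn : cl n = (0, 1)) :
    ∑' m, wV (m, n) * cexp (XX c x y (m, n)) * EH t z s (m, n) =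
    - cexp (y * cv c n + Real.pi * I * s * bq n n) * (th1 (uu c z x n).1 t * (th1 (uu c z x n).2.1 t *
      (th1 (uu c z x n).2.2.1 t * th1 (uu c z x n).2.2.2 t))) := by
  rw [← embI_inj.tsum_eq]
  · rw [th1, th1, th1, th1, ← tsum4 (thT_sum _ ht) (thT_sum _ ht) (thT_sum _ ht) (thT_sum _ ht), ← tsum_mul_left]
    refine tsum_congr fun m => ?_
    rw [wV_emb hn, neg_mul, neg_mul, neg_mul]
    simp only [EH, thT, ← exp_add]
    congr 2
    simp only [uu, XX, cv, bq, embI]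
    have := pi_ne_zero
    push_cast; field_simp; ring
  · intro m hm
    have h : cl m ≠ (0, 0) ∧ cl m ≠ (0, 1) := by
      constructor <;> intro h <;> apply hm <;> simp [wV, hn, h, phiV]
    have hodd : Odd m.1 := by
      rw [← Int.not_even_iff_odd, ← ZMod.intCast_eq_zero_iff_even]
      intro h0
      have : ∀ a : ZMod 2, a = 0 ∨ a = 1 := by decide
      rcases this (cl m).2 with h1 | h1
      · exact h.1 (Prod.ext h0 h1)
      · exact h.2 (Prod.ext h0 h1)
    obtain ⟨k, hk⟩ := hodd
    refine ⟨(k, m.2.1 + k, m.2.2.1 + k, m.2.2.2 + k), ?_⟩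
    ext <;> simp [embI, hk]

def iso (c : C4) : Prop := c.1 ^ 2 + c.2.1 ^ 2 + c.2.2.1 ^ 2 + c.2.2.2 ^ 2 = 0

lemma GV_iter (c : C4) {t z s : ℂ} (h : DD t z s) (x y) :
    GV c t z s x y = ∑' n, ∑' m, wV (m, n) * cexp (XX c x y (m, n)) * EH t z s (m, n) := by
  have sm := term_summable h wV_le (exp_le_sz c x y)
  have sm' := (Equiv.prodComm I4 I4).summable_iff.2 sm
  rw [GV, ← (Equiv.prodComm I4 I4).tsum_eq]
  exact sm'.tsum_prod

lemma GV_S {c : C4} (hc : iso c) {t z s : ℂ} (h : DD t z s) (x y) :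
    GV c (-1 / t) (z / t) (s - z ^ 2 / t) x y = - t ^ 2 * GV c t z s (t * x) (y + z * x) := by
  rw [GV_iter c h, GV_iter c h.S, ← tsum_mul_left]
  refine tsum_congr fun n => ?_
  by_cases hn : cl n = (0, 1)
  · rw [inner_eq c h.1 _ _ _ _ hn, inner_eq c h.S.1 _ _ _ _ hn]
    have ht := h.ne
    have e : uu c (z / t) x n = ((uu c z (t * x) n).1 / t, (uu c z (t * x) n).2.1 / t, (uu c z (t * x) n).2.2.1 / t, (uu c z (t * x) n).2.2.2 / t) := by
      have := pi_ne_zero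
      simp only [uu]; ext <;> simp only <;> field_simp
    rw [e]
    simp only [th1_S _ ht]
    rw [← kappa4 t]
    have e2 : cexp (y * cv c n + Real.pi * I * (s - z ^ 2 / t) * bq n n) * (cexp (Real.pi * I * ((uu c z (t * x) n).1 ^ 2 / t)) *
      cexp (Real.pi * I * ((uu c z (t * x) n).2.1 ^ 2 / t)) * cexp (Real.pi * I * ((uu c z (t * x) n).2.2.1 ^ 2 / t)) *
      cexp (Real.pi * I * ((uu c z (t * x) n).2.2.2 ^ 2 / t))) = cexp ((y + z * x) * cv c n + Real.pi * I * s * bq n n) := by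
      simp only [← exp_add]
      congr 1
      simp only [uu, cv, bq]
      have := pi_ne_zero
      have hc' := hc
      rw [iso] at hc'
      push_cast
      field_simp
      linear_combination (t ^ 2 * x ^ 2) * hc'
    rw [← e2]; ring
  · have : ∀ m, wV (m, n) = 0 := fun m => by simp [wV, phiV, hn]
    simp [this]

def rotI (n : I4) : I4 := (-(2 * n.1 + n.2.1 + n.2.2.1 + n.2.2.2), n.1 + n.2.2.2, n.1 + n.2.1, n.1 + n.2.2.1)
def rotB (c : C4) : C4 := ((-c.1 + c.2.1 + c.2.2.1 + c.2.2.2) / 2, (-c.1 - c.2.1 + c.2.2.1 - c.2.2.2) / 2,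
  (-c.1 - c.2.1 - c.2.2.1 + c.2.2.2) / 2, (-c.1 + c.2.1 - c.2.2.1 - c.2.2.2) / 2)
lemma rotI3 (n) : rotI (rotI (rotI n)) = n := by
  ext <;> simp only [rotI] <;> ring
lemma rotI_cl (n) : cl (rotI n) = rotC (cl n) := by
  have h2 : (2 : ZMod 2) = 0 := by decide
  simp only [cl, rotI, rotC, Prod.mk.injEq]; push_cast
  exact ⟨by linear_combination (-n.1 - n.2.1 - n.2.2.1 - n.2.2.2 : ZMod 2) * h2, by linear_combination (n.1 : ZMod 2) * h2⟩
lemma rotB_iso {c} (h : iso c) : iso (rotB c) := by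
  rw [iso] at *; simp only [rotB]; linear_combination h
lemma cv_rot (c n) : cv c (rotI n) = cv (rotB c) n := by
  simp only [cv, rotB, rotI]; push_cast; ring
lemma bq_rot (n m) : bq (rotI n) (rotI m) = bq n m := by
  simp only [bq, rotI]; push_cast; ring
def rotE : I4 × I4 ≃ I4 × I4 where
  toFun p := (rotI p.1, rotI p.2)
  invFun p := (rotI (rotI p.1), rotI (rotI p.2))
  left_inv p := by simp [rotI3]
  right_inv p := by simp [rotI3]

lemma rot_term (c t z s x y p) : cexp (XX c x y (rotE p)) * EH t z s (rotE p) = cexp (XX (rotB c) x y p) * EH t z s p := by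
  simp only [XX, EH, rotE, coe_fn_mk, cv_rot, bq_rot]

lemma Th_split (c) {t z s} (h : DD t z s) (x y) : Th c t z s x y =
    GV c t z s x y + GV (rotB c) t z s x y + GV (rotB (rotB c)) t z s x y := by
  have sm := fun c => term_summable h wV_le (exp_le_sz c x y)
  have key : ∀ (w : I4 × I4 → ℂ) c, ∑' p, w p * cexp (XX (rotB c) x y p) * EH t z s p =
      ∑' p, w (rotE.symm p) * cexp (XX c x y p) * EH t z s p := by
    intro w c
    rw [← rotE.tsum_eq (fun p => w (rotE.symm p) * cexp (XX c x y p) * EH t z s p)]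
    refine tsum_congr fun p => ?_
    rw [mul_assoc, mul_assoc, rot_term, Equiv.symm_apply_apply]
  have sk : ∀ (w : I4 × I4 → ℂ) (_ : ∀ p, ‖w p‖ ≤ 1), Summable fun p => w p * cexp (XX c x y p) * EH t z s p :=
    fun w hw => term_summable h hw (exp_le_sz c x y)
  rw [GV, GV, GV, key, key _ (rotB c), key _ c, ← Summable.tsum_add (sk _ wV_le) (sk _ fun p => wV_le _),
    ← Summable.tsum_add ((sk _ wV_le).add (sk _ fun p => wV_le _)) (sk _ fun p => wV_le _), Th]
  refine tsum_congr fun p => ?_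
  have : wf p = wV p + wV (rotE.symm p) + wV (rotE.symm (rotE.symm p)) := by
    simp only [wf, wV, rotE, Equiv.coe_fn_symm_mk, phC, rotI_cl]
    have : ∀ a, rotC (rotC (rotC a)) = a := by decide
    rw [this, this]; push_cast; ring
  rw [this]; ring

lemma Th_S {c : C4} (hc : iso c) {t z s : ℂ} (h : DD t z s) (x y) :
    Th c (-1 / t) (z / t) (s - z ^ 2 / t) x y = - t ^ 2 * Th c t z s (t * x) (y + z * x) := by
  rw [Th_split c h, Th_split c h.S, GV_S hc h, GV_S (rotB_iso hc) h, GV_S (rotB_iso (rotB_iso hc)) h]; ring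

lemma laws_fC {c : C4} (hc : iso c) (j : ℕ) : Laws j (fC c j) := by
  refine ⟨fun t z s h => ?_, fun t z s h x y => ?_, fun t z s h x y => ?_, fun t z s h x y => ?_⟩
  · refine ev_ext fun y => ?_
    rw [ev_neg, transfer c c j h h.T (K := -1) (x := 1) (y := y) fun α => Th_T ..]; ring
  · rw [transfer c c j h h.W (K := -1) (x := y) (y := x) fun α => Th_W ..]; ring
  · rw [transfer c c j h h.U (K := -1) (x := x) (y := y - x) fun α => by rw [Th_U]; ring_nf]; ring
  · exact transfer c c j h h.S fun α => by rw [Th_S hc h]; ring_nf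
end

section
def prj (i j : Fin 2) : (Fin 2 → Fin 2 → ℂ) →L[ℂ] ℂ :=
  (ContinuousLinearMap.proj (R := ℂ) (φ := fun _ : Fin 2 => ℂ) j).comp (ContinuousLinearMap.proj (R := ℂ) (φ := fun _ : Fin 2 => Fin 2 → ℂ) i)
lemma prj_apply (i j τ) : prj i j τ = τ i j := rfl

def LL (p : I4 × I4) : (Fin 2 → Fin 2 → ℂ) →L[ℂ] ℂ :=
  ((Real.pi * I : ℂ)) • ((bq p.1 p.1 : ℂ) • prj 0 0 + (2 * bq p.1 p.2 : ℂ) • prj 0 1 + (bq p.2 p.2 : ℂ) • prj 1 1)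
lemma EH_LL (τ p) : EH (τ 0 0) (τ 0 1) (τ 1 1) p = cexp (LL p τ) := by
  rw [EH]; congr 1
  simp only [LL, _root_.smul_apply, _root_.add_apply, prj_apply, smul_eq_mul]; ring

lemma bq_le (n m) : |bq n m| ≤ 4 * (szI n * szI m) := by
  have g : ∀ (n : I4), |(n.1 : ℝ) / 2| ≤ szI n ∧ |(n.1 : ℝ) / 2 + n.2.1| ≤ szI n ∧ |(n.1 : ℝ) / 2 + n.2.2.1| ≤ szI n ∧ |(n.1 : ℝ) / 2 + n.2.2.2| ≤ szI n := by
    intro n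
    have h0 := abs_nonneg (n.1 : ℝ)
    have h1 := abs_nonneg (n.2.1 : ℝ)
    have h2 := abs_nonneg (n.2.2.1 : ℝ)
    have h3 := abs_nonneg (n.2.2.2 : ℝ)
    have e : |(n.1 : ℝ) / 2| = |(n.1 : ℝ)| / 2 := by rw [abs_div, abs_two]
    have a1 := abs_add_le ((n.1 : ℝ) / 2) n.2.1
    have a2 := abs_add_le ((n.1 : ℝ) / 2) n.2.2.1
    have a3 := abs_add_le ((n.1 : ℝ) / 2) n.2.2.2
    simp only [szI]
    refine ⟨by linarith, by linarith, by linarith, by linarith⟩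
  obtain ⟨a0, a1, a2, a3⟩ := g n
  obtain ⟨b0, b1, b2, b3⟩ := g m
  have k : ∀ {x y a b : ℝ}, |x| ≤ a → |y| ≤ b → |x * y| ≤ a * b := by
    intro x y a b h1 h2
    rw [abs_mul]; exact mul_le_mul h1 h2 (abs_nonneg _) ((abs_nonneg _).trans h1)
  rw [bq]
  refine (abs_add_le _ _).trans ((add_le_add (abs_add_le _ _) le_rfl).trans ((add_le_add (add_le_add (abs_add_le _ _) le_rfl) le_rfl).trans ?_))
  have := k a0 b0
  have := k a1 b1
  have := k a2 b2
  have := k a3 b3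
  linarith

lemma LL_le (p) : ‖LL p‖ ≤ 8 * Real.pi * rexp (szI p.1 + szI p.2) := by
  refine ContinuousLinearMap.opNorm_le_bound _ (by positivity) fun τ => ?_
  have hn : ∀ i j, ‖τ i j‖ ≤ ‖τ‖ := fun i j => (norm_le_pi_norm (τ i) j).trans (norm_le_pi_norm τ i)
  simp only [LL, _root_.smul_apply, _root_.add_apply, prj_apply, smul_eq_mul]
  rw [norm_mul, norm_mul, norm_I, Complex.norm_real, norm_eq_abs, abs_of_pos pi_pos, mul_one]
  have h1 : ‖(bq p.1 p.1 : ℂ) * τ 0 0 + 2 * bq p.1 p.2 * τ 0 1 + bq p.2 p.2 * τ 1 1‖ ≤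
      |bq p.1 p.1| * ‖τ‖ + 2 * |bq p.1 p.2| * ‖τ‖ + |bq p.2 p.2| * ‖τ‖ := by
    refine (norm_add_le _ _).trans (add_le_add ((norm_add_le _ _).trans (add_le_add ?_ ?_)) ?_) <;>
    · simp only [norm_mul, Complex.norm_real, norm_eq_abs, Complex.norm_two]
      gcongr
      exact hn _ _
  have e := Real.pow_div_factorial_le_exp _ (add_nonneg (szI_nonneg p.1) (szI_nonneg p.2)) 2
  rw [div_le_iff₀ (by positivity)] at e
  simp at e
  have b1 := bq_le p.1 p.1
  have b2 := bq_le p.1 p.2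
  have b3 := bq_le p.2 p.2
  have h2 : |bq p.1 p.1| + 2 * |bq p.1 p.2| + |bq p.2 p.2| ≤ 8 * rexp (szI p.1 + szI p.2) := by nlinarith
  calc _ ≤ Real.pi * (|bq p.1 p.1| * ‖τ‖ + 2 * |bq p.1 p.2| * ‖τ‖ + |bq p.2 p.2| * ‖τ‖) := by gcongr
    _ = Real.pi * ((|bq p.1 p.1| + 2 * |bq p.1 p.2| + |bq p.2 p.2|) * ‖τ‖) := by ring
    _ ≤ Real.pi * ((8 * rexp (szI p.1 + szI p.2)) * ‖τ‖) := by gcongr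
    _ = _ := by ring

lemma fC_diff (c j) (i : Fin (j + 1)) {τ : Fin 2 → Fin 2 → ℂ} (hτ : DD (τ 0 0) (τ 0 1) (τ 1 1)) :
    DifferentiableAt ℂ (fun τ : Fin 2 → Fin 2 → ℂ => fC c j (τ 0 0) (τ 0 1) (τ 1 1) i) τ := by
  obtain ⟨δ, hδ, h⟩ := hτ.ex
  have hop : IsOpen {σ : Fin 2 → Fin 2 → ℂ | DDd δ (σ 0 0) (σ 0 1) (σ 1 1)} := by
    simp only [DDd, DD, ofPred_and]
    refine IsOpen.inter ?_ ?_ <;> apply isOpen_lt <;> fun_prop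
  obtain ⟨r, hr, hb⟩ := Metric.isOpen_iff.1 hop τ h
  set a := fun p : I4 × I4 => wf p * (cv c p.1 ^ (j - (i : ℕ)) * cv c p.2 ^ (i : ℕ))
  set C : ℝ := ((j - (i : ℕ)).factorial * (i : ℕ).factorial : ℝ)
  have H := hasFDerivAt_tsum_of_isPreconnected (𝕜 := ℂ) (u := fun p => C * (8 * Real.pi) * MM (Kc c + 1) (δ / 10) p) (f := fun p (σ : Fin 2 → Fin 2 → ℂ) => a p * EH (σ 0 0) (σ 0 1) (σ 1 1) p)
    (f' := fun p σ => a p • (cexp (LL p σ) • LL p)) (x := τ) (x₀ := τ) ((sumM _ (by positivity)).mul_left _) Metric.isOpen_ball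
    (convex_ball τ r).isPreconnected (fun p σ hσ => by
      simp_rw [EH_LL]
      exact ((LL p).hasFDerivAt.cexp).const_mul (a p)) (fun p σ hσ => by
      have k := term_le hδ (hb hσ) wf_le (mono_le c (j - (i : ℕ)) i) p
      rw [EH_LL, norm_mul] at k
      rw [norm_smul, norm_smul, ← mul_assoc]
      refine (mul_le_mul k (LL_le p) (norm_nonneg _) ((mul_nonneg (norm_nonneg _) (norm_nonneg _)).trans k)).trans (le_of_eq ?_)
      have e : MM (Kc c + 1) (δ / 10) p = MM (Kc c) (δ / 10) p * rexp (szI p.1 + szI p.2) := by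
        rw [MM, MM, ← Real.exp_add]; congr 1; ring
      rw [e]; ring) (Metric.mem_ball_self hr) (mono_summable c _ _ hτ) (Metric.mem_ball_self hr)
  exact H.differentiableAt.const_mul _

open Classical in
def FF (c : C4) (j : ℕ) (τ : Fin 2 → Fin 2 → ℂ) : Vc j :=
  if τ ∈ H2 then fC c j (τ 0 0) (τ 0 1) (τ 1 1) else 0

lemma FF_mk (c j) {t z s} (h : DD t z s) : FF c j (mkH t z s) = fC c j t z s := by
  rw [FF, if_pos ((mkH_mem _ _ _).2 h)]; rfl

lemma laws_FF {c} (hc : iso c) (j) : Laws j (fun t z s => FF c j (mkH t z s)) := by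
  have L := laws_fC hc j
  refine ⟨fun t z s h => ?_, fun t z s h x y => ?_, fun t z s h x y => ?_, fun t z s h x y => ?_⟩
  · simp only [FF_mk c j h, FF_mk c j h.T]; exact L.T _ _ _ h
  · simp only [FF_mk c j h, FF_mk c j h.W]; exact L.W _ _ _ h _ _
  · simp only [FF_mk c j h, FF_mk c j h.U]; exact L.U _ _ _ h _ _
  · simp only [FF_mk c j h, FF_mk c j h.S]; exact L.S _ _ _ h _ _

lemma one_le_bq {p} (h : wf p ≠ 0) : 1 ≤ bq p.1 p.1 ∧ 1 ≤ bq p.2 p.2 := by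
  have k : ∀ n, Odd (Nq n) → 1 ≤ bq n n := by
    intro n hn
    have h0 := bq_nonneg n
    rw [bq_self] at h0 ⊢
    have h1 : 0 ≤ Nq n := by exact_mod_cast h0
    obtain ⟨k, hk⟩ := hn
    exact_mod_cast (by omega : 1 ≤ Nq n)
  exact ⟨k _ (wf_ne h).1, k _ (wf_ne h).2⟩

lemma DD_diag {t s : ℂ} (h : 0 < t.im) (h' : 0 < s.im) : DD t 0 s := ⟨h, by simpa using mul_pos h h'⟩

lemma fC_cusp (c j) {t : ℂ} (ht : 0 < t.im) : Tendsto (fun u : ℝ => fC c j t 0 (u * I)) atTop (𝓝 0) := by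
  rw [tendsto_pi_nhds]
  intro i
  have sm := (mono_summable c (j - (i : ℕ)) i (DD_diag ht (by simp : 0 < I.im))).norm
  suffices H : Tendsto (fun u : ℝ => ∑' p, wf p * (cv c p.1 ^ (j - (i : ℕ)) * cv c p.2 ^ (i : ℕ)) * EH t 0 (u * I) p) atTop (𝓝 0) by
    have := H.const_mul ((j.choose i : ℕ) : ℂ)
    rwa [mul_zero] at this
  rw [tendsto_zero_iff_norm_tendsto_zero]
  have lim : Tendsto (fun u : ℝ => rexp (-(Real.pi * (u - 1))) * ∑' p, ‖wf p * (cv c p.1 ^ (j - (i : ℕ)) * cv c p.2 ^ (i : ℕ)) * EH t 0 I p‖) atTop (𝓝 0) := by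
    rw [← zero_mul (∑' p, ‖wf p * (cv c p.1 ^ (j - (i : ℕ)) * cv c p.2 ^ (i : ℕ)) * EH t 0 I p‖)]
    refine Tendsto.mul_const _ (Real.tendsto_exp_neg_atTop_nhds_zero.comp ?_)
    exact (tendsto_atTop_add_const_right _ _ tendsto_id).const_mul_atTop pi_pos
  refine squeeze_zero' (Eventually.of_forall fun u => norm_nonneg _) ?_ lim
  filter_upwards [eventually_ge_atTop 1] with u hu
  refine tsum_of_norm_bounded (sm.hasSum.mul_left _) fun p => ?_
  by_cases hw : wf p = 0
  · simp [hw]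
  · rw [norm_mul, norm_mul _ (EH t 0 I p), mul_left_comm (rexp _)]
    gcongr
    rw [norm_EH, norm_EH, ← Real.exp_add, exp_le_exp]
    have := (one_le_bq hw).2
    have hp := pi_pos
    simp only [mul_im, ofReal_re, I_im, ofReal_im, I_re, zero_im]
    nlinarith [mul_nonneg (mul_nonneg hp.le (sub_nonneg.2 hu)) (sub_nonneg.2 this)]

lemma FF_form {c} (hc : iso c) (j) {ε} (hε : IsEps ε) : IsSiegelCuspForm j 2 Sp4Z ε (FF c j) := by
  have L := full_of_laws hε (laws_FF hc j)
  refine ⟨?_, fun γ hγ τ hτ => (L γ hγ τ hτ).2.2, fun γ hγ t ht => ?_, fun τ hτ => if_neg hτ⟩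
  · have : ∀ τ ∈ H2, DifferentiableAt ℂ (fun τ : Fin 2 → Fin 2 → ℂ => fC c j (τ 0 0) (τ 0 1) (τ 1 1)) τ := by
      intro τ hτ
      rw [differentiableAt_pi]
      intro i
      refine fC_diff c j i ?_
      rw [eq_mk hτ, mkH_mem] at hτ; exact hτ
    refine DifferentiableOn.congr (fun τ hτ => (this τ hτ).differentiableWithinAt) fun τ hτ => if_pos hτ
  · have e : ∀ᶠ u : ℝ in atTop, ε γ • fC c j t 0 (u * I) = slashS j 2 γ (FF c j) (diagH t (u * I)) := by
      filter_upwards [eventually_gt_atTop 0] with u hu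
      have hd : DD t 0 (u * I) := DD_diag ht (by simpa using hu)
      have ed : diagH t (u * I) = mkH t 0 (u * I) := by
        ext a b; fin_cases a <;> fin_cases b <;> simp [diagH, mkH]
      have hm := (mkH_mem _ _ _).2 hd
      rw [ed]
      obtain ⟨h1, -, h3⟩ := L γ hγ _ hm
      rw [slashS, h3, FF_mk c j hd, wt, symAct_smul, symAct_smul, ← symAct_mul, nonsing_inv_mul _ h1, symAct_one, smul_comm, smul_smul, smul_smul, mul_assoc,
        ← zpow_add₀ h1.ne_zero]
      simp
    refine Tendsto.congr' e ?_
    have := (fC_cusp c j ht).const_smul (ε γ)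
    rwa [smul_zero] at this
end

section
def gmul (a b : ℤ × ℤ) : ℤ × ℤ := (a.1 * b.1 - a.2 * b.2, a.1 * b.2 + a.2 * b.1)
def gpow (a : ℤ × ℤ) : ℕ → ℤ × ℤ
  | 0 => (1, 0)
  | k + 1 => gmul (gpow a k) a
def toC : ℤ × ℤ →+ ℂ where
  toFun a := a.1 + a.2 * I
  map_zero' := by simp
  map_add' a b := by simp only [fst_add, snd_add]; push_cast; ring
lemma toC_apply (a) : toC a = a.1 + a.2 * I := rfl
lemma toC_mul (a b) : toC (gmul a b) = toC a * toC b := by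
  simp only [toC_apply, gmul]; push_cast; linear_combination (-a.2 * b.2 : ℂ) * I_sq
lemma toC_pow (a k) : toC (gpow a k) = toC a ^ k := by
  induction k with
  | zero => simp [gpow, toC_apply]
  | succ k ih => rw [gpow, toC_mul, ih, pow_succ]
lemma toC_inj {a b} (h : toC a = toC b) : a = b := by
  simp only [toC_apply] at h
  have h1 := congrArg Complex.re h
  have h2 := congrArg Complex.im h
  simp at h1 h2
  exact Prod.ext h1 h2

def cC (c : I4) : C4 := (c.1, c.2.1, c.2.2.1, c.2.2.2 * I)
def cg (c n : I4) : ℤ × ℤ := (c.1 * n.1 + c.2.1 * (n.1 + 2 * n.2.1) + c.2.2.1 * (n.1 + 2 * n.2.2.1), c.2.2.2 * (n.1 + 2 * n.2.2.2))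
lemma cg_eq (c n) : cv (cC c) n = toC (cg c n) / 2 := by
  simp only [cv, cC, toC_apply, cg]; push_cast; ring
def bx : Finset I4 := (Finset.Icc (-2) 2 ×ˢ Finset.Icc (-2) 2 ×ˢ Finset.Icc (-2) 2 ×ˢ Finset.Icc (-2) 2).filter fun n => Nq n = 1
lemma mem_bx {n} : n ∈ bx ↔ Nq n = 1 := by
  refine ⟨fun h => (Finset.mem_filter.1 h).2, fun h => Finset.mem_filter.2 ⟨?_, h⟩⟩
  rw [Nq] at h
  have k : n.1 ^ 2 + (n.1 + 2 * n.2.1) ^ 2 + (n.1 + 2 * n.2.2.1) ^ 2 + (n.1 + 2 * n.2.2.2) ^ 2 = 4 := by linear_combination 4 * h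
  have s : ∀ x : ℤ, x ^ 2 ≤ 4 → -2 ≤ x ∧ x ≤ 2 := fun x hx => ⟨by nlinarith, by nlinarith⟩
  have s0 := sq_nonneg n.1
  have s1 := sq_nonneg (n.1 + 2 * n.2.1)
  have s2 := sq_nonneg (n.1 + 2 * n.2.2.1)
  have s3 := sq_nonneg (n.1 + 2 * n.2.2.2)
  have t0 := s _ (by linarith : n.1 ^ 2 ≤ 4)
  have t1 := s _ (by linarith : (n.1 + 2 * n.2.1) ^ 2 ≤ 4)
  have t2 := s _ (by linarith : (n.1 + 2 * n.2.2.1) ^ 2 ≤ 4)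
  have t3 := s _ (by linarith : (n.1 + 2 * n.2.2.2) ^ 2 ≤ 4)
  simp only [mem_product, mem_Icc]
  omega

def VV (c : I4) (j i : ℕ) : ℤ × ℤ := ∑ n ∈ bx, ∑ m ∈ bx, gmul (phC (cl n) (cl m), 0) (gmul (gpow (cg c n) (j - i)) (gpow (cg c m) i))

lemma lead (c : I4) (j : ℕ) (i : Fin (j + 1)) : Tendsto (fun T : ℝ => (rexp (2 * Real.pi * T) : ℂ) * FF (cC c) j (mkH (T * I) 0 (T * I)) i) atTop
    (𝓝 ((j.choose i) * (toC (VV c j i) / 2 ^ j))) := by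
  set a := fun p : I4 × I4 => wf p * (cv (cC c) p.1 ^ (j - (i : ℕ)) * cv (cC c) p.2 ^ (i : ℕ)) with ha
  have sm := ((mono_summable (cC c) (j - (i : ℕ)) i (DD_diag (by simp : 0 < I.im) (by simp : 0 < I.im))).norm).mul_left (rexp (2 * Real.pi))
  have eE : ∀ (T : ℝ) p, (rexp (2 * Real.pi * T) : ℂ) * EH (T * I) 0 (T * I) p = (rexp (-(Real.pi * (bq p.1 p.1 + bq p.2 p.2 - 2) * T)) : ℝ) := by
    intro T p
    rw [EH, ofReal_exp, ofReal_exp, ← exp_add]; congr 1; push_cast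
    linear_combination (Real.pi * T * bq p.1 p.1 + Real.pi * T * bq p.2 p.2 : ℂ) * I_sq
  have lim : Tendsto (fun T : ℝ => ∑' p, a p * (rexp (-(Real.pi * (bq p.1 p.1 + bq p.2 p.2 - 2) * T)) : ℝ)) atTop
      (𝓝 (∑' p, a p * (if p ∈ bx ×ˢ bx then 1 else 0))) := by
    refine tendsto_tsum_of_dominated_convergence (bound := fun p => rexp (2 * Real.pi) * ‖a p * EH I 0 I p‖) sm (fun p => ?_) ?_
    · by_cases hw : wf p = 0
      · simp [ha, hw]
      refine Tendsto.const_mul _ ?_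
      obtain ⟨h1, h2⟩ := one_le_bq hw
      by_cases hp : p ∈ bx ×ˢ bx
      · rw [if_pos hp]
        rw [mem_product, mem_bx, mem_bx] at hp
        simp only [bq_self, hp.1, hp.2]
        norm_num
      · rw [if_neg hp, ← Complex.ofReal_zero]
        refine (Complex.continuous_ofReal.tendsto 0).comp (Real.tendsto_exp_neg_atTop_nhds_zero.comp ?_)
        refine tendsto_id.const_mul_atTop (mul_pos pi_pos ?_)
        rw [bq_self] at h1 h2 ⊢
        rw [bq_self]
        rw [mem_product, mem_bx, mem_bx] at hp
        have h1' : 1 ≤ Nq p.1 := by exact_mod_cast h1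
        have h2' : 1 ≤ Nq p.2 := by exact_mod_cast h2
        have : 0 < Nq p.1 + Nq p.2 - 2 := by omega
        exact_mod_cast this
    · filter_upwards [eventually_ge_atTop 1] with T hT p
      by_cases hw : wf p = 0
      · simp [ha, hw]
      obtain ⟨h1, h2⟩ := one_le_bq hw
      have e1 := eE 1 p
      rw [Complex.ofReal_one, one_mul, mul_one, mul_one] at e1
      have : rexp (2 * Real.pi) * ‖a p * EH I 0 I p‖ = ‖a p‖ * rexp (-(Real.pi * (bq p.1 p.1 + bq p.2 p.2 - 2))) := by
        have e2 := congrArg norm e1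
        rw [norm_mul, Complex.norm_real, Complex.norm_real, norm_eq_abs, norm_eq_abs, abs_exp, abs_exp] at e2
        rw [norm_mul, ← e2]; ring
      rw [this, norm_mul, Complex.norm_real, norm_eq_abs, abs_exp]
      have hq : 0 ≤ bq p.1 p.1 + bq p.2 p.2 - 2 := by linarith
      exact mul_le_mul_of_nonneg_left (Real.exp_le_exp.2 (neg_le_neg (le_mul_of_one_le_right (mul_nonneg Real.pi_pos.le hq) hT))) (norm_nonneg _)
  have val : ∑' p, a p * (if p ∈ bx ×ˢ bx then 1 else 0) = toC (VV c j i) / 2 ^ j := by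
    rw [tsum_eq_sum (s := bx ×ˢ bx) (fun p hp => by rw [if_neg hp, mul_zero]), VV, map_sum, Finset.sum_product, Finset.sum_div]
    refine sum_congr rfl fun n hn => ?_
    rw [map_sum, Finset.sum_div]
    refine sum_congr rfl fun m hm => ?_
    rw [if_pos (Finset.mem_product.2 ⟨hn, hm⟩), mul_one, ha]
    have e2 : (2 : ℂ) ^ j = 2 ^ (j - (i : ℕ)) * 2 ^ (i : ℕ) := by
      rw [← pow_add]; congr 1; have := i.isLt; omega
    simp only [toC_mul, toC_pow, cg_eq, wf, toC_apply (phC _ _, 0), div_pow, e2]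
    push_cast; field_simp; ring
  rw [val] at lim
  refine (lim.const_mul (j.choose i : ℂ)).congr' ?_
  filter_upwards [eventually_gt_atTop 0] with T hT
  have hd : DD (T * I) 0 (T * I) := DD_diag (by simpa using hT) (by simpa using hT)
  rw [FF_mk _ _ hd, fC, mul_left_comm]
  congr 1
  rw [← tsum_mul_left]
  refine tsum_congr fun p => ?_
  rw [mul_left_comm, eE]

lemma iso_cC {c : I4} (h : c.1 ^ 2 + c.2.1 ^ 2 + c.2.2.1 ^ 2 = c.2.2.2 ^ 2) : iso (cC c) := by
  have : (c.1 ^ 2 + c.2.1 ^ 2 + c.2.2.1 ^ 2 : ℂ) = c.2.2.2 ^ 2 := by exact_mod_cast h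
  rw [iso]; simp only [cC]; linear_combination this + (c.2.2.2 : ℂ) ^ 2 * I_sq

/-- vanishing combinations force vanishing leading terms -/
lemma lead_zero {c d : I4} {j : ℕ} {a b : ℂ} (h : a • FF (cC c) j + b • FF (cC d) j = 0) (i : Fin (j + 1)) :
    a * toC (VV c j i) + b * toC (VV d j i) = 0 := by
  have l := ((lead c j i).const_mul a).add ((lead d j i).const_mul b)
  have z : ∀ T : ℝ, a * ((rexp (2 * Real.pi * T) : ℂ) * FF (cC c) j (mkH (T * I) 0 (T * I)) i) +
      b * ((rexp (2 * Real.pi * T) : ℂ) * FF (cC d) j (mkH (T * I) 0 (T * I)) i) = 0 := by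
    intro T
    have := congrFun (congrFun h (mkH (T * I) 0 (T * I))) i
    simp only [Pi.add_apply, Pi.smul_apply, smul_eq_mul, Pi.zero_apply] at this
    linear_combination (rexp (2 * Real.pi * T) : ℂ) * this
  have u := tendsto_nhds_unique (l.congr z) tendsto_const_nhds
  have hc : ((j.choose i : ℕ) : ℂ) ≠ 0 := by
    exact_mod_cast (Nat.choose_pos (by have := i.isLt; omega)).ne'
  have h2 : (2 : ℂ) ^ j ≠ 0 := pow_ne_zero _ two_ne_zero
  field_simp at u
  simpa [hc] using u

lemma VV26 : VV (1, 2, 2, 3) 26 4 ≠ 0 := by decide +kernel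
lemma VV28 : VV (1, 2, 2, 3) 28 4 ≠ 0 := by decide +kernel
lemma VV30 : gmul (VV (1, 2, 2, 3) 30 4) (VV (2, 3, 6, 7) 30 8) - gmul (VV (1, 2, 2, 3) 30 8) (VV (2, 3, 6, 7) 30 4) ≠ 0 := by decide +kernel

lemma lower1 {ε} (hε : IsEps ε) {j : ℕ} [Module.Finite ℂ ↥(SiegelCusp j 2 Sp4Z ε)] (i : Fin (j + 1)) (h : VV (1, 2, 2, 3) j i ≠ 0) :
    1 ≤ Module.finrank ℂ ↥(SiegelCusp j 2 Sp4Z ε) := by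
  rw [Nat.one_le_iff_ne_zero, ← Nat.pos_iff_ne_zero, Module.finrank_pos_iff_exists_ne_zero]
  refine ⟨⟨FF (cC (1, 2, 2, 3)) j, FF_form (iso_cC (by norm_num)) j hε⟩, fun h0 => h ?_⟩
  have h1 : FF (cC (1, 2, 2, 3)) j = 0 := congrArg Subtype.val h0
  have := lead_zero (c := (1, 2, 2, 3)) (d := (1, 2, 2, 3)) (j := j) (a := 1) (b := 0) (by rw [h1]; simp) i
  rw [one_mul, zero_mul, add_zero] at this
  exact toC_inj (this.trans (map_zero toC).symm)

lemma lower2 {ε} (hε : IsEps ε) [Module.Finite ℂ ↥(SiegelCusp 30 2 Sp4Z ε)] :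
    2 ≤ Module.finrank ℂ ↥(SiegelCusp 30 2 Sp4Z ε) := by
  let v : Fin 2 → ↥(SiegelCusp 30 2 Sp4Z ε) := ![⟨FF (cC (1, 2, 2, 3)) 30, FF_form (iso_cC (by norm_num)) 30 hε⟩,
    ⟨FF (cC (2, 3, 6, 7)) 30, FF_form (iso_cC (by norm_num)) 30 hε⟩]
  have hv : LinearIndependent ℂ v := by
    rw [LinearIndependent.pair_iff]
    intro a b h0
    have h : a • FF (cC (1, 2, 2, 3)) 30 + b • FF (cC (2, 3, 6, 7)) 30 = 0 := congrArg Subtype.val h0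
    have h4 := lead_zero h 4
    have h8 := lead_zero h 8
    have hD : toC (gmul (VV (1, 2, 2, 3) 30 4) (VV (2, 3, 6, 7) 30 8) - gmul (VV (1, 2, 2, 3) 30 8) (VV (2, 3, 6, 7) 30 4)) ≠ 0 :=
      fun h' => VV30 (toC_inj (h'.trans (map_zero toC).symm))
    rw [map_sub, toC_mul, toC_mul] at hD
    change a * toC (VV (1, 2, 2, 3) 30 4) + b * toC (VV (2, 3, 6, 7) 30 4) = 0 at h4
    change a * toC (VV (1, 2, 2, 3) 30 8) + b * toC (VV (2, 3, 6, 7) 30 8) = 0 at h8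
    constructor
    · refine (mul_eq_zero.1 ?_).resolve_right hD
      linear_combination toC (VV (2, 3, 6, 7) 30 8) * h4 - toC (VV (2, 3, 6, 7) 30 4) * h8
    · refine (mul_eq_zero.1 ?_).resolve_right hD
      linear_combination toC (VV (1, 2, 2, 3) 30 4) * h8 - toC (VV (1, 2, 2, 3) 30 8) * h4
  simpa using hv.fintype_card_le_finrank

theorem dim_S26_S28_S30_eps (ε : Matrix (Fin 4) (Fin 4) ℤ → ℂ) (hε : IsEps ε) :
    Module.finrank ℂ ↥(SiegelCusp 26 2 Sp4Z ε) = 1 ∧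
    Module.finrank ℂ ↥(SiegelCusp 28 2 Sp4Z ε) = 1 ∧
    Module.finrank ℂ ↥(SiegelCusp 30 2 Sp4Z ε) = 2 := by
  have u1 := upper (g := 13) (us := 1) hε (by simp)
  have u2 := upper (g := 14) (us := 1) hε (by simp)
  have u3 := upper (g := 15) (us := 2) hε (by simp)
  norm_num at u1 u2 u3
  have := u1.1
  have := u2.1
  have := u3.1
  exact ⟨le_antisymm u1.2 (lower1 hε 4 VV26), le_antisymm u2.2 (lower1 hε 4 VV28), le_antisymm u3.2 (lower2 hε)⟩
end
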